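/- Let H be a graph of order n with k components, each of which is an even cycle of length at least 6 (so n ≥ 6, k ≥ 1). Let G be a bipartite graph with bipartition (X,Y) such that |X| = |Y| ≥ n/2. If the minimum degree of G is at least n/2 − k + 1, then G contains a subdivision of H. -/

import Mathlib

/-- `φ` and `P` form a subdivision of `H` inside `G`: `φ` embeds the branch vertices,
each edge of `H` is replaced by a path of `G`, the interior vertices of these paths
avoid the branch vertices, and distinct paths meet only in common endpoints. -/
def SubdivisionSystem {α β : Type*} (H : SimpleGraph α) (G : SimpleGraph β)
    (φ : α ↪ β) (P : ∀ a b, H.Adj a b → G.Walk (φ a) (φ b)) : Prop :=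
  (∀ a b (h : H.Adj a b), (P a b h).IsPath) ∧
  (∀ a b (h : H.Adj a b) (c : β), c ∈ (P a b h).support →
      c ∉ Set.range φ ∨ c = φ a ∨ c = φ b) ∧
  (∀ a b (h : H.Adj a b) (a' b' : α) (h' : H.Adj a' b'),
      s(a, b) ≠ s(a', b') → ∀ c : β,
        c ∈ (P a b h).support → c ∈ (P a' b' h').support →
          (c = φ a ∨ c = φ b) ∧ (c = φ a' ∨ c = φ b'))

/-- `G` contains a subdivision of `H`. -/
def ContainsSubdivision {α β : Type*} (H : SimpleGraph α) (G : SimpleGraph β) : Prop :=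
  ∃ (φ : α ↪ β) (P : ∀ a b, H.Adj a b → G.Walk (φ a) (φ b)),
    SubdivisionSystem H G φ P


namespace SubdivEven

/-- `l` lists the vertices of a path of `G` from `a` to `b`. -/
structure Pth {V : Type*} (G : SimpleGraph V) (a b : V) (l : List V) : Prop where
  chain : l.IsChain G.Adj
  nodup : l.Nodup
  hd : l.head? = some a
  lst : l.getLast? = some b

/-- `l` lists the vertices of a cycle of `G`. -/
def CycL {V : Type*} (G : SimpleGraph V) (l : List V) : Prop :=
  ∃ a b, Pth G a b l ∧ G.Adj b a ∧ 3 ≤ l.length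

section basics
variable {V : Type*} {G : SimpleGraph V} {a b c d : V} {l l' : List V}

theorem Pth.single (a : V) : Pth G a a [a] :=
  ⟨List.isChain_singleton a, List.nodup_singleton a, rfl, rfl⟩

theorem Pth.ne_nil (h : Pth G a b l) : l ≠ [] := by
  rintro rfl; simpa using h.hd

theorem Pth.length_pos (h : Pth G a b l) : 0 < l.length :=
  List.length_pos_iff.2 h.ne_nil

theorem Pth.append (h : Pth G a b l) (h' : Pth G c d l') (hadj : G.Adj b c)
    (hdis : ∀ x ∈ l, x ∉ l') : Pth G a d (l ++ l') := by
  refine ⟨List.isChain_append.2 ⟨h.chain, h'.chain, ?_⟩, ?_, ?_, ?_⟩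
  · intro x hx y hy
    rw [h.lst] at hx; rw [h'.hd] at hy
    simp at hx hy; subst hx; subst hy; exact hadj
  · exact List.Nodup.append h.nodup h'.nodup (fun x hx hx' => hdis x hx hx')
  · rw [List.head?_append, h.hd]; rfl
  · rw [List.getLast?_append, h'.lst]; rfl

theorem Pth.cons (h' : Pth G c d l') (hadj : G.Adj a c)
    (hdis : a ∉ l') : Pth G a d (a :: l') :=
  (Pth.single a).append h' hadj (by simpa using hdis)

theorem Pth.reverse (h : Pth G a b l) : Pth G b a l.reverse := by
  refine ⟨?_, List.nodup_reverse.2 h.nodup, ?_, ?_⟩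
  · rw [List.isChain_reverse]
    exact h.chain.imp (fun _ _ hh => hh.symm)
  · rw [List.head?_reverse, h.lst]
  · rw [List.getLast?_reverse, h.hd]

theorem Pth.cyc (h : Pth G a b l) (hadj : G.Adj b a) (hl : 3 ≤ l.length) : CycL G l :=
  ⟨a, b, h, hadj, hl⟩

theorem Pth.getElem_zero (h : Pth G a b l) : l[0]'h.length_pos = a := by
  have := h.hd
  rw [List.head?_eq_getElem?, List.getElem?_eq_getElem h.length_pos] at this
  simpa using this

theorem Pth.getElem_last (h : Pth G a b l) :
    l[l.length - 1]'(by have := h.length_pos; omega) = b := by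
  have := h.lst
  rw [List.getLast?_eq_getElem?, List.getElem?_eq_getElem (by have := h.length_pos; omega)] at this
  simpa using this

theorem Pth.mem_left (h : Pth G a b l) : a ∈ l := by
  have := h.getElem_zero; rw [← this]; exact List.getElem_mem _

theorem Pth.mem_right (h : Pth G a b l) : b ∈ l := by
  have := h.getElem_last; rw [← this]; exact List.getElem_mem _

theorem Pth.adj (h : Pth G a b l) (i : ℕ) (hi : i + 1 < l.length) : G.Adj l[i] l[i+1] :=
  (List.isChain_iff_getElem.1 h.chain) i hi

theorem Pth.inj (h : Pth G a b l) {i j : ℕ} (hi : i < l.length) (hj : j < l.length)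
    (hij : l[i] = l[j]) : i = j :=
  (List.Nodup.getElem_inj_iff h.nodup).1 hij

/-- Segment of a path. -/
theorem Pth.seg (h : Pth G a b l) {i j : ℕ} (hij : i ≤ j) (hj : j < l.length) :
    ∃ s, Pth G (l[i]'(by omega)) l[j] s ∧ s.length = j - i + 1 ∧
      ∀ x ∈ s, ∃ t, ∃ ht : t < l.length, i ≤ t ∧ t ≤ j ∧ x = l[t] := by
  refine ⟨(l.drop i).take (j - i + 1), ⟨(h.chain.drop i).take _, ?_, ?_, ?_⟩, ?_, ?_⟩
  · exact (List.take_sublist _ _ |>.trans (List.drop_sublist _ _)).nodup h.nodup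
  · rw [List.head?_take, List.head?_drop]
    simp [List.getElem?_eq_getElem (show i < l.length by omega)]
  · rw [List.getLast?_eq_getElem?]
    have : ((l.drop i).take (j - i + 1)).length = j - i + 1 := by simp; omega
    rw [this, List.getElem?_take, List.getElem?_drop]
    have h2 : i + (j - i + 1 - 1) = j := by omega
    rw [h2]; simp [List.getElem?_eq_getElem hj]
  · simp; omega
  · intro x hx
    obtain ⟨t, ht, rfl⟩ := List.mem_iff_getElem.1 hx
    have ht' : t < j - i + 1 := by simp at ht; omega
    refine ⟨i + t, by omega, by omega, by omega, ?_⟩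
    simp

theorem CycL.nodup (h : CycL G l) : l.Nodup := by
  obtain ⟨a, b, h, -, -⟩ := h; exact h.nodup

theorem CycL.len (h : CycL G l) : 3 ≤ l.length := by
  obtain ⟨a, b, -, -, h⟩ := h; exact h

/-- A cycle can be rotated so as to start at any of its vertices. -/
theorem CycL.rot (h : CycL G l) {x : V} (hx : x ∈ l) :
    ∃ l' y, Pth G x y l' ∧ G.Adj y x ∧ l'.Perm l := by
  obtain ⟨a, b, h, hadj, hl⟩ := h
  obtain ⟨s, t, rfl⟩ := List.append_of_mem hx
  rcases List.eq_nil_or_concat s with rfl | ⟨s', z, rfl⟩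
  · have := h.hd
    obtain rfl : x = a := by simpa using this
    exact ⟨_, b, h, hadj, List.Perm.refl _⟩
  · have hc := List.isChain_append.1 h.chain
    have hnd := List.nodup_append.1 h.nodup
    have hps : Pth G a z (s' ++ [z]) := by
      refine ⟨by simpa using hc.1, by simpa using hnd.1, ?_, by simp⟩
      have := h.hd
      cases s' <;> simpa using this
    have hpt : Pth G x b (x :: t) := by
      refine ⟨hc.2.1, hnd.2.1, rfl, ?_⟩
      have := h.lst
      rw [List.getLast?_append] at this
      cases hh : (x :: t).getLast? with
      | none => simp at hh
      | some w => rw [hh] at this; simpa using this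
    refine ⟨(x :: t) ++ (s' ++ [z]), z, hpt.append hps hadj ?_, ?_, ?_⟩
    · intro y hy hy'
      exact hnd.2.2 y (by simpa using hy') y hy rfl
    · exact hc.2.2 z (by simp) x (by simp)
    · simpa using List.perm_append_comm (l₁ := x :: t) (l₂ := s' ++ [z])

theorem Pth.cyc_of_perm (h : Pth G a b l) (hadj : G.Adj b a) (hp : l.Perm l') (hl : 3 ≤ l'.length) :
    CycL G l := h.cyc hadj (by rw [hp.length_eq]; exact hl)

end basics

section color
variable {V : Type*} {G : SimpleGraph V} {a b c d : V} {l l' : List V} {col : V → Bool}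

theorem Pth.col_iff (h : Pth G a b l) (hcol : ∀ u v, G.Adj u v → col u ≠ col v)
    {i j : ℕ} (hi : i < l.length) (hj : j < l.length) :
    col l[i] = col l[j] ↔ i % 2 = j % 2 := by
  have key : ∀ i (hi : i < l.length), col l[i] = (col (l[0]'(by omega)) ^^ decide (i % 2 = 1)) := by
    intro i
    induction i with
    | zero => intro hi; simp
    | succ n ih =>
      intro hi
      have h1 := ih (by omega)
      have h2 := hcol _ _ (h.adj n hi)
      rw [h1] at h2
      rcases Nat.mod_two_eq_zero_or_one n with h3 | h3
      · have : (n + 1) % 2 = 1 := by omega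
        simp [h3, this] at h2 ⊢
        revert h2; cases col (l[0]'(by omega)) <;> cases col l[n+1] <;> simp
      · have : (n + 1) % 2 = 0 := by omega
        simp [h3, this] at h2 ⊢
        revert h2; cases col (l[0]'(by omega)) <;> cases col l[n+1] <;> simp
  rw [key i hi, key j hj]
  rcases Nat.mod_two_eq_zero_or_one i with h3 | h3 <;>
  rcases Nat.mod_two_eq_zero_or_one j with h4 | h4 <;>
  simp [h3, h4]

theorem CycL.even (h : CycL G l) (hcol : ∀ u v, G.Adj u v → col u ≠ col v) :
    l.length % 2 = 0 := by
  obtain ⟨a, b, h, hadj, hl⟩ := h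
  have h1 := h.col_iff hcol (i := 0) (j := l.length - 1) (by omega) (by omega)
  rw [h.getElem_zero, h.getElem_last] at h1
  have h2 := hcol _ _ hadj
  by_contra h3
  exact h2 (h1.2 (by omega)).symm

/-- Signed count. -/
def sg (col : V → Bool) (x : V) : ℤ := if col x then 1 else -1

theorem sg_ne {x y : V} (h : col x ≠ col y) : sg col x + sg col y = 0 := by
  unfold sg
  revert h
  cases col x <;> cases col y <;> simp

theorem chain_sum_even (hcol : ∀ u v, G.Adj u v → col u ≠ col v) :
    ∀ (n : ℕ) (l : List V), l.IsChain G.Adj → l.length = 2 * n → (l.map (sg col)).sum = 0 := by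
  intro n
  induction n with
  | zero => intro l _ hl; have : l = [] := by simpa using hl
            subst this; simp
  | succ n ih =>
    intro l hc hl
    match l, hc, hl with
    | x :: y :: t, hc, hl =>
      have h1 : t.IsChain G.Adj := hc.tail.tail
      have h2 : G.Adj x y := by simpa using (List.isChain_cons_cons.1 hc).1
      have := ih t h1 (by simp at hl; omega)
      have h3 := sg_ne (hcol _ _ h2)
      simp; omega
    | [], hc, hl => simp at hl
    | [x], hc, hl => simp at hl; omega

end color

end SubdivEven


namespace SubdivEven

open Finset

/-- number of neighbours of `v` inside `S`. -/
noncomputable def dg {V : Type*} (G : SimpleGraph V) (v : V) (S : Finset V) : ℕ := by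
  classical exact (S.filter (fun x => G.Adj v x)).card

open Classical in
/-- positions on the list `l` of the neighbours of `v`. -/
noncomputable def nbpos {V : Type*} (G : SimpleGraph V) (v : V) (l : List V) : Finset ℕ :=
  (Finset.range l.length).filter (fun i => ∃ h : i < l.length, G.Adj v l[i])

theorem spread (J : Finset ℕ) (hJ : J.Nonempty) (r : ℕ) (hp : ∀ t ∈ J, t % 2 = r) :
    ∃ i ∈ J, ∃ j ∈ J, i + 2 * J.card ≤ j + 2 ∧ ∀ t ∈ J, i ≤ t ∧ t ≤ j := by
  refine ⟨J.min' hJ, J.min'_mem hJ, J.max' hJ, J.max'_mem hJ, ?_, fun t ht =>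
    ⟨J.min'_le t ht, J.le_max' t ht⟩⟩
  set i := J.min' hJ with hi
  set j := J.max' hJ with hj
  have hij : i ≤ j := J.min'_le _ (J.max'_mem hJ)
  have hpi := hp i (J.min'_mem hJ)
  have hpj := hp j (J.max'_mem hJ)
  have hsub : J ⊆ (Finset.range ((j - i) / 2 + 1)).image (fun t => i + 2 * t) := by
    intro t ht
    have h1 := J.min'_le t ht
    have h2 := J.le_max' t ht
    have h3 := hp t ht
    rw [Finset.mem_image]
    refine ⟨(t - i) / 2, ?_, ?_⟩
    · rw [Finset.mem_range]; omega
    · omega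
  have := (Finset.card_le_card hsub).trans Finset.card_image_le
  rw [Finset.card_range] at this
  omega

section
variable {V : Type*} {G : SimpleGraph V} {a b c d v u : V} {l l' : List V} {col : V → Bool}

theorem mem_nbpos {i : ℕ} : i ∈ nbpos G v l ↔ ∃ h : i < l.length, G.Adj v l[i] := by
  classical
  unfold nbpos
  rw [Finset.mem_filter, Finset.mem_range]
  exact ⟨fun h => h.2, fun h => ⟨h.1, h⟩⟩

theorem card_nbpos [DecidableEq V] (hl : l.Nodup) : (nbpos G v l).card = dg G v l.toFinset := by
  classical
  unfold dg
  refine Finset.card_bij (fun i hi => l[i]'(mem_nbpos.1 hi).1) ?_ ?_ ?_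
  · intro i hi
    simp only [Finset.mem_filter, List.mem_toFinset]
    exact ⟨List.getElem_mem _, (mem_nbpos.1 hi).2⟩
  · intro i hi j hj hij
    exact (List.Nodup.getElem_inj_iff hl).1 hij
  · intro x hx
    simp only [Finset.mem_filter, List.mem_toFinset] at hx
    obtain ⟨i, hi, rfl⟩ := List.mem_iff_getElem.1 hx.1
    exact ⟨i, mem_nbpos.2 ⟨hi, hx.2⟩, rfl⟩

theorem nbpos_parity (h : Pth G a b l) (hcol : ∀ u v, G.Adj u v → col u ≠ col v) {i j : ℕ}
    (hi : i ∈ nbpos G v l) (hj : j ∈ nbpos G v l) : i % 2 = j % 2 := by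
  obtain ⟨hi1, hi2⟩ := mem_nbpos.1 hi
  obtain ⟨hj1, hj2⟩ := mem_nbpos.1 hj
  rw [← h.col_iff hcol hi1 hj1]
  have h1 := hcol _ _ hi2
  have h2 := hcol _ _ hj2
  revert h1 h2
  cases col v <;> cases col l[i] <;> cases col l[j] <;> simp

/-- Shortcut via an outside vertex, first case. -/
theorem shortcut_aux [DecidableEq V] {x y : V} (h : Pth G x y l) (hyx : G.Adj y x)
    (hcol : ∀ u v, G.Adj u v → col u ≠ col v) {m L : ℕ} (hL : l.length = 2 * L)
    (hv : v ∉ l) (hm : 3 ≤ m) (hd : m ≤ dg G v l.toFinset) (h0 : 0 ∈ nbpos G v l)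
    (h2 : 2 ∉ nbpos G v l) :
    ∃ l', CycL G l' ∧ 2 * m ≤ l'.length ∧ l'.length < 2 * L ∧ ∀ z ∈ l', z = v ∨ z ∈ l := by
  rw [← card_nbpos h.nodup] at hd
  set J := (nbpos G v l).erase 0 with hJ
  have hJc : J.card = (nbpos G v l).card - 1 := Finset.card_erase_of_mem h0
  have hJne : J.Nonempty := by rw [← Finset.card_pos]; omega
  have hpar : ∀ t ∈ J, t % 2 = 0 := by
    intro t ht
    exact nbpos_parity h hcol (Finset.mem_of_mem_erase ht) h0
  obtain ⟨i, hi, j, hj, hij, hb⟩ := spread J hJne 0 hpar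
  have hiJ := Finset.mem_erase.1 hi
  have hjJ := Finset.mem_erase.1 hj
  have hi2 : i ≠ 2 := fun hh => h2 (hh ▸ hiJ.2)
  have hip := hpar i hi
  have hjp := hpar j hj
  obtain ⟨hil, hiv⟩ := mem_nbpos.1 hiJ.2
  obtain ⟨hjl, hjv⟩ := mem_nbpos.1 hjJ.2
  obtain ⟨h0l, h0v⟩ := mem_nbpos.1 h0
  obtain ⟨s, hs, hsl, hsm⟩ := h.seg (i := i) (j := l.length - 1) (by omega) (by omega)
  rw [h.getElem_last] at hs
  rw [h.getElem_zero] at h0v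
  have hxs : x ∉ s := by
    intro hx
    obtain ⟨t, ht, ht1, ht2, hxt⟩ := hsm x hx
    have : l[0] = l[t] := by rw [h.getElem_zero]; exact hxt
    have := h.inj h0l ht this
    omega
  have hvs : ∀ z ∈ s, z ∈ l := by
    intro z hz
    obtain ⟨t, ht, ht1, ht2, hxt⟩ := hsm z hz
    rw [hxt]; exact List.getElem_mem _
  have hp1 : Pth G l[i] x (s ++ [x]) := hs.append (Pth.single x) hyx (by
    intro z hz hzx
    simp at hzx; subst hzx; exact hxs hz)
  have hp2 : Pth G v x (v :: (s ++ [x])) := hp1.cons hiv (by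
    simp only [List.mem_append, List.mem_singleton, not_or]
    exact ⟨fun hh => hv (hvs v hh), fun hh => hv (hh ▸ h.mem_left)⟩)
  refine ⟨_, hp2.cyc h0v.symm (by simp; omega), by simp; omega, by simp; omega, ?_⟩
  intro z hz
  simp only [List.mem_cons, List.mem_append, List.not_mem_nil, or_false] at hz
  rcases hz with hz | hz | hz
  · exact Or.inl hz
  · exact Or.inr (hvs z hz)
  · right; rw [hz]; exact h.mem_left

/-- If `v` outside a cycle of length `2L` has at least `m` neighbours on it and `L > m`, then we
find a strictly shorter cycle of length at least `2m`. -/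
theorem shortcut [DecidableEq V] (h : CycL G l)
    (hcol : ∀ u v, G.Adj u v → col u ≠ col v) {m L : ℕ} (hL : l.length = 2 * L)
    (hv : v ∉ l) (hm : 3 ≤ m) (hmL : m < L) (hd : m ≤ dg G v l.toFinset) :
    ∃ l', CycL G l' ∧ 2 * m ≤ l'.length ∧ l'.length < 2 * L ∧ ∀ z ∈ l', z = v ∨ z ∈ l := by
  by_contra hcon
  -- every neighbour on `l`, rotated, has its second successor a neighbour
  have main : ∀ x y l', Pth G x y l' → G.Adj y x → l'.Perm l → 0 ∈ nbpos G v l' →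
      2 ∈ nbpos G v l' := by
    intro x y l' hp hyx hperm h0
    by_contra h2
    obtain ⟨l'', h1, h3, h4, h5⟩ := shortcut_aux hp hyx hcol (m := m) (L := L)
      (by rw [hperm.length_eq, hL]) (by rw [hperm.mem_iff]; exact hv) hm
      (by rw [List.toFinset_eq_of_perm _ _ hperm]; exact hd) h0 h2
    exact hcon ⟨l'', h1, h3, h4, fun z hz => (h5 z hz).imp id (fun hh => hperm.mem_iff.1 hh)⟩
  have hne : (nbpos G v l).Nonempty := by
    rw [← Finset.card_pos, card_nbpos h.nodup]; omega
  obtain ⟨i, hi⟩ := hne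
  obtain ⟨hil, hiv⟩ := mem_nbpos.1 hi
  obtain ⟨l1, y, hp, hyx, hperm⟩ := h.rot (List.getElem_mem hil)
  have hlen := hperm.length_eq
  have h0 : 0 ∈ nbpos G v l1 := mem_nbpos.2 ⟨hp.length_pos, by rw [hp.getElem_zero]; exact hiv⟩
  have h2 := main _ _ _ hp hyx hperm h0
  obtain ⟨h2l, h2v⟩ := mem_nbpos.1 h2
  -- split rotated list at position 2
  have h4l : 4 < l1.length := by omega
  obtain ⟨s1, hs1, hs1l, hs1m⟩ := hp.seg (i := 2) (j := l1.length - 1) (by omega) (by omega)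
  obtain ⟨s, hs, hsl, hsm⟩ := hp.seg (i := 4) (j := l1.length - 1) (by omega) (by omega)
  -- rotate at position 2
  have hl1 : l1 = l1.take 2 ++ l1.drop 2 := (List.take_append_drop 2 l1).symm
  have hdrop : Pth G l1[2] y (l1.drop 2) := by
    refine ⟨hp.chain.drop 2, (List.drop_sublist _ _).nodup hp.nodup, ?_, ?_⟩
    · rw [List.head?_drop]; simp [List.getElem?_eq_getElem h2l]
    · rw [List.getLast?_drop, if_neg (by omega), hp.lst]
  have htake : Pth G l[i] l1[1] (l1.take 2) := by
    refine ⟨hp.chain.take 2, (List.take_sublist _ _).nodup hp.nodup, ?_, ?_⟩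
    · rw [List.head?_take]; simp [hp.hd]
    · rw [List.getLast?_take]; simp
  have hrot := hdrop.append htake hyx (by
    intro z hz hz'
    have := hp.nodup
    rw [hl1] at this
    exact (List.nodup_append.1 this).2.2 z hz' z hz rfl)
  have hrp : (l1.drop 2 ++ l1.take 2).Perm l := by
    refine (List.perm_append_comm).trans ?_
    rw [← hl1]; exact hperm
  have h4 := main _ _ _ hrot (hp.adj 1 h2l) hrp
    (mem_nbpos.2 ⟨hrot.length_pos, by rw [hrot.getElem_zero]; exact h2v⟩)
  obtain ⟨h4l', h4v⟩ := mem_nbpos.1 h4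
  have h4e : (l1.drop 2 ++ l1.take 2)[2] = l1[4] := by
    rw [List.getElem_append_left (by simp; omega)]
    simp
  rw [h4e] at h4v
  -- the cycle
  have hxs : l[i] ∉ s := by
    intro hx
    obtain ⟨t, ht, ht1, ht2, hxt⟩ := hsm _ hx
    have : l1[0] = l1[t] := by rw [hp.getElem_zero]; exact hxt
    have := hp.inj (by omega) ht this
    omega
  have hvs : ∀ z ∈ s, z ∈ l := by
    intro z hz
    obtain ⟨t, ht, ht1, ht2, hxt⟩ := hsm z hz
    rw [hxt]; exact hperm.mem_iff.1 (List.getElem_mem _)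
  rw [hp.getElem_last] at hs
  have hp1 := hs.append (Pth.single l[i]) hyx (by
    intro z hz hzx
    simp at hzx; subst hzx; exact hxs hz)
  have hp2 := hp1.cons h4v (by
    simp only [List.mem_append, List.mem_singleton, not_or]
    exact ⟨fun hh => hv (hvs v hh), fun hh => hv (hh ▸ List.getElem_mem _)⟩)
  refine hcon ⟨_, hp2.cyc hiv.symm (by simp; omega), by simp; omega, by simp; omega, ?_⟩
  intro z hz
  simp only [List.mem_cons, List.mem_append, List.not_mem_nil, or_false] at hz
  rcases hz with hz | hz | hz
  · exact Or.inl hz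
  · exact Or.inr (hvs z hz)
  · right; rw [hz]; exact List.getElem_mem _

/-- Chords: a vertex of a cycle of length `2L > 2m` with at least `m` neighbours on it. -/
theorem chord [DecidableEq V] (h : CycL G l)
    (hcol : ∀ u v, G.Adj u v → col u ≠ col v) {m L : ℕ} (hL : l.length = 2 * L)
    (hv : v ∈ l) (hm : 3 ≤ m) (hmL : m < L) (hd : m ≤ dg G v l.toFinset) :
    ∃ l', CycL G l' ∧ 2 * m ≤ l'.length ∧ l'.length < 2 * L ∧ ∀ z ∈ l', z ∈ l := by
  obtain ⟨l1, y, hp, hyx, hperm⟩ := h.rot hv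
  have hlen := hperm.length_eq
  rw [← List.toFinset_eq_of_perm _ _ hperm, ← card_nbpos hp.nodup] at hd
  have hpar : ∀ t ∈ nbpos G v l1, t % 2 = 1 := by
    intro t ht
    obtain ⟨htl, htv⟩ := mem_nbpos.1 ht
    have h1 := hcol _ _ htv
    rw [← hp.getElem_zero, Ne, hp.col_iff hcol hp.length_pos htl] at h1
    omega
  have hmem : ∀ t (ht : t < l1.length), l1[t] ∈ l := fun t ht => hperm.mem_iff.1 (List.getElem_mem _)
  by_cases h3 : 3 ∈ nbpos G v l1
  · obtain ⟨h3l, h3v⟩ := mem_nbpos.1 h3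
    obtain ⟨s, hs, hsl, hsm⟩ := hp.seg (i := 3) (j := l1.length - 1) (by omega) (by omega)
    rw [hp.getElem_last] at hs
    have := hs.cons h3v (by
      intro hx
      obtain ⟨t, ht, ht1, ht2, hxt⟩ := hsm _ hx
      have : l1[0] = l1[t] := by rw [hp.getElem_zero]; exact hxt
      have := hp.inj (by omega) ht this
      omega)
    refine ⟨_, this.cyc hyx (by simp; omega), by simp; omega, by simp; omega, ?_⟩
    intro z hz
    rcases List.mem_cons.1 hz with rfl | hz
    · exact hv
    · obtain ⟨t, ht, ht1, ht2, rfl⟩ := hsm _ hz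
      exact hmem t ht
  · set J := ((nbpos G v l1).erase 1).erase (2 * L - 1) with hJ
    have hJc : (nbpos G v l1).card ≤ J.card + 2 := by
      have h1 := Finset.pred_card_le_card_erase (s := nbpos G v l1) (a := 1)
      have h2 := Finset.pred_card_le_card_erase (s := (nbpos G v l1).erase 1) (a := 2 * L - 1)
      rw [← hJ] at h2
      omega
    have hJn : J.Nonempty := by rw [← Finset.card_pos]; omega
    have hJm : ∀ t ∈ J, t ≠ 2 * L - 1 ∧ t ≠ 1 ∧ t ∈ nbpos G v l1 := by
      intro t ht
      rw [hJ, Finset.mem_erase, Finset.mem_erase] at ht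
      exact ht
    obtain ⟨i, hi, j, hj, hij, hb⟩ := spread J hJn 1 (fun t ht => hpar t (hJm t ht).2.2)
    have hi' := hJm i hi
    have hj' := hJm j hj
    have hip := hpar i hi'.2.2
    have hjp := hpar j hj'.2.2
    have hi3 : i ≠ 3 := fun hh => h3 (hh ▸ hi'.2.2)
    have hle := (hb i hi).2
    obtain ⟨hjl, hjv⟩ := mem_nbpos.1 hj'.2.2
    obtain ⟨s, hs, hsl, hsm⟩ := hp.seg (i := 0) (j := j) (by omega) hjl
    rw [hp.getElem_zero] at hs
    refine ⟨_, hs.cyc hjv.symm (by omega), by omega, by omega, ?_⟩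
    intro z hz
    obtain ⟨t, ht, ht1, ht2, rfl⟩ := hsm _ hz
    exact hmem t ht

/-- Many forward neighbours on a path give a long cycle. -/
theorem forward (h : Pth G a b l) (hcol : ∀ u v, G.Adj u v → col u ≠ col v) {i m : ℕ}
    (hi : i < l.length) (hm : 2 ≤ m)
    (hd : m ≤ ((nbpos G l[i] l).filter (fun t => i < t)).card) :
    ∃ l', CycL G l' ∧ 2 * m ≤ l'.length ∧ ∀ z ∈ l', z ∈ l := by
  set J := (nbpos G l[i] l).filter (fun t => i < t) with hJ
  have hJn : J.Nonempty := by rw [← Finset.card_pos]; omega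
  have hpar : ∀ t ∈ J, t % 2 = (i + 1) % 2 := by
    intro t ht
    obtain ⟨htl, htv⟩ := mem_nbpos.1 (Finset.mem_filter.1 ht).1
    have h1 := hcol _ _ htv
    rw [Ne, h.col_iff hcol hi htl] at h1
    omega
  obtain ⟨x, hx, j, hj, hij, hb⟩ := spread J hJn _ hpar
  have hx' := (Finset.mem_filter.1 hx).2
  have hj' := (Finset.mem_filter.1 hj).2
  have hjp := hpar j hj
  obtain ⟨hjl, hjv⟩ := mem_nbpos.1 (Finset.mem_filter.1 hj).1
  obtain ⟨s, hs, hsl, hsm⟩ := h.seg (i := i) (j := j) (by omega) hjl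
  refine ⟨s, hs.cyc hjv.symm (by omega), by omega, ?_⟩
  intro z hz
  obtain ⟨t, ht, ht1, ht2, rfl⟩ := hsm _ hz
  exact List.getElem_mem _

end
end SubdivEven


namespace SubdivEven

open Finset

section
variable {V : Type*} {G : SimpleGraph V} {a b c d v u z : V} {l l' : List V} {col : V → Bool}

theorem CycL.adj (h : CycL G l) (j : ℕ) (hj : j < l.length) :
    G.Adj l[j] (l[(j + 1) % l.length]'(Nat.mod_lt _ (by omega))) := by
  obtain ⟨a, b, h, hadj, hl⟩ := h
  by_cases hj' : j + 1 < l.length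
  · simp only [Nat.mod_eq_of_lt hj']
    exact h.adj j hj'
  · have : j = l.length - 1 := by omega
    subst this
    have h1 : (l.length - 1 + 1) % l.length = 0 := by
      rw [show l.length - 1 + 1 = l.length by omega, Nat.mod_self]
    simp only [h1]
    rw [h.getElem_last, h.getElem_zero]; exact hadj

theorem cycL_of (h3 : 3 ≤ l.length) (hn : l.Nodup)
    (h : ∀ j (hj : j < l.length), G.Adj l[j] (l[(j + 1) % l.length]'(Nat.mod_lt _ (by omega)))) :
    CycL G l := by
  refine ⟨l[0], l[l.length - 1], ⟨?_, hn, ?_, ?_⟩, ?_, h3⟩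
  · rw [List.isChain_iff_getElem]
    intro i hi
    have := h i (by omega)
    simp only [Nat.mod_eq_of_lt hi] at this
    exact this
  · rw [List.head?_eq_getElem?, List.getElem?_eq_getElem]
  · rw [List.getLast?_eq_getElem?, List.getElem?_eq_getElem]
  · have := h (l.length - 1) (by omega)
    have h1 : (l.length - 1 + 1) % l.length = 0 := by
      rw [show l.length - 1 + 1 = l.length by omega, Nat.mod_self]
    simp only [h1] at this
    exact this

theorem sum_sg [DecidableEq V] (S : Finset V) : ∑ x ∈ S, sg col x =
    ((S.filter (fun x => col x = true)).card : ℤ) - (S.filter (fun x => col x = false)).card := by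
  unfold sg
  rw [Finset.sum_ite]
  simp
  ring

theorem card_split (S : Finset V) : (S.filter (fun x => col x = true)).card +
    (S.filter (fun x => col x = false)).card = S.card := by
  rw [← Finset.card_filter_add_card_filter_not (s := S) (fun x => col x = true)]
  simp

theorem list_sum_sg [DecidableEq V] (hl : l.Nodup) :
    (l.map (sg col)).sum = ∑ x ∈ l.toFinset, sg col x := by
  rw [List.sum_toFinset _ hl]

theorem CycL.sum_sg [DecidableEq V] (h : CycL G l) (hcol : ∀ u v, G.Adj u v → col u ≠ col v) :
    ∑ x ∈ l.toFinset, sg col x = 0 := by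
  rw [← list_sum_sg h.nodup]
  have := h.even hcol
  obtain ⟨a, b, hp, -, -⟩ := h
  exact chain_sum_even hcol (l.length / 2) l hp.chain (by omega)

theorem CycL.card_col [DecidableEq V] (h : CycL G l) (hcol : ∀ u v, G.Adj u v → col u ≠ col v)
    {q : ℕ} (hq : l.length = 2 * q) (β : Bool) :
    (l.toFinset.filter (fun x => col x = β)).card = q := by
  have h1 := h.sum_sg hcol
  rw [SubdivEven.sum_sg] at h1
  have h2 := card_split (col := col) l.toFinset
  rw [List.toFinset_card_of_nodup h.nodup, hq] at h2
  cases β <;> omega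

theorem dg_le_col [DecidableEq V] (h : CycL G l) (hcol : ∀ u v, G.Adj u v → col u ≠ col v)
    {q : ℕ} (hq : l.length = 2 * q) (v : V) : dg G v l.toFinset ≤ q := by
  classical
  rw [← h.card_col hcol hq (!col v)]
  unfold dg
  refine Finset.card_le_card ?_
  intro x hx
  rw [Finset.mem_filter] at hx ⊢
  refine ⟨hx.1, ?_⟩
  have := hcol _ _ hx.2
  revert this
  cases col v <;> cases col x <;> simp

theorem replace_idx [DecidableEq V] (h : CycL G l) (hz : z ∉ l) (i : ℕ) (hi : i < l.length)
    (h1 : G.Adj z (l[(i + 1) % l.length]'(Nat.mod_lt _ (by omega))))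
    (h2 : G.Adj z (l[(i + (l.length - 1)) % l.length]'(Nat.mod_lt _ (by omega)))) :
    ∃ l', CycL G l' ∧ l'.length = l.length ∧ ∀ x ∈ l', x = z ∨ (x ∈ l ∧ x ≠ l[i]) := by
  have h3 := h.len
  have hn := h.nodup
  have hnd : (l.set i z).Nodup := by
    rw [List.nodup_iff_injective_getElem]
    intro ⟨p, hp⟩ ⟨p', hp'⟩ hpp
    simp only [List.getElem_set, List.length_set] at hpp hp hp'
    have : p = p' := by
      split_ifs at hpp with h4 h5 h5
      · omega
      · exact absurd (hpp ▸ List.getElem_mem _) hz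
      · exact absurd (hpp ▸ List.getElem_mem _) hz
      · exact (List.Nodup.getElem_inj_iff hn).1 hpp
    simpa using this
  refine ⟨l.set i z, cycL_of (by simpa using h3) hnd ?_, by simp, ?_⟩
  · intro j hj
    simp only [List.length_set] at hj
    simp only [List.getElem_set, List.length_set]
    split_ifs with h4 h5 h5
    · exfalso
      by_cases hj' : j + 1 < l.length
      · rw [Nat.mod_eq_of_lt hj'] at h5; omega
      · rw [show j + 1 = l.length by omega, Nat.mod_self] at h5; omega
    · subst h4; exact h1
    · have : (i + (l.length - 1)) % l.length = j := by
        by_cases hj' : j + 1 < l.length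
        · rw [Nat.mod_eq_of_lt hj'] at h5
          rw [h5, show j + 1 + (l.length - 1) = j + l.length by omega, Nat.add_mod_right,
            Nat.mod_eq_of_lt hj]
        · rw [show j + 1 = l.length by omega, Nat.mod_self] at h5
          rw [h5, Nat.zero_add, Nat.mod_eq_of_lt (by omega)]; omega
      simp only [this] at h2
      exact h2.symm
    · exact h.adj j hj
  · intro x hx
    obtain ⟨t, ht, rfl⟩ := List.mem_iff_getElem.1 hx
    simp only [List.length_set] at ht
    rw [List.getElem_set]
    split_ifs with h4
    · exact Or.inl rfl
    · right
      refine ⟨List.getElem_mem _, fun hh => h4 ((List.Nodup.getElem_inj_iff hn).1 hh).symm⟩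

/-- Replacing a vertex of a cycle by an outside vertex with many neighbours. -/
theorem replace_exists [DecidableEq V] (h : CycL G l) (hcol : ∀ u v, G.Adj u v → col u ≠ col v)
    {q : ℕ} (hq : l.length = 2 * q) (hz : z ∉ l) (T : Finset V) (hT : ∀ y ∈ T, y ∈ l ∧ col y = col z)
    (hcond : (q ≤ dg G z l.toFinset ∧ 1 ≤ T.card) ∨ (q ≤ dg G z l.toFinset + 1 ∧ 3 ≤ T.card)) :
    ∃ y ∈ T, ∃ l', CycL G l' ∧ l'.length = l.length ∧ ∀ x ∈ l', x = z ∨ (x ∈ l ∧ x ≠ y) := by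
  classical
  by_contra hcon
  push Not at hcon
  have h3 := h.len
  -- the set of non-neighbours of opposite colour
  set B := l.toFinset.filter (fun x => col x = !col z) with hB
  have hBc : B.card = q := h.card_col hcol hq _
  set D := B.filter (fun x => ¬ G.Adj z x) with hD
  have hDc : D.card + dg G z l.toFinset = q := by
    rw [← hBc, ← Finset.card_filter_add_card_filter_not (s := B) (fun x => G.Adj z x), add_comm]
    congr 1
    unfold dg
    congr 1
    ext x
    simp only [hB, Finset.mem_filter]
    constructor
    · rintro ⟨h1, h2⟩
      refine ⟨⟨h1, ?_⟩, h2⟩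
      have := hcol _ _ h2
      revert this
      cases col z <;> cases col x <;> simp
    · rintro ⟨⟨h1, -⟩, h2⟩
      exact ⟨h1, h2⟩
  -- every element of T has a cyclic neighbour in D
  have key : ∀ y ∈ T, ∃ i, ∃ hi : i < l.length, l[i] = y ∧
      ((l[(i + 1) % l.length]'(Nat.mod_lt _ (by omega))) ∈ D ∨
       (l[(i + (l.length - 1)) % l.length]'(Nat.mod_lt _ (by omega))) ∈ D) := by
    intro y hy
    obtain ⟨hyl, hyc⟩ := hT y hy
    obtain ⟨i, hi, rfl⟩ := List.mem_iff_getElem.1 hyl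
    refine ⟨i, hi, rfl, ?_⟩
    by_contra hno
    push Not at hno
    have hc1 : col (l[(i + 1) % l.length]'(Nat.mod_lt _ (by omega))) = !col z := by
      have := hcol _ _ (h.adj i hi)
      rw [hyc] at this
      revert this
      cases col z <;> cases col (l[(i + 1) % l.length]'(Nat.mod_lt _ (by omega))) <;> simp
    have hc2 : col (l[(i + (l.length - 1)) % l.length]'(Nat.mod_lt _ (by omega))) = !col z := by
      have := hcol _ _ (h.adj ((i + (l.length - 1)) % l.length) (Nat.mod_lt _ (by omega)))
      have h5 : ((i + (l.length - 1)) % l.length + 1) % l.length = i := by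
        rw [Nat.mod_add_mod, show i + (l.length - 1) + 1 = i + l.length by omega,
          Nat.add_mod_right, Nat.mod_eq_of_lt hi]
      simp only [h5] at this
      rw [hyc] at this
      revert this
      cases col z <;> cases col (l[(i + (l.length - 1)) % l.length]'(Nat.mod_lt _ (by omega))) <;> simp
    have ha1 : G.Adj z (l[(i + 1) % l.length]'(Nat.mod_lt _ (by omega))) := by
      by_contra hh
      exact hno.1 (by
        simp only [hD, hB, Finset.mem_filter, List.mem_toFinset]
        exact ⟨⟨List.getElem_mem _, hc1⟩, hh⟩)
    have ha2 : G.Adj z (l[(i + (l.length - 1)) % l.length]'(Nat.mod_lt _ (by omega))) := by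
      by_contra hh
      exact hno.2 (by
        simp only [hD, hB, Finset.mem_filter, List.mem_toFinset]
        exact ⟨⟨List.getElem_mem _, hc2⟩, hh⟩)
    obtain ⟨l', h6, h7, h8⟩ := replace_idx h hz i hi ha1 ha2
    obtain ⟨x, hx1, hx2, hx3⟩ := hcon _ hy l' h6 h7
    rcases h8 x hx1 with h9 | h9
    · exact hx2 h9
    · exact h9.2 (hx3 h9.1)
  rcases hcond with ⟨h1, h2⟩ | ⟨h1, h2⟩
  · have hD0 : D = ∅ := by rw [← Finset.card_eq_zero]; omega
    obtain ⟨y, hy⟩ := Finset.card_pos.1 (show 0 < T.card by omega)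
    obtain ⟨i, hi, -, h4⟩ := key y hy
    rw [hD0] at h4; simp at h4
  · have hD1 : D.card ≤ 1 := by omega
    rw [Finset.card_le_one] at hD1
    -- D has an element u0 at index j0
    obtain ⟨y, hy⟩ := Finset.card_pos.1 (show 0 < T.card by omega)
    have : ∃ u0, u0 ∈ D := by
      obtain ⟨i, hi, -, h4⟩ := key y hy
      rcases h4 with h4 | h4
      · exact ⟨_, h4⟩
      · exact ⟨_, h4⟩
    obtain ⟨u0, hu0⟩ := this
    have hu0l : u0 ∈ l := by
      simp only [hD, hB, Finset.mem_filter, List.mem_toFinset] at hu0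
      exact hu0.1.1
    obtain ⟨j0, hj0, hj0e⟩ := List.mem_iff_getElem.1 hu0l
    have hsub : T ⊆ {l[(j0 + (l.length - 1)) % l.length]'(Nat.mod_lt _ (by omega)),
        l[(j0 + 1) % l.length]'(Nat.mod_lt _ (by omega))} := by
      intro y hy
      obtain ⟨i, hi, rfl, h4⟩ := key y hy
      rw [Finset.mem_insert, Finset.mem_singleton]
      rcases h4 with h4 | h4
      · left
        have h5 := hD1 _ h4 _ hu0
        rw [← hj0e] at h5
        have h6 := (List.Nodup.getElem_inj_iff h.nodup).1 h5
        have : (j0 + (l.length - 1)) % l.length = i := by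
          rw [← h6, Nat.mod_add_mod, show i + 1 + (l.length - 1) = i + l.length by omega,
            Nat.add_mod_right, Nat.mod_eq_of_lt hi]
        simp only [this]
      · right
        have h5 := hD1 _ h4 _ hu0
        rw [← hj0e] at h5
        have h6 := (List.Nodup.getElem_inj_iff h.nodup).1 h5
        have : (j0 + 1) % l.length = i := by
          rw [← h6, Nat.mod_add_mod, show i + (l.length - 1) + 1 = i + l.length by omega,
            Nat.add_mod_right, Nat.mod_eq_of_lt hi]
        simp only [this]
    have := (Finset.card_le_card hsub).trans (Finset.card_le_two)
    omega

/-- Closing an odd path through a vertex of the cycle `l` that gets replaced by `z`. -/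
theorem win1 [DecidableEq V] {e f : V} {S : List V} (h : CycL G l)
    (hcol : ∀ u v, G.Adj u v → col u ≠ col v)
    {q : ℕ} (hq : l.length = 2 * q) (hz : z ∉ l) (hS : Pth G e f S) (hS2 : 2 ≤ S.length)
    (hzS : z ∉ S) (hdis : ∀ x ∈ S, x ∉ l) (hze : col z ≠ col e) (hzf : col z ≠ col f)
    (hcond : (q ≤ dg G z l.toFinset ∧ q + 1 ≤ dg G e l.toFinset + dg G f l.toFinset) ∨
      (q ≤ dg G z l.toFinset + 1 ∧ q + 3 ≤ dg G e l.toFinset + dg G f l.toFinset)) :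
    ∃ l1 l2, CycL G l1 ∧ CycL G l2 ∧ l1.length = 2 * q ∧ l2.length = S.length + 1 ∧
      (∀ x ∈ l1, x ∉ l2) ∧ (∀ x ∈ l1, x = z ∨ x ∈ l) ∧ (∀ x ∈ l2, x ∈ S ∨ x ∈ l) := by
  classical
  set A := l.toFinset.filter (fun x => G.Adj e x) with hA
  set B := l.toFinset.filter (fun x => G.Adj f x) with hB
  set U := l.toFinset.filter (fun x => col x = col z) with hU
  have hUc : U.card = q := h.card_col hcol hq _
  have hAU : A ∪ B ⊆ U := by
    intro x hx
    rw [Finset.mem_union, hA, hB, Finset.mem_filter, Finset.mem_filter] at hx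
    rw [hU, Finset.mem_filter]
    rcases hx with hx | hx
    · refine ⟨hx.1, ?_⟩
      have := hcol _ _ hx.2
      revert this hze
      cases col z <;> cases col x <;> cases col e <;> simp
    · refine ⟨hx.1, ?_⟩
      have := hcol _ _ hx.2
      revert this hzf
      cases col z <;> cases col x <;> cases col f <;> simp
  have h1 := Finset.card_le_card hAU
  have h2 := Finset.card_union_add_card_inter A B
  have hAd : A.card = dg G e l.toFinset := by unfold dg; rfl
  have hBd : B.card = dg G f l.toFinset := by unfold dg; rfl
  obtain ⟨y, hy, l', hl', hlen, hmem⟩ := replace_exists h hcol hq hz (A ∩ B) (by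
    intro y hy
    have hyU := hAU (Finset.mem_union_left _ (Finset.mem_inter.1 hy).1)
    rw [hU, Finset.mem_filter, List.mem_toFinset] at hyU
    exact hyU) (by omega)
  rw [Finset.mem_inter, hA, hB, Finset.mem_filter, Finset.mem_filter, List.mem_toFinset] at hy
  have hyS : y ∉ S := fun hh => hdis y hh hy.1.1
  refine ⟨l', y :: S, hl', (hS.cons hy.1.2.symm hyS).cyc hy.2.2 (by simp; omega), by omega, by simp,
    ?_, ?_, ?_⟩
  · intro x hx hx'
    rcases List.mem_cons.1 hx' with rfl | hx'
    · rcases hmem x hx with rfl | h4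
      · exact hz hy.1.1
      · exact h4.2 rfl
    · rcases hmem x hx with rfl | h4
      · exact hzS hx'
      · exact hdis x hx' h4.1
  · intro x hx
    exact (hmem x hx).imp id (fun h => h.1)
  · intro x hx
    rcases List.mem_cons.1 hx with rfl | hx
    · right; exact hy.1.1
    · exact Or.inl hx

end
end SubdivEven


namespace SubdivEven

open Finset

/-- Winning patterns for a hexagon (vertices 6..11) and two path ends (0,1,2 and 3,4,5):
the two connecting vertices of the long cycle, the new hexagon, and the optional edges used. -/
def pats : List (List ℕ × List ℕ × List ℕ) :=
  [([1, 6], [0, 7, 8, 9, 10, 11], [0, 2, 3, 15]),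
   ([1, 6], [4, 3, 8, 9, 10, 11], [3, 10, 14, 15]),
   ([1, 6], [4, 7, 8, 9, 10, 3], [3, 11, 12, 15]),
   ([1, 6], [4, 7, 8, 9, 10, 11], [3, 12, 14, 15]),
   ([1, 8], [0, 7, 6, 11, 10, 9], [0, 1, 4, 16]),
   ([1, 8], [4, 3, 6, 11, 10, 9], [4, 9, 13, 16]),
   ([1, 8], [4, 7, 6, 11, 10, 3], [4, 11, 12, 16]),
   ([1, 8], [4, 7, 6, 11, 10, 9], [4, 12, 13, 16]),
   ([1, 10], [0, 11, 6, 7, 8, 9], [1, 2, 5, 17]),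
   ([1, 10], [4, 3, 6, 7, 8, 9], [5, 9, 13, 17]),
   ([1, 10], [4, 11, 6, 7, 8, 3], [5, 10, 14, 17]),
   ([1, 10], [4, 11, 6, 7, 8, 9], [5, 13, 14, 17]),
   ([7, 4], [0, 1, 6, 11, 10, 9], [1, 3, 6, 12]),
   ([7, 4], [0, 1, 8, 9, 10, 11], [2, 4, 6, 12]),
   ([7, 4], [6, 1, 8, 9, 10, 11], [3, 4, 6, 12]),
   ([7, 4], [6, 3, 8, 9, 10, 11], [6, 9, 10, 12]),
   ([7, 6], [0, 1, 8, 9, 10, 11], [2, 4, 6, 15]),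
   ([7, 6], [4, 3, 8, 9, 10, 11], [6, 10, 14, 15]),
   ([7, 8], [0, 1, 6, 11, 10, 9], [1, 3, 6, 16]),
   ([7, 8], [4, 3, 6, 11, 10, 9], [6, 9, 13, 16]),
   ([9, 4], [0, 11, 6, 7, 8, 1], [2, 4, 7, 13]),
   ([9, 4], [0, 7, 6, 11, 10, 1], [0, 5, 7, 13]),
   ([9, 4], [6, 7, 8, 3, 10, 11], [7, 10, 11, 13]),
   ([9, 8], [0, 7, 6, 11, 10, 1], [0, 5, 7, 16]),
   ([9, 8], [4, 7, 6, 11, 10, 3], [7, 11, 12, 16]),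
   ([9, 10], [0, 11, 6, 7, 8, 1], [2, 4, 7, 17]),
   ([9, 10], [4, 11, 6, 7, 8, 3], [7, 10, 14, 17]),
   ([11, 4], [0, 1, 6, 7, 8, 9], [1, 3, 8, 14]),
   ([11, 4], [0, 7, 8, 9, 10, 1], [0, 5, 8, 14]),
   ([11, 4], [6, 7, 8, 9, 10, 3], [8, 9, 11, 14]),
   ([11, 6], [0, 7, 8, 9, 10, 1], [0, 5, 8, 15])]

/-- second endpoint of the optional edge with code `e` (its first endpoint is `e / 3`). -/
def tgt (e : ℕ) : ℕ := 6 + 2 * (e % 3) + (1 - (e / 3) % 2)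

/-- edges that are always present. -/
def fixedB (x y : ℕ) : Bool :=
  [(0,1),(1,2),(3,4),(4,5),(6,7),(7,8),(8,9),(9,10),(10,11),(6,11)].any
    (fun p => (p.1 == x && p.2 == y) || (p.1 == y && p.2 == x))

def edgeOK (codes : List ℕ) (x y : ℕ) : Bool :=
  fixedB x y || codes.any (fun e => (e / 3 == x && tgt e == y) || (e / 3 == y && tgt e == x))

def patOK (p : List ℕ × List ℕ × List ℕ) : Bool :=
  match p with
  | ([a, b], [h0, h1, h2, h3, h4, h5], codes) =>
    edgeOK codes 2 a && edgeOK codes a b && edgeOK codes b 5 &&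
    edgeOK codes h0 h1 && edgeOK codes h1 h2 && edgeOK codes h2 h3 &&
    edgeOK codes h3 h4 && edgeOK codes h4 h5 && edgeOK codes h5 h0 &&
    decide ([h0, h1, h2, h3, h4, h5, 5, b, a, 2].Nodup) &&
    [h0, h1, h2, h3, h4, h5, 5, b, a, 2].all (fun x => decide (x < 12)) &&
    codes.all (fun e => decide (e < 18))
  | _ => false

theorem pats_ok : ∀ p ∈ pats, patOK p = true := by decide +kernel

/-- No set of few missing edges meets all patterns. -/
def chk (L : List (List ℕ)) : ℕ → List ℕ → Bool
  | 0, miss => L.any (fun p => p.all (fun e => !miss.elem e))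
  | f + 1, miss =>
    match L.find? (fun p => p.all (fun e => !miss.elem e)) with
    | none => false
    | some p => p.all (fun e => chk L f (e :: miss))

theorem chk_sound (L : List (List ℕ)) : ∀ (f : ℕ) (miss : List ℕ), chk L f miss = true →
    ∀ M : Finset ℕ, (∀ e ∈ miss, e ∈ M) → M.card ≤ (miss.toFinset).card + f →
    ∃ p ∈ L, ∀ e ∈ p, e ∉ M := by
  intro f
  induction f with
  | zero =>
    intro miss hc M hM hcard
    have hEq : miss.toFinset = M := by
      refine Finset.eq_of_subset_of_card_le ?_ (by omega)
      intro e he; exact hM e (List.mem_toFinset.1 he)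
    simp only [chk, List.any_eq_true, List.all_eq_true] at hc
    obtain ⟨p, hp, hpe⟩ := hc
    refine ⟨p, hp, fun e he => ?_⟩
    have := hpe e he
    rw [← hEq, List.mem_toFinset]
    simpa using this
  | succ f ih =>
    intro miss hc M hM hcard
    unfold chk at hc
    cases hfind : L.find? (fun p => p.all (fun e => !miss.elem e)) with
    | none => rw [hfind] at hc; simp at hc
    | some p =>
      rw [hfind] at hc
      have hpL := List.mem_of_find?_eq_some hfind
      have hpe := List.find?_some hfind
      simp only [List.all_eq_true] at hc hpe
      by_cases hdis : ∀ e ∈ p, e ∉ M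
      · exact ⟨p, hpL, hdis⟩
      · push Not at hdis
        obtain ⟨e, he, heM⟩ := hdis
        refine ih (e :: miss) (hc e he) M ?_ ?_
        · intro x hx
          rcases List.mem_cons.1 hx with rfl | hx
          · exact heM
          · exact hM x hx
        · have : e ∉ miss.toFinset := by
            have := hpe e he
            rw [List.mem_toFinset]
            simpa using this
          rw [List.toFinset_cons, Finset.card_insert_of_notMem this]
          omega

theorem pats_chk : chk (pats.map (fun p => p.2.2)) 5 [] = true := by decide +kernel

theorem exists_pat (M : Finset ℕ) (hM : M.card ≤ 5) : ∃ p ∈ pats, ∀ e ∈ p.2.2, e ∉ M := by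
  obtain ⟨p, hp, hpe⟩ := chk_sound _ 5 [] pats_chk M (by simp) (by simpa using hM)
  obtain ⟨p', hp', rfl⟩ := List.mem_map.1 hp
  exact ⟨p', hp', hpe⟩

end SubdivEven


namespace SubdivEven

open Finset

section
variable {V : Type*} {G : SimpleGraph V} {col : V → Bool}

/-- Combinatorial core of the hexagon case. -/
theorem key6_core [DecidableEq V] (f : ℕ → V) (mid : List V) {v4 w4 : V}
    (hinj : ∀ i j, i < 12 → j < 12 → f i = f j → i = j)
    (hmid : Pth G v4 w4 mid) (hdis : ∀ i, i < 12 → f i ∉ mid)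
    (hfix : ∀ x y, fixedB x y = true → G.Adj (f x) (f y))
    (h3 : G.Adj (f 2) v4) (h4 : G.Adj w4 (f 5))
    (M : Finset ℕ) (hM : M.card ≤ 5)
    (hadj : ∀ e, e < 18 → e ∉ M → G.Adj (f (e / 3)) (f (tgt e))) :
    ∃ l1 l2, CycL G l1 ∧ CycL G l2 ∧ l1.length = 6 ∧ l2.length = mid.length + 4 ∧
      (∀ x ∈ l1, x ∉ l2) ∧ (∀ x ∈ l1, ∃ i < 12, x = f i) ∧
      (∀ x ∈ l2, x ∈ mid ∨ ∃ i < 12, x = f i) := by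
  obtain ⟨p, hp, hpM⟩ := exists_pat M hM
  have hok := pats_ok p hp
  unfold patOK at hok
  split at hok
  · rename_i a b t0 t1 t2 t3 t4 t5 codes
    simp only [Bool.and_eq_true, decide_eq_true_eq, List.all_eq_true] at hok
    obtain ⟨⟨⟨⟨⟨⟨⟨⟨⟨⟨⟨e1, e2⟩, e3⟩, e4⟩, e5⟩, e6⟩, e7⟩, e8⟩, e9⟩, hnd⟩, hlt⟩, hc⟩ := hok
    have hE : ∀ x y, edgeOK codes x y = true → G.Adj (f x) (f y) := by
      intro x y hxy
      unfold edgeOK at hxy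
      rw [Bool.or_eq_true] at hxy
      rcases hxy with hxy | hxy
      · exact hfix x y hxy
      · rw [List.any_eq_true] at hxy
        obtain ⟨e, he, hxy⟩ := hxy
        have := hadj e (hc e he) (hpM e he)
        simp only [Bool.or_eq_true, Bool.and_eq_true, beq_iff_eq] at hxy
        rcases hxy with ⟨rfl, rfl⟩ | ⟨rfl, rfl⟩
        · exact this
        · exact this.symm
    have hnf : ([t0, t1, t2, t3, t4, t5, 5, b, a, 2].map f).Nodup := by
      refine List.Nodup.map_on ?_ hnd
      intro x hx y hy hxy
      exact hinj x y (hlt x hx) (hlt y hy) hxy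
    have hsplit : [t0, t1, t2, t3, t4, t5, 5, b, a, 2].map f =
      [f t0, f t1, f t2, f t3, f t4, f t5] ++ [f 5, f b, f a, f 2] := rfl
    rw [hsplit, List.nodup_append] at hnf
    have hP1 : Pth G (f t0) (f t5) [f t0, f t1, f t2, f t3, f t4, f t5] := by
      refine ⟨?_, hnf.1, rfl, rfl⟩
      simp only [List.isChain_cons_cons, List.isChain_singleton, and_true]
      exact ⟨hE _ _ e4, hE _ _ e5, hE _ _ e6, hE _ _ e7, hE _ _ e8⟩
    have hP2 : Pth G (f 5) (f 2) [f 5, f b, f a, f 2] := by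
      refine ⟨?_, hnf.2.1, rfl, rfl⟩
      simp only [List.isChain_cons_cons, List.isChain_singleton, and_true]
      exact ⟨(hE _ _ e3).symm, (hE _ _ e2).symm, (hE _ _ e1).symm⟩
    have hm1 : ∀ x ∈ [f t0, f t1, f t2, f t3, f t4, f t5], ∃ i < 12, x = f i := by
      intro x hx
      have : x ∈ [t0, t1, t2, t3, t4, t5, 5, b, a, 2].map f := by
        rw [hsplit]; exact List.mem_append_left _ hx
      obtain ⟨i, hi, rfl⟩ := List.mem_map.1 this
      exact ⟨i, hlt i hi, rfl⟩
    have hm2 : ∀ x ∈ [f 5, f b, f a, f 2], ∃ i < 12, x = f i := by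
      intro x hx
      have : x ∈ [t0, t1, t2, t3, t4, t5, 5, b, a, 2].map f := by
        rw [hsplit]; exact List.mem_append_right _ hx
      obtain ⟨i, hi, rfl⟩ := List.mem_map.1 this
      exact ⟨i, hlt i hi, rfl⟩
    have hP3 := hmid.append hP2 h4 (by
      intro x hx hx'
      obtain ⟨i, hi, rfl⟩ := hm2 x hx'
      exact hdis i hi hx)
    refine ⟨_, _, hP1.cyc (hE _ _ e9) (by simp), hP3.cyc h3 (by simp), by simp, by simp, ?_, hm1, ?_⟩
    · intro x hx hx'
      rcases List.mem_append.1 hx' with hx' | hx'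
      · obtain ⟨i, hi, rfl⟩ := hm1 x hx
        exact hdis i hi hx'
      · exact hnf.2.2 x hx x hx' rfl
    · intro x hx
      rcases List.mem_append.1 hx with hx | hx
      · exact Or.inl hx
      · exact Or.inr (hm2 x hx)
  · simp at hok

open Classical in
theorem dg_list6 [DecidableEq V] {v c0 c1 c2 c3 c4 c5 : V} (hn : [c0, c1, c2, c3, c4, c5].Nodup) :
    dg G v [c0, c1, c2, c3, c4, c5].toFinset =
      (if G.Adj v c0 then 1 else 0) + (if G.Adj v c1 then 1 else 0) + (if G.Adj v c2 then 1 else 0)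
      + (if G.Adj v c3 then 1 else 0) + (if G.Adj v c4 then 1 else 0)
      + (if G.Adj v c5 then 1 else 0) := by
  unfold dg
  rw [Finset.card_filter]
  rw [List.sum_toFinset _ hn]
  simp
  ring

theorem key6 [DecidableEq V] (hcol : ∀ u v, G.Adj u v → col u ≠ col v)
    {v1 v2 v3 w1 w2 w3 v4 w4 c0 c1 c2 c3 c4 c5 : V} {mid : List V}
    (hmid : Pth G v4 w4 mid)
    (hnd : [v1, v2, v3, w1, w2, w3, c0, c1, c2, c3, c4, c5].Nodup)
    (hdis : ∀ x ∈ [v1, v2, v3, w1, w2, w3, c0, c1, c2, c3, c4, c5], x ∉ mid)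
    (a1 : G.Adj v1 v2) (a2 : G.Adj v2 v3) (a3 : G.Adj v3 v4) (a4 : G.Adj w1 w2)
    (a5 : G.Adj w2 w3) (a6 : G.Adj w4 w3)
    (b0 : G.Adj c0 c1) (b1 : G.Adj c1 c2) (b2 : G.Adj c2 c3) (b3 : G.Adj c3 c4) (b4 : G.Adj c4 c5)
    (b5 : G.Adj c5 c0) (hw : col w1 ≠ col v1) (hc : col c0 = col v1)
    (hsum : 13 ≤ dg G v1 [c0, c1, c2, c3, c4, c5].toFinset +
      dg G v2 [c0, c1, c2, c3, c4, c5].toFinset +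
      dg G v3 [c0, c1, c2, c3, c4, c5].toFinset + dg G w1 [c0, c1, c2, c3, c4, c5].toFinset +
      dg G w2 [c0, c1, c2, c3, c4, c5].toFinset + dg G w3 [c0, c1, c2, c3, c4, c5].toFinset) :
    ∃ l1 l2, CycL G l1 ∧ CycL G l2 ∧ l1.length = 6 ∧ l2.length = mid.length + 4 ∧
      (∀ x ∈ l1, x ∉ l2) ∧
      (∀ x ∈ l1, x ∈ [v1, v2, v3, w1, w2, w3, c0, c1, c2, c3, c4, c5]) ∧
      (∀ x ∈ l2, x ∈ mid ∨ x ∈ [v1, v2, v3, w1, w2, w3, c0, c1, c2, c3, c4, c5]) := by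
  classical
  set L := [v1, v2, v3, w1, w2, w3, c0, c1, c2, c3, c4, c5] with hL
  have hlen : L.length = 12 := rfl
  set f : ℕ → V := fun i => L.getD i v1 with hf
  have hfi : ∀ i (hi : i < 12), f i = L[i]'(by omega) := by
    intro i hi
    simp only [hf]
    rw [List.getD_eq_getElem _ _ (by omega)]
  have hcn : [c0, c1, c2, c3, c4, c5].Nodup := by
    have : L = [v1, v2, v3, w1, w2, w3] ++ [c0, c1, c2, c3, c4, c5] := rfl
    rw [this] at hnd
    exact (List.nodup_append.1 hnd).2.1
  -- colours
  have ev : ∀ {u v : V}, G.Adj u v → col v = !col u := by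
    intro u v huv
    have := hcol _ _ huv
    revert this; cases col u <;> cases col v <;> simp
  have k2 := ev a1
  have k3 := ev a2
  have k5 := ev a4
  have k6 := ev a5
  have kw : col w1 = !col v1 := by revert hw; cases col w1 <;> cases col v1 <;> simp
  have kc1 := ev b0
  have kc2 := ev b1
  have kc3 := ev b2
  have kc4 := ev b3
  have kc5 := ev b4
  rw [k2] at k3
  rw [kw] at k5
  rw [k5] at k6
  rw [hc] at kc1
  rw [kc1] at kc2
  rw [kc2] at kc3
  rw [kc3] at kc4
  rw [kc4] at kc5
  simp only [Bool.not_not] at *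
  have no : ∀ {u v : V}, col u = col v → ¬ G.Adj u v := fun h1 h2 => hcol _ _ h2 h1
  set M := (Finset.range 18).filter (fun e => ¬ G.Adj (f (e / 3)) (f (tgt e))) with hM
  have hMc : M.card ≤ 5 := by
    have h1 := Finset.card_filter_add_card_filter_not (s := Finset.range 18)
      (fun e => G.Adj (f (e / 3)) (f (tgt e)))
    rw [Finset.card_range, ← hM] at h1
    have h2 : 13 ≤ ((Finset.range 18).filter (fun e => G.Adj (f (e / 3)) (f (tgt e)))).card := by
      rw [Finset.card_filter]
      simp only [Finset.sum_range_succ, Finset.sum_range_zero, tgt, hf, hL]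
      simp only [dg_list6 hcn] at hsum
      rw [if_neg (no (u := v1) (v := c0) (by rw [hc])), if_neg (no (u := v1) (v := c2) (by rw [kc2])),
        if_neg (no (u := v1) (v := c4) (by rw [kc4])),
        if_neg (no (u := v2) (v := c1) (by rw [k2, kc1])),
        if_neg (no (u := v2) (v := c3) (by rw [k2, kc3])),
        if_neg (no (u := v2) (v := c5) (by rw [k2, kc5])),
        if_neg (no (u := v3) (v := c0) (by rw [k3, hc])),
        if_neg (no (u := v3) (v := c2) (by rw [k3, kc2])),
        if_neg (no (u := v3) (v := c4) (by rw [k3, kc4])),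
        if_neg (no (u := w1) (v := c1) (by rw [kw, kc1])),
        if_neg (no (u := w1) (v := c3) (by rw [kw, kc3])),
        if_neg (no (u := w1) (v := c5) (by rw [kw, kc5])),
        if_neg (no (u := w2) (v := c0) (by rw [k5, hc])),
        if_neg (no (u := w2) (v := c2) (by rw [k5, kc2])),
        if_neg (no (u := w2) (v := c4) (by rw [k5, kc4])),
        if_neg (no (u := w3) (v := c1) (by rw [k6, kc1])),
        if_neg (no (u := w3) (v := c3) (by rw [k6, kc3])),
        if_neg (no (u := w3) (v := c5) (by rw [k6, kc5]))] at hsum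
      simp at hsum ⊢
      omega
    omega
  have hmemf : ∀ i, i < 12 → f i ∈ L := fun i hi => by rw [hfi i hi]; exact List.getElem_mem _
  obtain ⟨l1, l2, h1, h2, h3, h4, h5, h6, h7⟩ := key6_core f mid (G := G) (v4 := v4) (w4 := w4) (by
      intro i j hi hj hij
      rw [hfi i hi, hfi j hj] at hij
      exact (List.Nodup.getElem_inj_iff hnd).1 hij) hmid
    (fun i hi => hdis _ (hmemf i hi)) (by
      intro x y hxy
      unfold fixedB at hxy
      simp only [List.any_cons, List.any_nil, Bool.or_eq_true, Bool.and_eq_true, beq_iff_eq,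
        Bool.or_false] at hxy
      rcases hxy with h | h | h | h | h | h | h | h | h | h <;>
      rcases h with ⟨rfl, rfl⟩ | ⟨rfl, rfl⟩ <;> simp only [hf, hL] <;>
      first
        | exact a1 | exact a1.symm | exact a2 | exact a2.symm | exact a4 | exact a4.symm
        | exact a5 | exact a5.symm | exact b0 | exact b0.symm | exact b1 | exact b1.symm
        | exact b2 | exact b2.symm | exact b3 | exact b3.symm | exact b4 | exact b4.symm
        | exact b5 | exact b5.symm) a3 a6 M hMc (by
      intro e he heM
      by_contra hh
      exact heM (Finset.mem_filter.2 ⟨Finset.mem_range.2 he, hh⟩))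
  refine ⟨l1, l2, h1, h2, h3, h4, h5, ?_, ?_⟩
  · intro x hx
    obtain ⟨i, hi, rfl⟩ := h6 x hx
    exact hmemf i hi
  · intro x hx
    rcases h7 x hx with hx | ⟨i, hi, rfl⟩
    · exact Or.inl hx
    · exact Or.inr (hmemf i hi)

end
end SubdivEven


namespace SubdivEven

open Finset

section
variable {V : Type*} {G : SimpleGraph V} {col : V → Bool}

theorem key_big [DecidableEq V] (hcol : ∀ u v, G.Adj u v → col u ≠ col v) {a b : V}
    {l c : List V} {p q : ℕ} (hl : Pth G a b l) (hp : 4 ≤ p) (hlen : l.length = 2 * p)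
    (hc : CycL G c) (hclen : c.length = 2 * q) (hdis : ∀ x ∈ l, x ∉ c)
    {i j t : ℕ} (hij : i + 2 * p - 4 = j) (hi : 1 ≤ i) (hi2 : i ≤ 2) (ht : t < 2 * p)
    (hti : t < i ∨ j < t) (htp : t % 2 ≠ i % 2)
    (hcond : (q ≤ dg G l[t] c.toFinset ∧
        q + 1 ≤ dg G l[i] c.toFinset + dg G l[j] c.toFinset) ∨
      (q ≤ dg G l[t] c.toFinset + 1 ∧
        q + 3 ≤ dg G l[i] c.toFinset + dg G l[j] c.toFinset)) :
    ∃ l1 l2, CycL G l1 ∧ CycL G l2 ∧ l1.length = 2 * q ∧ l2.length = 2 * p - 2 ∧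
      (∀ x ∈ l1, x ∉ l2) ∧ (∀ x ∈ l1, x ∈ l ∨ x ∈ c) ∧ (∀ x ∈ l2, x ∈ l ∨ x ∈ c) := by
  obtain ⟨S, hS, hSl, hSm⟩ := hl.seg (i := i) (j := j) (by omega) (by omega)
  have hSl' : ∀ x ∈ S, x ∈ l := by
    intro x hx
    obtain ⟨s, hs, -, -, rfl⟩ := hSm x hx
    exact List.getElem_mem _
  obtain ⟨l1, l2, h1, h2, h3, h4, h5, h6, h7⟩ := win1 (z := l[t]) hc hcol hclen
    (hdis _ (List.getElem_mem _)) hS (by omega) (by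
      intro hx
      obtain ⟨s, hs, hs1, hs2, hst⟩ := hSm _ hx
      have := hl.inj (by omega) hs hst
      omega) (fun x hx => hdis x (hSl' x hx))
    (by rw [Ne, hl.col_iff hcol (by omega) (by omega)]; omega)
    (by rw [Ne, hl.col_iff hcol (by omega) (by omega)]; omega) hcond
  refine ⟨l1, l2, h1, h2, h3, by omega, h5, ?_, ?_⟩
  · intro x hx
    rcases h6 x hx with rfl | h
    · left; exact List.getElem_mem _
    · exact Or.inr h
  · intro x hx
    exact (h7 x hx).imp (hSl' x) id

/-- Key Lemma: a path with `2p` vertices and a disjoint cycle `c` of length `2q` with many edges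
between the path ends and `c` can be rearranged to disjoint cycles of lengths `2q`, `2p-2`. -/
theorem key [DecidableEq V] (hcol : ∀ u v, G.Adj u v → col u ≠ col v) {a b : V}
    {l c : List V} {p q : ℕ} (hl : Pth G a b l) (hp : 4 ≤ p) (hlen : l.length = 2 * p)
    (hc : CycL G c) (hq : 3 ≤ q) (hclen : c.length = 2 * q) (hdis : ∀ x ∈ l, x ∉ c)
    (hsum : 6 * q < dg G l[0] c.toFinset + dg G l[1] c.toFinset + dg G l[2] c.toFinset +
      dg G l[2 * p - 1] c.toFinset + dg G l[2 * p - 2] c.toFinset + dg G l[2 * p - 3] c.toFinset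
      + 6) :
    ∃ l1 l2, CycL G l1 ∧ CycL G l2 ∧ l1.length = 2 * q ∧ l2.length = 2 * p - 2 ∧
      (∀ x ∈ l1, x ∉ l2) ∧ (∀ x ∈ l1, x ∈ l ∨ x ∈ c) ∧ (∀ x ∈ l2, x ∈ l ∨ x ∈ c) := by
  rcases Nat.lt_or_ge 3 q with hq4 | hq3
  · by_contra hcon
    have c1 := mt (key_big hcol hl hp hlen hc hclen hdis (i := 2) (j := 2 * p - 2)
      (t := 2 * p - 1) (by omega) (by omega) (by omega) (by omega) (by omega) (by omega)) hcon
    have c2 := mt (key_big hcol hl hp hlen hc hclen hdis (i := 2) (j := 2 * p - 2)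
      (t := 1) (by omega) (by omega) (by omega) (by omega) (by omega) (by omega)) hcon
    have c3 := mt (key_big hcol hl hp hlen hc hclen hdis (i := 1) (j := 2 * p - 3)
      (t := 0) (by omega) (by omega) (by omega) (by omega) (by omega) (by omega)) hcon
    have c4 := mt (key_big hcol hl hp hlen hc hclen hdis (i := 1) (j := 2 * p - 3)
      (t := 2 * p - 2) (by omega) (by omega) (by omega) (by omega) (by omega) (by omega)) hcon
    have d0 := dg_le_col hc hcol hclen l[0]
    have d1 := dg_le_col hc hcol hclen l[1]
    have d2 := dg_le_col hc hcol hclen l[2]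
    have d3 := dg_le_col hc hcol hclen l[2 * p - 1]
    have d4 := dg_le_col hc hcol hclen l[2 * p - 2]
    have d5 := dg_le_col hc hcol hclen l[2 * p - 3]
    generalize dg G l[0] c.toFinset = x0 at *
    generalize dg G l[1] c.toFinset = x1 at *
    generalize dg G l[2] c.toFinset = x2 at *
    generalize dg G l[2 * p - 1] c.toFinset = x3 at *
    generalize dg G l[2 * p - 2] c.toFinset = x4 at *
    generalize dg G l[2 * p - 3] c.toFinset = x5 at *
    clear hcon hdis hl hc hcol hlen hclen
    have e1 : 2 * x3 + x2 + x4 + 4 ≤ 4 * q := by omega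
    have e2 : 2 * x1 + x2 + x4 + 4 ≤ 4 * q := by omega
    have e3 : 2 * x0 + x5 + x1 + 4 ≤ 4 * q := by omega
    have e4 : 2 * x4 + x5 + x1 + 4 ≤ 4 * q := by omega
    omega
  · obtain rfl : q = 3 := by omega
    obtain ⟨x, hx⟩ := Finset.card_pos.1 (show 0 < (c.toFinset.filter
      (fun x => col x = col l[0])).card by rw [hc.card_col hcol hclen]; omega)
    rw [Finset.mem_filter, List.mem_toFinset] at hx
    obtain ⟨c', y, hc', hyx, hperm⟩ := hc.rot hx.1
    rw [← List.toFinset_eq_of_perm _ _ hperm] at hsum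
    have hdis' : ∀ x ∈ l, x ∉ c' := fun x hx => by rw [hperm.mem_iff]; exact hdis x hx
    have hmem' : ∀ x, x ∈ c' → x ∈ c := fun x hx => hperm.mem_iff.1 hx
    have hclen' : c'.length = 6 := by rw [hperm.length_eq, hclen]
    clear hperm hclen hdis hc
    match c', hclen' with
    | [c0, c1, c2, c3, c4, c5], _ =>
      obtain ⟨mid, hmid, hmidl, hmidm⟩ := hl.seg (i := 3) (j := 2 * p - 4) (by omega) (by omega)
      have hx0 : c0 = x := by simpa using hc'.hd
      have hy0 : c5 = y := by simpa using hc'.lst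
      subst hx0; subst hy0
      have hch := hc'.chain
      simp only [List.isChain_cons_cons, List.isChain_singleton, and_true] at hch
      have adj : ∀ i j (hi : i < l.length) (hj : j < l.length), i + 1 = j → G.Adj l[i] l[j] := by
        intro i j hi hj hij
        subst hij; exact hl.adj i hj
      have hlist : [l[0], l[1], l[2], l[2*p-1], l[2*p-2], l[2*p-3]].Nodup := by
        have inj : ∀ i j (hi : i < l.length) (hj : j < l.length), i ≠ j → l[i] ≠ l[j] :=
          fun i j hi hj hij hh => hij (hl.inj hi hj hh)
        simp only [List.nodup_cons, List.mem_cons, not_or, List.not_mem_nil, not_false_eq_true,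
          List.nodup_nil, and_true]
        refine ⟨⟨?_, ?_, ?_, ?_, ?_⟩, ⟨?_, ?_, ?_, ?_⟩, ⟨?_, ?_, ?_⟩, ⟨?_, ?_⟩, ?_⟩ <;>
          (apply inj; omega)
      have hmemL : ∀ x ∈ [l[0], l[1], l[2], l[2*p-1], l[2*p-2], l[2*p-3]], ∃ t, ∃ ht : t < l.length,
          x = l[t] ∧ (t < 3 ∨ 2 * p - 4 < t) := by
        intro x hx
        simp only [List.mem_cons, List.not_mem_nil, or_false] at hx
        rcases hx with rfl | rfl | rfl | rfl | rfl | rfl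
        · exact ⟨0, by omega, rfl, by omega⟩
        · exact ⟨1, by omega, rfl, by omega⟩
        · exact ⟨2, by omega, rfl, by omega⟩
        · exact ⟨2*p-1, by omega, rfl, by omega⟩
        · exact ⟨2*p-2, by omega, rfl, by omega⟩
        · exact ⟨2*p-3, by omega, rfl, by omega⟩
      have hall : ∀ x ∈ [l[0], l[1], l[2], l[2*p-1], l[2*p-2], l[2*p-3]] ++
          [c0, c1, c2, c3, c4, c5], x ∈ l ∨ x ∈ c := by
        intro x hx
        rcases List.mem_append.1 hx with hx | hx
        · obtain ⟨t, ht, rfl, -⟩ := hmemL x hx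
          left; exact List.getElem_mem _
        · exact Or.inr (hmem' x hx)
      obtain ⟨l1, l2, h1, h2, h3, h4, h5, h6, h7⟩ := key6 (v1 := l[0]) (v2 := l[1]) (v3 := l[2])
        (w1 := l[2*p-1]) (w2 := l[2*p-2]) (w3 := l[2*p-3]) (c0 := c0) (c1 := c1) (c2 := c2) (c3 := c3)
        (c4 := c4) (c5 := c5) hcol hmid
        (by
          refine (List.nodup_append (l₁ := [l[0], l[1], l[2], l[2*p-1], l[2*p-2], l[2*p-3]])).2
            ⟨hlist, hc'.nodup, ?_⟩
          intro x hx y hy hxy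
          obtain ⟨t, ht, rfl, -⟩ := hmemL x hx
          exact hdis' _ (List.getElem_mem ht) (hxy ▸ hy))
        (by
          intro x hx hxm
          obtain ⟨t', ht', h1, h2, h3⟩ := hmidm x hxm
          rcases List.mem_append (s := [l[0], l[1], l[2], l[2*p-1], l[2*p-2], l[2*p-3]]) |>.1 hx
            with hx | hx
          · obtain ⟨t, ht, rfl, htt⟩ := hmemL x hx
            have := hl.inj ht ht' h3
            omega
          · rw [h3] at hx
            exact hdis' _ (List.getElem_mem ht') hx)
        (adj _ _ _ _ rfl) (adj _ _ _ _ rfl) (adj _ _ _ _ rfl)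
        (adj _ _ _ _ (by omega)).symm (adj _ _ _ _ (by omega)).symm (adj _ _ _ _ (by omega))
        hch.1 hch.2.1 hch.2.2.1 hch.2.2.2.1 hch.2.2.2.2 hyx
        (by rw [Ne, hl.col_iff hcol (by omega) (by omega)]; omega) hx.2 (by omega)
      refine ⟨l1, l2, h1, h2, by omega, by omega, h5, fun x hx => hall x (h6 x hx), ?_⟩
      intro x hx
      rcases h7 x hx with hx | hx
      · obtain ⟨t', ht', -, -, rfl⟩ := hmidm x hx
        left; exact List.getElem_mem _
      · exact hall x hx

end
end SubdivEven


namespace SubdivEven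
open Finset

section
variable {V : Type*} {G : SimpleGraph V} {a b c d v u : V} {l l' : List V} {col : V → Bool}

/-- A minimal Hall violator, matched after deleting any vertex. -/
theorem hall_violator [DecidableEq V] (G : SimpleGraph V) (A B : Finset V) (hlt : B.card < A.card) :
    ∃ A' ⊆ A, A'.Nonempty ∧ ∀ a0 ∈ A', ∃ f : V → V,
      (∀ x ∈ A', x ≠ a0 → G.Adj x (f x) ∧ f x ∈ B) ∧
      (∀ b ∈ B, ∀ x ∈ A', G.Adj x b → ∃ y ∈ A', y ≠ a0 ∧ f y = b) ∧
      (∀ x ∈ A', ∀ y ∈ A', x ≠ a0 → y ≠ a0 → f x = f y → x = y) := by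
  classical
  let N : V → Finset V := fun x => B.filter (fun y => G.Adj x y)
  have hN : ∀ x y, y ∈ N x ↔ y ∈ B ∧ G.Adj x y := by intro x y; simp [N]
  let P : Finset (Finset V) := A.powerset.filter (fun S => (S.biUnion N).card < S.card)
  have hP : P.Nonempty := by
    refine ⟨A, ?_⟩
    simp only [P, Finset.mem_filter, Finset.mem_powerset]
    refine ⟨Finset.Subset.refl _, lt_of_le_of_lt (Finset.card_le_card ?_) hlt⟩
    intro y hy
    rw [Finset.mem_biUnion] at hy
    obtain ⟨x, -, hx⟩ := hy
    exact ((hN x y).1 hx).1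
  obtain ⟨S, hS, hmin⟩ := Finset.exists_min_image P Finset.card hP
  simp only [P, Finset.mem_filter, Finset.mem_powerset] at hS
  refine ⟨S, hS.1, ?_, ?_⟩
  · rw [← Finset.card_pos]; omega
  intro a0 ha0
  have hall : ∀ T : Finset {x // x ∈ S.erase a0}, T.card ≤ (T.biUnion (fun x => N x.1)).card := by
    intro T
    by_contra hcon
    push Not at hcon
    have h1 : (T.image Subtype.val) ∈ P := by
      simp only [P, Finset.mem_filter, Finset.mem_powerset]
      constructor
      · intro x hx
        rw [Finset.mem_image] at hx
        obtain ⟨y, -, rfl⟩ := hx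
        exact hS.1 (Finset.mem_of_mem_erase y.2)
      · rw [Finset.card_image_of_injective _ Subtype.val_injective, Finset.image_biUnion]
        exact hcon
    have h2 := hmin _ h1
    have h3 : (T.image Subtype.val).card ≤ (S.erase a0).card := by
      apply Finset.card_le_card
      intro x hx
      rw [Finset.mem_image] at hx
      obtain ⟨y, -, rfl⟩ := hx
      exact y.2
    have := Finset.card_erase_lt_of_mem ha0
    omega
  obtain ⟨f, hf, hfN⟩ := (Finset.all_card_le_biUnion_card_iff_exists_injective _).1 hall
  have hsurj : Finset.univ.image f = S.biUnion N := by
    apply Finset.eq_of_subset_of_card_le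
    · intro y hy
      rw [Finset.mem_image] at hy
      obtain ⟨x, -, rfl⟩ := hy
      rw [Finset.mem_biUnion]
      exact ⟨x.1, Finset.mem_of_mem_erase x.2, hfN x⟩
    · rw [Finset.card_image_of_injective _ hf, Finset.card_univ, Fintype.card_coe,
        Finset.card_erase_of_mem ha0]
      omega
  refine ⟨fun x => if h : x ∈ S.erase a0 then f ⟨x, h⟩ else x, ?_, ?_, ?_⟩
  · intro x hx hxa
    have hh : x ∈ S.erase a0 := Finset.mem_erase.2 ⟨hxa, hx⟩
    simp only [dif_pos hh]
    have := (hN _ _).1 (hfN ⟨x, hh⟩)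
    exact ⟨this.2, this.1⟩
  · intro b hb x hx hxb
    have : b ∈ S.biUnion N := Finset.mem_biUnion.2 ⟨x, hx, (hN _ _).2 ⟨hb, hxb⟩⟩
    rw [← hsurj, Finset.mem_image] at this
    obtain ⟨y, -, rfl⟩ := this
    refine ⟨y.1, Finset.mem_of_mem_erase y.2, Finset.ne_of_mem_erase y.2, ?_⟩
    simp only [dif_pos y.2]
  · intro x hx y hy hxa hya hxy
    have hh : x ∈ S.erase a0 := Finset.mem_erase.2 ⟨hxa, hx⟩
    have hh' : y ∈ S.erase a0 := Finset.mem_erase.2 ⟨hya, hy⟩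
    simp only [dif_pos hh, dif_pos hh'] at hxy
    simpa using hf hxy

theorem alt_path [Fintype V] [DecidableEq V] {β : Bool} (A B : Finset V)
    (hA : ∀ x ∈ A, col x = β) (hB : ∀ x ∈ B, col x ≠ β) {a0 : V} (ha0 : a0 ∈ A) (f : V → V)
    (hf1 : ∀ x ∈ A, x ≠ a0 → G.Adj x (f x) ∧ f x ∈ B)
    (hf2 : ∀ b ∈ B, ∀ x ∈ A, G.Adj x b → ∃ y ∈ A, y ≠ a0 ∧ f y = b) :
    ∃ z q, Pth G z a0 q ∧ z ∈ A ∧ (∀ x ∈ q, x ∈ A ∨ x ∈ B) ∧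
      ∀ b ∈ B, G.Adj z b → b ∈ q := by
  classical
  let Q : ℕ → Prop := fun n => ∃ z q, Pth G z a0 q ∧ z ∈ A ∧ (∀ x ∈ q, x ∈ A ∨ x ∈ B) ∧
    (∀ x ∈ q, x ∈ A → x ≠ a0 → f x ∈ q) ∧ q.length = n
  have hbd : ∀ n, Q n → n ≤ Fintype.card V := by
    rintro n ⟨z, q, hq, -, -, -, rfl⟩
    exact hq.nodup.length_le_card
  have h1 : Q 1 := ⟨a0, [a0], Pth.single a0, ha0, by simpa using Or.inl ha0, by simp, rfl⟩
  have hcard : 1 ≤ Fintype.card V := hbd 1 h1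
  obtain ⟨z, q, hq, hz, hAB, hinv, hlen⟩ := Nat.findGreatest_spec (P := Q) hcard h1
  refine ⟨z, q, hq, hz, hAB, ?_⟩
  intro b hb hzb
  by_contra hbq
  obtain ⟨y, hy, hya, rfl⟩ := hf2 b hb z hz hzb
  have hyb := hf1 y hy hya
  have hyq : y ∉ q := fun h => hbq (hinv y h hy hya)
  have p1 := hq.cons hzb.symm hbq
  have p2 := p1.cons hyb.1 (by
    simp only [List.mem_cons, not_or]; exact ⟨hyb.1.ne, hyq⟩)
  have hQ : Q (q.length + 2) := by
    refine ⟨y, _, p2, hy, ?_, ?_, by simp⟩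
    · intro x hx
      simp only [List.mem_cons] at hx
      rcases hx with rfl | rfl | hx
      · exact Or.inl hy
      · exact Or.inr hb
      · exact hAB x hx
    · intro x hx hxA hxa
      simp only [List.mem_cons] at hx ⊢
      rcases hx with rfl | rfl | hx
      · simp
      · exact absurd (hA _ hxA) (hB _ hb)
      · right; right; exact hinv x hx hxA hxa
  have := Nat.le_findGreatest (hbd _ hQ) hQ
  omega

theorem lemmaK_alpha [DecidableEq V] {z a0 : V} {q : List V} (hcol : ∀ u v, G.Adj u v → col u ≠ col v)
    (hq : Pth G z a0 q) {m : ℕ} (hm : 2 ≤ m) (hno : ∀ l, CycL G l → (∀ z ∈ l, z ∈ q) → l.length < 2 * m)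
    (B : Finset V) (hB : ∀ b ∈ B, G.Adj z b → b ∈ q) :
    dg G z B < m ∧ 2 * dg G z B ≤ q.length := by
  classical
  have h1 : dg G z B ≤ (nbpos G z q).card := by
    rw [card_nbpos hq.nodup]
    unfold dg
    apply Finset.card_le_card
    intro x hx
    simp only [Finset.mem_filter, List.mem_toFinset] at hx ⊢
    exact ⟨hB x hx.1 hx.2, hx.2⟩
  have hz := hq.getElem_zero
  have hpar : ∀ t ∈ nbpos G z q, t % 2 = 1 := by
    intro t ht
    obtain ⟨htl, htv⟩ := mem_nbpos.1 ht
    have h1 := hcol _ _ htv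
    rw [← hz, Ne, hq.col_iff hcol hq.length_pos htl] at h1
    omega
  constructor
  · by_contra hcon
    push Not at hcon
    have hfil : (nbpos G z q).filter (fun t => 0 < t) = nbpos G z q := by
      apply Finset.filter_true_of_mem
      intro t ht
      have := hpar t ht; omega
    obtain ⟨l, hl, hl2, hl3⟩ := forward hq hcol (i := 0) (m := m) hq.length_pos hm
      (by rw [hz, hfil]; omega)
    have := hno l hl hl3
    omega
  · by_cases hJ : (nbpos G z q).Nonempty
    · obtain ⟨i, hi, j, hj, hij, hb⟩ := spread _ hJ _ hpar
      have := hpar i hi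
      obtain ⟨hjl, -⟩ := mem_nbpos.1 hj
      omega
    · rw [Finset.not_nonempty_iff_eq_empty] at hJ
      rw [hJ] at h1
      have := hq.length_pos
      simp at h1; omega

/-- Lemma K: a longest path in `R` with leftover vertices of large degree gives a long cycle. -/
theorem lemmaK [Fintype V] [DecidableEq V] (hcol : ∀ u v, G.Adj u v → col u ≠ col v) {β : Bool}
    (R : Finset V) {O : List V} (hO : Pth G a b O) (hOR : ∀ x ∈ O, x ∈ R)
    (hmax : ∀ x y p, Pth G x y p → (∀ z ∈ p, z ∈ R) → p.length ≤ O.length) (A B : Finset V)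
    (hA : ∀ x ∈ A, x ∈ R ∧ x ∉ O ∧ col x = β) (hB : ∀ x ∈ B, x ∈ R ∧ x ∉ O ∧ col x ≠ β)
    (hlt : B.card < A.card) {m : ℕ} (hm : 2 ≤ m)
    (hd : ∀ x ∈ A, m ≤ dg G x O.toFinset + dg G x B)
    (hno : ∀ l, CycL G l → (∀ z ∈ l, z ∈ R) → l.length < 2 * m) : False := by
  obtain ⟨A', hA'A, ⟨a1, ha1⟩, hA'⟩ := hall_violator G A B hlt
  have run : ∀ a0 ∈ A', ∃ z q, Pth G z a0 q ∧ z ∈ A' ∧ (∀ x ∈ q, x ∈ R ∧ x ∉ O) ∧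
      dg G z B < m ∧ 2 * dg G z B ≤ q.length := by
    intro a0 ha0
    obtain ⟨f, hf1, hf2, hf3⟩ := hA' a0 ha0
    obtain ⟨z, q, hq, hz, hAB, hnb⟩ := alt_path (G := G) (col := col) (β := β) A' B
      (fun x hx => (hA x (hA'A hx)).2.2) (fun x hx => (hB x hx).2.2) ha0 f hf1 hf2
    have hqR : ∀ x ∈ q, x ∈ R ∧ x ∉ O := by
      intro x hx
      rcases hAB x hx with h | h
      · exact ⟨(hA x (hA'A h)).1, (hA x (hA'A h)).2.1⟩
      · exact ⟨(hB x h).1, (hB x h).2.1⟩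
    obtain ⟨h1, h2⟩ := lemmaK_alpha hcol hq hm
      (fun l hl hlq => hno l hl (fun z hz => (hqR z (hlq z hz)).1)) B hnb
    exact ⟨z, q, hq, hz, hqR, h1, h2⟩
  obtain ⟨a0, -, -, ha0, -, h1, -⟩ := run a1 ha1
  have h2 := hd a0 (hA'A ha0)
  rw [← card_nbpos hO.nodup] at h2
  obtain ⟨i, hi⟩ : (nbpos G a0 O).Nonempty := by rw [← Finset.card_pos]; omega
  obtain ⟨hil, hia⟩ := mem_nbpos.1 hi
  obtain ⟨z, q, hq, hz, hqR, h3, h4⟩ := run a0 ha0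
  have h5 := hd z (hA'A hz)
  rw [← card_nbpos hO.nodup] at h5
  set J := nbpos G z O with hJ
  have hJn : J.Nonempty := by rw [← Finset.card_pos]; omega
  -- odd length of q
  have hqodd : q.length % 2 = 1 := by
    have e1 : col z = col a0 := by
      rw [(hA z (hA'A hz)).2.2, (hA a0 (hA'A ha0)).2.2]
    have hpos := hq.length_pos
    have e2 : col (q[0]'hpos) = col (q[q.length - 1]'(by omega)) := by
      rw [hq.getElem_zero, hq.getElem_last]; exact e1
    rw [hq.col_iff hcol] at e2
    omega
  have hmemO : ∀ t (ht : t < O.length), O[t] ∈ R := fun t ht => hOR _ (List.getElem_mem _)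
  -- gaps
  have gapR : ∀ j ∈ J, i < j → i + q.length + 1 ≤ j := by
    intro j hj hij
    obtain ⟨hjl, hjz⟩ := mem_nbpos.1 hj
    obtain ⟨s, hs, hsl, hsm⟩ := hO.seg (i := 0) (j := i) (by omega) hil
    obtain ⟨t, ht, htl, htm⟩ := hO.seg (i := j) (j := O.length - 1) (by omega) (by omega)
    have p1 := hs.append hq.reverse hia.symm (by
      intro x hx hx'
      obtain ⟨r, hr, -, -, rfl⟩ := hsm x hx
      exact (hqR _ (List.mem_reverse.1 hx')).2 (List.getElem_mem _))
    have p2 := p1.append ht hjz (by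
      intro x hx hx'
      obtain ⟨r, hr, hr1, hr2, rfl⟩ := htm x hx'
      rcases List.mem_append.1 hx with hx | hx
      · obtain ⟨r', hr', hr'1, hr'2, he⟩ := hsm _ hx
        have := hO.inj _ _ he
        omega
      · exact (hqR _ (List.mem_reverse.1 hx)).2 (List.getElem_mem _))
    have := hmax _ _ _ p2 (by
      intro x hx
      simp only [List.mem_append, List.mem_reverse] at hx
      rcases hx with (hx | hx) | hx
      · obtain ⟨r, hr, -, -, rfl⟩ := hsm x hx; exact hmemO _ _
      · exact (hqR x hx).1
      · obtain ⟨r, hr, -, -, rfl⟩ := htm x hx; exact hmemO _ _)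
    simp at this; omega
  have cycR : ∀ j ∈ J, i ≤ j → 3 ≤ j - i + 1 + q.length → j - i + 1 + q.length < 2 * m := by
    intro j hj hij h3
    obtain ⟨hjl, hjz⟩ := mem_nbpos.1 hj
    obtain ⟨s, hs, hsl, hsm⟩ := hO.seg (i := i) (j := j) (by omega) hjl
    have p1 := hs.append hq hjz.symm (by
      intro x hx hx'
      obtain ⟨r, hr, -, -, rfl⟩ := hsm x hx
      exact (hqR _ hx').2 (List.getElem_mem _))
    have := hno _ (p1.cyc hia (by simp; omega)) (by
      intro x hx
      simp only [List.mem_append] at hx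
      rcases hx with hx | hx
      · obtain ⟨r, hr, -, -, rfl⟩ := hsm x hx; exact hmemO _ _
      · exact (hqR x hx).1)
    simp at this; omega
  have cycL' : ∀ j ∈ J, j ≤ i → 3 ≤ i - j + 1 + q.length → i - j + 1 + q.length < 2 * m := by
    intro j hj hij h3
    obtain ⟨hjl, hjz⟩ := mem_nbpos.1 hj
    obtain ⟨s, hs, hsl, hsm⟩ := hO.seg (i := j) (j := i) (by omega) hil
    have p1 := hs.append hq.reverse hia.symm (by
      intro x hx hx'
      obtain ⟨r, hr, -, -, rfl⟩ := hsm x hx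
      exact (hqR _ (List.mem_reverse.1 hx')).2 (List.getElem_mem _))
    have := hno _ (p1.cyc hjz (by simp; omega)) (by
      intro x hx
      simp only [List.mem_append, List.mem_reverse] at hx
      rcases hx with hx | hx
      · obtain ⟨r, hr, -, -, rfl⟩ := hsm x hx; exact hmemO _ _
      · exact (hqR x hx).1)
    simp at this; omega
  have cycB : ∀ j ∈ J, ∀ t ∈ J, j < t → t - j + 2 < 2 * m := by
    intro j hj t ht hjt
    obtain ⟨hjl, hjz⟩ := mem_nbpos.1 hj
    obtain ⟨htl, htz⟩ := mem_nbpos.1 ht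
    obtain ⟨s, hs, hsl, hsm⟩ := hO.seg (i := j) (j := t) (by omega) htl
    have p1 := hs.cons hjz (by
      intro hx
      obtain ⟨r, hr, -, -, he⟩ := hsm z hx
      exact (hqR z hq.mem_left).2 (he ▸ List.getElem_mem _))
    have := hno _ (p1.cyc htz.symm (by simp; omega)) (by
      intro x hx
      simp only [List.mem_cons] at hx
      rcases hx with rfl | hx
      · exact (hqR x hq.mem_left).1
      · obtain ⟨r, hr, -, -, rfl⟩ := hsm x hx; exact hmemO _ _)
    simp at this; omega
  obtain ⟨lo, hlo, hi', hhi, hlh, hbd⟩ := spread J hJn (i % 2 ) (by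
    intro t ht
    have e1 : col z = col a0 := by
      rw [(hA z (hA'A hz)).2.2, (hA a0 (hA'A ha0)).2.2]
    obtain ⟨htl, htz⟩ := mem_nbpos.1 ht
    rw [← hO.col_iff hcol htl hil]
    have h1 := hcol _ _ htz
    have h2 := hcol _ _ hia
    rw [e1] at h1
    revert h1 h2
    cases col a0 <;> cases col O[i] <;> cases col O[t] <;> simp)
  have hlohi := (hbd lo hlo).2
  by_cases c1 : i ≤ lo
  · have := cycR hi' hhi (by omega)
    omega
  by_cases c2 : hi' ≤ i
  · have := cycL' lo hlo (by omega)
    omega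
  have hcc : (J.filter (fun t => i < t)).card + (J.filter (fun t => ¬ i < t)).card = J.card :=
    Finset.card_filter_add_card_filter_not _
  have hpar : ∀ t ∈ J, t % 2 = lo % 2 := fun t ht => nbpos_parity hO hcol ht hlo
  obtain ⟨x1, hx1, y1, hy1, hxy1, -⟩ := spread (J.filter (fun t => i < t))
    ⟨hi', Finset.mem_filter.2 ⟨hhi, by omega⟩⟩ _ (fun t ht => hpar t (Finset.mem_filter.1 ht).1)
  obtain ⟨x2, hx2, y2, hy2, hxy2, -⟩ := spread (J.filter (fun t => ¬ i < t))
    ⟨lo, Finset.mem_filter.2 ⟨hlo, by omega⟩⟩ _ (fun t ht => hpar t (Finset.mem_filter.1 ht).1)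
  rw [Finset.mem_filter] at hx1 hy1 hx2 hy2
  have g1 := gapR x1 hx1.1 hx1.2
  have g2 := (hbd y1 hy1.1).2
  have g3 := (hbd x2 hx2.1).1
  have := cycB lo hlo hi' hhi (by omega)
  omega

end
end SubdivEven


namespace SubdivEven
open Finset

/-- Lexicographic weight of a list of lengths: shorter earlier entries give larger weight. -/
def wt (B : ℕ) : ℕ → List ℕ → ℕ
  | 0, _ => 0
  | _ + 1, [] => 0
  | e + 1, L :: r => (B - 1 - L) * B ^ e + wt B e r

theorem wt_lt {B : ℕ} (hB : 1 ≤ B) : ∀ e l, wt B e l < B ^ e := by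
  intro e
  induction e with
  | zero => intro l; simp [wt]
  | succ e ih =>
    intro l
    cases l with
    | nil => simp only [wt]; positivity
    | cons L r =>
      simp only [wt]
      have h1 := ih r
      have h2 : (B - 1 - L + 1) * B ^ e ≤ B * B ^ e := Nat.mul_le_mul_right _ (by omega)
      rw [pow_succ, mul_comm (B ^ e) B]
      rw [add_mul] at h2
      omega

theorem wt_app {B L : ℕ} (hL : L + 1 < B) (r : List ℕ) : ∀ (p : List ℕ) (e : ℕ), p.length < e →
    wt B e p < wt B e (p ++ L :: r) := by
  intro p
  induction p with
  | nil =>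
    intro e he
    obtain ⟨e, rfl⟩ : ∃ e', e = e' + 1 := ⟨e - 1, by simp at he; omega⟩
    simp only [wt, List.nil_append]
    have : 0 < (B - 1 - L) * B ^ e := Nat.mul_pos (by omega) (Nat.pow_pos (by omega))
    omega
  | cons x p ih =>
    intro e he
    obtain ⟨e, rfl⟩ : ∃ e', e = e' + 1 := ⟨e - 1, by simp at he; omega⟩
    simp only [wt, List.cons_append]
    have := ih e (by simp at he; omega)
    omega

theorem wt_lt_of {B L L' : ℕ} (hL : L + 1 < B) (hL' : L' < L) (r r' : List ℕ) :
    ∀ (p : List ℕ) (e : ℕ), p.length < e → wt B e (p ++ L :: r) < wt B e (p ++ L' :: r') := by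
  intro p
  induction p with
  | nil =>
    intro e he
    obtain ⟨e, rfl⟩ : ∃ e', e = e' + 1 := ⟨e - 1, by simp at he; omega⟩
    simp only [wt, List.nil_append]
    have h1 := wt_lt (B := B) (by omega) e r
    have h2 : (B - 1 - L + 1) * B ^ e ≤ (B - 1 - L') * B ^ e := Nat.mul_le_mul_right _ (by omega)
    rw [add_mul] at h2
    omega
  | cons x p ih =>
    intro e he
    obtain ⟨e, rfl⟩ : ∃ e', e = e' + 1 := ⟨e - 1, by simp at he; omega⟩
    simp only [wt, List.cons_append]
    have := ih e (by simp at he; omega)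
    omega

/-- A state of the packing process. -/
structure St {V : Type*} (G : SimpleGraph V) {k : ℕ} (mm : Fin k → ℕ) (c : Fin k → List V)
    (I : Finset (Fin k)) (bl : List (Fin k)) : Prop where
  hI : ∀ i ∈ I, CycL G (c i) ∧ (c i).length = 2 * mm i
  hb : ∀ i ∈ bl, CycL G (c i) ∧ 2 * mm i ≤ (c i).length
  nd : bl.Nodup
  dsj : ∀ i ∈ bl, i ∉ I
  emp : ∀ i, i ∉ I → i ∉ bl → c i = []
  dis : ∀ i j, i ≠ j → ∀ x ∈ c i, x ∉ c j

section
variable {V : Type*} {G : SimpleGraph V} {k : ℕ} {mm : Fin k → ℕ} {c : Fin k → List V}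
    {I : Finset (Fin k)} {bl p s : List (Fin k)}

theorem St.append (h : St G mm c I bl) {b : Fin k} (hbI : b ∉ I) (hbb : b ∉ bl) {l : List V}
    (hl : CycL G l) (hlen : 2 * mm b ≤ l.length) (hdis : ∀ i, ∀ x ∈ l, x ∉ c i) :
    St G mm (Function.update c b l) I (bl ++ [b]) := by
  refine ⟨?_, ?_, ?_, ?_, ?_, ?_⟩
  · intro i hi
    rw [Function.update_of_ne (by rintro rfl; exact hbI hi)]
    exact h.hI i hi
  · intro i hi
    by_cases hib : i = b
    · subst hib; simp [hl, hlen]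
    · rw [Function.update_of_ne hib]
      simp only [List.mem_append, List.mem_singleton, hib, or_false] at hi
      exact h.hb i hi
  · rw [List.nodup_append]
    refine ⟨h.nd, by simp, ?_⟩
    intro x hx y hy
    simp at hy; subst hy; rintro rfl; exact hbb hx
  · intro i hi
    simp only [List.mem_append, List.mem_singleton] at hi
    rcases hi with hi | rfl
    · exact h.dsj i hi
    · exact hbI
  · intro i hi hi2
    simp only [List.mem_append, List.mem_singleton, not_or] at hi2
    rw [Function.update_of_ne hi2.2]
    exact h.emp i hi hi2.1
  · intro i j hij x hx
    by_cases hib : i = b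
    · subst hib
      rw [Function.update_self] at hx
      rw [Function.update_of_ne (Ne.symm hij)]
      exact hdis j x hx
    · rw [Function.update_of_ne hib] at hx
      by_cases hjb : j = b
      · subst hjb
        rw [Function.update_self]
        exact fun hh => hdis i x hh hx
      · rw [Function.update_of_ne hjb]
        exact h.dis i j hij x hx

theorem St.swap (h : St G mm c I bl) {j : Fin k} (hj : j ∈ I) {l : List V}
    (hl : CycL G l) (hlen : l.length = 2 * mm j) (hdis : ∀ i, i ≠ j → ∀ x ∈ l, x ∉ c i) :
    St G mm (Function.update c j l) I bl := by
  have hne : ∀ i ∈ bl, i ≠ j := by rintro i hi rfl; exact h.dsj i hi hj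
  refine ⟨?_, ?_, h.nd, h.dsj, ?_, ?_⟩
  · intro i hi
    by_cases hib : i = j
    · subst hib; simp [hl, hlen]
    · rw [Function.update_of_ne hib]
      exact h.hI i hi
  · intro i hi
    rw [Function.update_of_ne (hne i hi)]
    exact h.hb i hi
  · intro i hi hi2
    rw [Function.update_of_ne (by rintro rfl; exact hi hj)]
    exact h.emp i hi hi2
  · intro i i' hij x hx
    by_cases hib : i = j
    · subst hib
      rw [Function.update_self] at hx
      rw [Function.update_of_ne (Ne.symm hij)]
      exact hdis i' (Ne.symm hij) x hx
    · rw [Function.update_of_ne hib] at hx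
      by_cases hjb : i' = j
      · subst hjb
        rw [Function.update_self]
        exact fun hh => hdis i hib x hh hx
      · rw [Function.update_of_ne hjb]
        exact h.dis i i' hij x hx

open Classical in
/-- forget the cycles outside `I ∪ p`. -/
noncomputable def restr (c : Fin k → List V) (I : Finset (Fin k)) (p : List (Fin k)) : Fin k → List V :=
  fun i => if i ∈ I ∨ i ∈ p then c i else []

theorem restr_pos {i : Fin k} (h : i ∈ I ∨ i ∈ p) : restr c I p i = c i := if_pos h
theorem restr_neg {i : Fin k} (h : ¬ (i ∈ I ∨ i ∈ p)) : restr c I p i = [] := if_neg h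

theorem mem_restr {i : Fin k} {x : V} (h : x ∈ restr c I p i) : (i ∈ I ∨ i ∈ p) ∧ x ∈ c i := by
  by_cases hi : i ∈ I ∨ i ∈ p
  · rw [restr_pos hi] at h; exact ⟨hi, h⟩
  · rw [restr_neg hi] at h; simp at h

theorem St.drop (h : St G mm c I (p ++ s)) : St G mm (restr c I p) I p := by
  have hnd := List.nodup_append.1 h.nd
  refine ⟨?_, ?_, hnd.1, ?_, ?_, ?_⟩
  · intro i hi
    rw [restr_pos (Or.inl hi)]; exact h.hI i hi
  · intro i hi
    rw [restr_pos (Or.inr hi)]; exact h.hb i (List.mem_append_left _ hi)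
  · intro i hi; exact h.dsj i (List.mem_append_left _ hi)
  · intro i hi hi2
    exact restr_neg (by tauto)
  · intro i j hij x hx hx'
    exact h.dis i j hij x (mem_restr hx).2 (mem_restr hx').2

end

/-- An optimal state, together with a longest path in the rest. -/
structure Opt {V : Type*} [Fintype V] (G : SimpleGraph V) {k : ℕ} (mm : Fin k → ℕ)
    (c : Fin k → List V) (I : Finset (Fin k)) (bl : List (Fin k)) (P : List V) : Prop where
  st : St G mm c I bl
  o1 : ∀ c' I' bl', St G mm c' I' bl' → I'.card ≤ I.card
  o2 : ∀ c' bl', St G mm c' I bl' → wt (Fintype.card V + 2) k (bl'.map (fun i => (c' i).length)) ≤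
    wt (Fintype.card V + 2) k (bl.map (fun i => (c i).length))
  chain : P.IsChain G.Adj
  nodup : P.Nodup
  out : ∀ x ∈ P, ∀ i, x ∉ c i
  o3 : ∀ c' (P' : List V), St G mm c' I bl → (∀ i ∈ bl, (c' i).length = (c i).length) → P'.IsChain G.Adj →
    P'.Nodup → (∀ x ∈ P', ∀ i, x ∉ c' i) → P'.length ≤ P.length

section
variable {V : Type*} [Fintype V] {G : SimpleGraph V} {k : ℕ} {mm : Fin k → ℕ}

theorem exists_opt (G : SimpleGraph V) (mm : Fin k → ℕ) : ∃ c I bl P, Opt G mm c I bl P := by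
  classical
  set B := Fintype.card V + 2 with hB
  let Q1 : ℕ → Prop := fun n => ∃ c I bl, St G mm c I bl ∧ I.card = n
  have b1 : ∀ n, Q1 n → n ≤ k := by
    rintro n ⟨c, I, bl, -, rfl⟩
    simpa using Finset.card_le_univ I
  have q1 : Q1 0 := ⟨fun _ => [], ∅, [], ⟨by simp, by simp, by simp, by simp, by simp, by simp⟩, rfl⟩
  obtain ⟨c1, I, bl1, hs1, hI⟩ := Nat.findGreatest_spec (P := Q1) (Nat.zero_le k) q1
  have o1 : ∀ c' I' bl', St G mm c' I' bl' → I'.card ≤ I.card := by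
    intro c' I' bl' h
    rw [hI]
    exact Nat.le_findGreatest (b1 _ ⟨_, _, _, h, rfl⟩) ⟨_, _, _, h, rfl⟩
  let Q2 : ℕ → Prop := fun n => ∃ c bl, St G mm c I bl ∧ wt B k (bl.map (fun i => (c i).length)) = n
  have b2 : ∀ n, Q2 n → n ≤ B ^ k := by
    rintro n ⟨c, bl, -, rfl⟩
    exact (wt_lt (by omega) _ _).le
  have q2 : Q2 _ := ⟨c1, bl1, hs1, rfl⟩
  obtain ⟨c2, bl, hs2, hw⟩ := Nat.findGreatest_spec (P := Q2) (b2 _ q2) q2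
  have o2 : ∀ c' bl', St G mm c' I bl' → wt B k (bl'.map (fun i => (c' i).length)) ≤
      wt B k (bl.map (fun i => (c2 i).length)) := by
    intro c' bl' h
    rw [hw]
    exact Nat.le_findGreatest (b2 _ ⟨_, _, h, rfl⟩) ⟨_, _, h, rfl⟩
  let Q3 : ℕ → Prop := fun n => ∃ (c : Fin k → List V) (P : List V), St G mm c I bl ∧ (∀ i ∈ bl, (c i).length = (c2 i).length) ∧
    P.IsChain G.Adj ∧ P.Nodup ∧ (∀ x ∈ P, ∀ i, x ∉ c i) ∧ P.length = n
  have b3 : ∀ n, Q3 n → n ≤ Fintype.card V := by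
    rintro n ⟨c, P, -, -, -, h, -, rfl⟩
    exact h.length_le_card
  have q3 : Q3 0 := ⟨c2, [], hs2, fun _ _ => rfl, List.isChain_nil, List.nodup_nil, by simp, rfl⟩
  obtain ⟨c, P, hs, hlen, hch, hnd, hout, hP⟩ := Nat.findGreatest_spec (P := Q3) (b3 _ q3) q3
  refine ⟨c, I, bl, P, hs, o1, ?_, hch, hnd, hout, ?_⟩
  · intro c' bl' h
    have := o2 c' bl' h
    rw [List.map_congr_left hlen]
    exact this
  · intro c' P' h1 h2 h3 h4 h5
    rw [hP]
    have hq : Q3 P'.length := ⟨c', P', h1, fun i hi => (h2 i hi).trans (hlen i hi), h3, h4, h5, rfl⟩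
    exact Nat.le_findGreatest (b3 _ hq) hq

variable {c : Fin k → List V} {I : Finset (Fin k)} {bl p s : List (Fin k)} {P : List V}

/-- Main improvement step. -/
theorem Opt.improve (h : Opt G mm c I bl P) (hbl : bl = p ++ s) {c0 : Fin k → List V}
    (h0 : St G mm c0 I p) (hlen0 : ∀ i ∈ p, (c0 i).length = (c i).length) {b : Fin k}
    (hbI : b ∉ I) (hbp : b ∉ p) {l : List V} (hl : CycL G l) (hlen : 2 * mm b ≤ l.length)
    (hdis : ∀ i, ∀ x ∈ l, x ∉ c0 i) (hs : ∀ b' r, s = b' :: r → l.length < (c b').length) : False := by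
  have h1 := h0.append hbI hbp hl hlen hdis
  have h2 := h.o2 _ _ h1
  have hpk : p.length < k := by
    have := h1.nd.length_le_card
    simp at this; omega
  have hmap : (p ++ [b]).map (fun i => (Function.update c0 b l i).length) =
      p.map (fun i => (c i).length) ++ [l.length] := by
    rw [List.map_append]
    congr 1
    · apply List.map_congr_left
      intro i hi
      rw [Function.update_of_ne (by rintro rfl; exact hbp hi), hlen0 i hi]
    · simp
  rw [hmap, hbl, List.map_append] at h2
  cases s with
  | nil =>
    have := wt_app (B := Fintype.card V + 2) (L := l.length)
      (by have := hl.nodup.length_le_card; omega) [] (p.map (fun i => (c i).length)) k (by simpa using hpk)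
    simp only [List.map_nil, List.append_nil] at h2
    omega
  | cons b' r =>
    have hb' : b' ∈ bl := by rw [hbl]; simp
    have hcb := (h.st.hb b' hb').1.nodup.length_le_card
    have := wt_lt_of (B := Fintype.card V + 2) (L := (c b').length) (L' := l.length)
      (by omega) (hs b' r rfl) (r.map (fun i => (c i).length)) []
      (p.map (fun i => (c i).length)) k (by simpa using hpk)
    simp only [List.map_cons] at h2
    omega

theorem Opt.long (h : Opt G mm c I bl P) {b : Fin k} (hb : b ∈ bl) : 2 * mm b < (c b).length := by
  classical
  by_contra hcon
  have h1 := h.st.hb b hb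
  have hbI := h.st.dsj b hb
  have hst : St G mm c (insert b I) (bl.erase b) := by
    refine ⟨?_, ?_, h.st.nd.erase _, ?_, ?_, h.st.dis⟩
    · intro i hi
      rcases Finset.mem_insert.1 hi with rfl | hi
      · exact ⟨h1.1, by omega⟩
      · exact h.st.hI i hi
    · intro i hi; exact h.st.hb i (List.mem_of_mem_erase hi)
    · intro i hi hi2
      have h3 := (h.st.nd.mem_erase_iff).1 hi
      rcases Finset.mem_insert.1 hi2 with hh | hh
      · exact h3.1 hh
      · exact h.st.dsj i h3.2 hh
    · intro i hi hi2
      rw [Finset.mem_insert, not_or] at hi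
      rw [h.st.nd.mem_erase_iff, not_and] at hi2
      exact h.st.emp i hi.2 (hi2 hi.1)
  have := h.o1 _ _ _ hst
  rw [Finset.card_insert_of_notMem hbI] at this
  omega

end
end SubdivEven


namespace SubdivEven
open Finset
set_option linter.unusedSectionVars false

/-- uncovered vertices -/
def Rst {V : Type*} [Fintype V] [DecidableEq V] {k : ℕ} (c : Fin k → List V) : Finset V :=
  Finset.univ \ Finset.univ.biUnion (fun i => (c i).toFinset)

section
variable {V : Type*} [Fintype V] [DecidableEq V] {G : SimpleGraph V} {k : ℕ} {mm : Fin k → ℕ}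
variable {c : Fin k → List V} {I : Finset (Fin k)} {bl p s : List (Fin k)} {P : List V}
  {col : V → Bool}

theorem mem_Rst {x : V} : x ∈ Rst c ↔ ∀ i, x ∉ c i := by
  simp [Rst]

theorem dg_sdiff_add (G : SimpleGraph V) (v : V) {S T : Finset V} (h : S ⊆ T) :
    dg G v T = dg G v S + dg G v (T \ S) := by
  classical
  unfold dg
  rw [← Finset.card_union_of_disjoint]
  · congr 1
    ext x
    simp only [Finset.mem_filter, Finset.mem_union, Finset.mem_sdiff]
    have := @h x
    tauto
  · rw [Finset.disjoint_left]
    intro x hx hx'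
    simp only [Finset.mem_filter, Finset.mem_sdiff] at hx hx'
    tauto

theorem dg_mono (G : SimpleGraph V) (v : V) {S T : Finset V} (h : ∀ x ∈ S, G.Adj v x → x ∈ T) :
    dg G v S ≤ dg G v T := by
  classical
  unfold dg
  apply Finset.card_le_card
  intro x hx
  rw [Finset.mem_filter] at hx ⊢
  exact ⟨h x hx.1 hx.2, hx.2⟩

theorem dg_le_card (G : SimpleGraph V) (v : V) (S : Finset V) : dg G v S ≤ S.card := by
  classical
  unfold dg
  exact Finset.card_filter_le _ _

theorem dg_biUnion (G : SimpleGraph V) (v : V) (hdis : ∀ i j, i ≠ j → ∀ x ∈ c i, x ∉ c j) :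
    dg G v (Finset.univ.biUnion (fun i => (c i).toFinset)) = ∑ i, dg G v (c i).toFinset := by
  classical
  unfold dg
  rw [← Finset.card_biUnion]
  · congr 1
    ext x; simp only [Finset.mem_filter, Finset.mem_biUnion, Finset.mem_univ, true_and]
    constructor
    · rintro ⟨⟨i, hi⟩, h⟩; exact ⟨i, hi, h⟩
    · rintro ⟨i, hi, h⟩; exact ⟨⟨i, hi⟩, h⟩
  · intro i _ j _ hij
    simp only [Function.onFun]
    rw [Finset.disjoint_left]
    intro x hx hx'
    simp only [Finset.mem_filter, List.mem_toFinset] at hx hx'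
    exact hdis i j hij x hx.1 hx'.1

theorem dg_total (G : SimpleGraph V) (v : V) (hdis : ∀ i j, i ≠ j → ∀ x ∈ c i, x ∉ c j) :
    dg G v Finset.univ = ∑ i, dg G v (c i).toFinset + dg G v (Rst c) := by
  rw [dg_sdiff_add G v (Finset.subset_univ (Finset.univ.biUnion (fun i => (c i).toFinset))),
    dg_biUnion G v hdis]
  rfl

/-- double counting -/
theorem dg_comm (G : SimpleGraph V) (S T : Finset V) : ∑ x ∈ S, dg G x T = ∑ y ∈ T, dg G y S := by
  classical
  unfold dg
  have := Finset.sum_card_bipartiteAbove_eq_sum_card_bipartiteBelow (s := S) (t := T)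
    (fun x y => G.Adj x y)
  unfold Finset.bipartiteAbove Finset.bipartiteBelow at this
  rw [this]
  apply Finset.sum_congr rfl
  intro y _
  congr 1
  ext x; simp [G.adj_comm]

/-- excess towards the exact cycles -/
noncomputable def exc (G : SimpleGraph V) (mm : Fin k → ℕ) (c : Fin k → List V) (I : Finset (Fin k))
    (v : V) : ℤ := ∑ j ∈ I, ((dg G v (c j).toFinset : ℤ) - ((mm j : ℤ) - 1))

theorem St.deg (h : St G mm c I bl) (hm : ∀ i, 3 ≤ mm i)
    (hD : ∀ v, ∑ i, (mm i - 1) + 1 ≤ dg G v Finset.univ) {i0 : Fin k} (hi0 : i0 ∉ I)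
    (hi0' : i0 ∉ bl) {v : V} (hv : ∀ i ∈ bl, dg G v (c i).toFinset ≤ mm i - 1) :
    (mm i0 : ℤ) ≤ exc G mm c I v + dg G v (Rst c) := by
  have h1 := hD v
  rw [dg_total G v h.dis] at h1
  have h2 : (∑ i, ((mm i : ℤ) - 1)) + 1 ≤ ∑ i, (dg G v (c i).toFinset : ℤ) + dg G v (Rst c) := by
    have : ((∑ i, (mm i - 1) + 1 : ℕ) : ℤ) ≤ ((∑ i, dg G v (c i).toFinset + dg G v (Rst c) : ℕ) : ℤ) :=
      by exact_mod_cast h1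
    push_cast at this
    rw [Finset.sum_congr rfl (g := fun i => ((mm i : ℤ) - 1))] at this
    · exact this
    · intro i _; have := hm i; omega
  have h3 : (mm i0 : ℤ) - 1 ≤ ∑ i ∈ Iᶜ, (((mm i : ℤ) - 1) - dg G v (c i).toFinset) := by
    have hz : ((mm i0 : ℤ) - 1) = ((mm i0 : ℤ) - 1) - dg G v (c i0).toFinset := by
      rw [h.emp i0 hi0 hi0']
      simp [dg]
    rw [hz]
    apply Finset.single_le_sum (f := fun i => (((mm i : ℤ) - 1) - dg G v (c i).toFinset))
    · intro i hi
      by_cases hib : i ∈ bl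
      · have := hv i hib
        have := hm i
        show (0 : ℤ) ≤ ((mm i : ℤ) - 1) - dg G v (c i).toFinset
        omega
      · show (0 : ℤ) ≤ ((mm i : ℤ) - 1) - dg G v (c i).toFinset
        rw [h.emp i (Finset.mem_compl.1 hi) hib]
        have := hm i
        simp [dg]; omega
    · exact Finset.mem_compl.2 hi0
  rw [Finset.sum_sub_distrib] at h3
  rw [← Finset.sum_add_sum_compl I (fun i => ((mm i : ℤ) - 1)),
    ← Finset.sum_add_sum_compl I (fun i => (dg G v (c i).toFinset : ℤ))] at h2
  unfold exc
  rw [Finset.sum_sub_distrib]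
  linarith

theorem Opt.U1 (h : Opt G mm c I bl P) (hcol : ∀ u v, G.Adj u v → col u ≠ col v)
    (hm : ∀ i, 3 ≤ mm i) {b : Fin k} {r : List (Fin k)} (hbl : bl = p ++ b :: r) {v : V}
    (hvI : ∀ i ∈ I, v ∉ c i) (hvp : ∀ i ∈ p, v ∉ c i) (hvb : v ∉ c b) :
    dg G v (c b).toFinset ≤ mm b - 1 := by
  by_contra hcon
  push Not at hcon
  have hb : b ∈ bl := by rw [hbl]; simp
  have h1 := h.long hb
  have h2 := h.st.hb b hb
  have hev := h2.1.even hcol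
  have hnd := h.st.nd
  rw [hbl] at hnd
  have hbp : b ∉ p := fun hh => (List.nodup_append.1 hnd).2.2 b hh b (by simp) rfl
  have hm3 := hm b
  obtain ⟨l', c1, c2, c3, c4⟩ := shortcut h2.1 hcol (m := mm b) (L := (c b).length / 2) (by omega) hvb
    (hm b) (by omega) (by omega)
  refine h.improve hbl (St.drop (s := b :: r) (hbl ▸ h.st)) (fun i hi => by rw [restr_pos (Or.inr hi)])
    (h.st.dsj b hb) hbp c1 c2 ?_ ?_
  · intro i x hx hx'
    obtain ⟨hi, hxi⟩ := mem_restr hx'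
    rcases c4 x hx with rfl | hxb
    · rcases hi with hi | hi
      · exact hvI i hi hxi
      · exact hvp i hi hxi
    · have hib : i = b := by
        by_contra hne; exact h.st.dis i b hne x hxi hxb
      subst hib
      rcases hi with hi | hi
      · exact h.st.dsj i hb hi
      · exact hbp hi
  · intro b' r' hh
    simp only [List.cons.injEq] at hh
    rw [← hh.1]; omega

theorem Opt.U2 (h : Opt G mm c I bl P) (hcol : ∀ u v, G.Adj u v → col u ≠ col v)
    (hm : ∀ i, 3 ≤ mm i) {b : Fin k} {r : List (Fin k)} (hbl : bl = p ++ b :: r) {v : V}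
    (hvb : v ∈ c b) :
    dg G v (c b).toFinset ≤ mm b - 1 := by
  by_contra hcon
  push Not at hcon
  have hb : b ∈ bl := by rw [hbl]; simp
  have h1 := h.long hb
  have h2 := h.st.hb b hb
  have hev := h2.1.even hcol
  have hnd := h.st.nd
  rw [hbl] at hnd
  have hbp : b ∉ p := fun hh => (List.nodup_append.1 hnd).2.2 b hh b (by simp) rfl
  have hm3 := hm b
  obtain ⟨l', c1, c2, c3, c4⟩ := chord h2.1 hcol (m := mm b) (L := (c b).length / 2) (by omega) hvb
    (hm b) (by omega) (by omega)
  refine h.improve hbl (St.drop (s := b :: r) (hbl ▸ h.st)) (fun i hi => by rw [restr_pos (Or.inr hi)])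
    (h.st.dsj b hb) hbp c1 c2 ?_ ?_
  · intro i x hx hx'
    obtain ⟨hi, hxi⟩ := mem_restr hx'
    have hxb := c4 x hx
    have hib : i = b := by
      by_contra hne; exact h.st.dis i b hne x hxi hxb
    subst hib
    rcases hi with hi | hi
    · exact h.st.dsj i hb hi
    · exact hbp hi
  · intro b' r' hh
    simp only [List.cons.injEq] at hh
    rw [← hh.1]; omega

theorem Opt.U3 (h : Opt G mm c I bl P) {b : Fin k} (hbI : b ∉ I) (hbb : b ∉ bl) {l : List V}
    (hl : CycL G l) (hlR : ∀ x ∈ l, x ∈ Rst c) : l.length < 2 * mm b := by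
  by_contra hcon
  exact h.improve (s := []) (by simp) h.st (fun _ _ => rfl) hbI hbb hl (by omega)
    (fun i x hx => mem_Rst.1 (hlR x hx) i) (by simp)

theorem Opt.degR (h : Opt G mm c I bl P) (hcol : ∀ u v, G.Adj u v → col u ≠ col v)
    (hm : ∀ i, 3 ≤ mm i) (hD : ∀ v, ∑ i, (mm i - 1) + 1 ≤ dg G v Finset.univ) {i0 : Fin k}
    (hi0 : i0 ∉ I) (hi0' : i0 ∉ bl) {v : V} (hv : v ∈ Rst c) :
    (mm i0 : ℤ) ≤ exc G mm c I v + dg G v (Rst c) := by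
  rw [mem_Rst] at hv
  refine h.st.deg hm hD hi0 hi0' ?_
  intro i hi
  obtain ⟨p, r, hpr⟩ := List.append_of_mem hi
  exact h.U1 hcol hm hpr (fun i _ => hv i) (fun i _ => hv i) (hv i)

theorem sum_shift {M : Type*} [AddCommMonoid M] [IsCancelAdd M] (f : ℕ → M) (n : ℕ)
    (hf : ∀ i, f (i + n) = f i) (d : ℕ) :
    ∑ i ∈ Finset.range n, f (i + d) = ∑ i ∈ Finset.range n, f i := by
  induction d with
  | zero => simp
  | succ d ih =>
    rw [← ih]
    have h1 := Finset.sum_range_succ (fun i => f (i + d)) n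
    have h2 := Finset.sum_range_succ' (fun i => f (i + d)) n
    rw [h1] at h2
    have h3 : f (n + d) = f (0 + d) := by rw [add_comm n d, hf, zero_add]
    rw [h3] at h2
    have h4 := add_right_cancel h2
    rw [h4]
    apply Finset.sum_congr rfl
    intro i _
    congr 1; omega

theorem CycL.rotate {l : List V} (h : CycL G l) (r : ℕ) : CycL G (l.rotate r) := by
  refine cycL_of (by simpa using h.len) (by simpa using h.nodup) ?_
  intro j hj
  have hj' : j < l.length := by simpa using hj
  rw [List.getElem_rotate, List.getElem_rotate]
  have := h.adj ((j + r) % l.length) (Nat.mod_lt _ (by omega))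
  convert this using 2
  simp only [List.length_rotate, Nat.mod_add_mod]
  congr 1; omega

/-- edges between the last block and an exact cycle -/
theorem Opt.U4 (h : Opt G mm c I bl P) (hcol : ∀ u v, G.Adj u v → col u ≠ col v)
    (hm : ∀ i, 3 ≤ mm i) {b : Fin k} (hbl : bl = p ++ [b]) {j : Fin k} (hj : j ∈ I) :
    ∑ u ∈ (c b).toFinset, dg G u (c j).toFinset ≤ (c b).length * (mm j - 1) := by
  have hb : b ∈ bl := by rw [hbl]; simp
  have hbI := h.st.dsj b hb
  have hbj : b ≠ j := by rintro rfl; exact hbI hj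
  have h1 := h.long hb
  have h2 := h.st.hb b hb
  have hev := h2.1.even hcol
  have hnd := h.st.nd
  rw [hbl] at hnd
  have hbp : b ∉ p := fun hh => (List.nodup_append.1 hnd).2.2 b hh b (by simp) rfl
  have hm3 := hm b
  have hm3j := hm j
  have hjI := h.st.hI j hj
  set n := (c b).length with hn
  let f : ℕ → ℕ := fun i => dg G ((c b)[i % n]'(Nat.mod_lt _ (by omega))) (c j).toFinset
  have hf : ∀ i, f (i + n) = f i := by intro i; simp [f]
  have hrot : ∀ r, f (r + 0) + f (r + 1) + f (r + 2) + f (r + (n - 1)) + f (r + (n - 2)) +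
      f (r + (n - 3)) + 6 ≤ 6 * mm j := by
    intro r
    by_contra hcon
    have hc1 := h2.1.rotate r
    have hlen1 : ((c b).rotate r).length = n := by simp [hn]
    obtain ⟨a, z, hp, -, -⟩ := id hc1
    have hget : ∀ i (hi : i < ((c b).rotate r).length), dg G (((c b).rotate r)[i]) (c j).toFinset
        = f (r + i) := by
      intro i hi
      rw [List.getElem_rotate]
      simp only [f, add_comm, ← hn]
    obtain ⟨l1, l2, k1, k2, k3, k4, k5, k6, k7⟩ := key hcol hp (p := n / 2) (q := mm j) (by omega)
      (by omega) hjI.1 (hm j) hjI.2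
      (by intro x hx; rw [List.mem_rotate] at hx; exact h.st.dis b j hbj x hx)
      (by
        rw [hget, hget, hget, hget, hget, hget]
        have e : 2 * (n / 2) = n := by omega
        rw [e]
        omega)
    have k6' : ∀ x ∈ l1, x ∈ c b ∨ x ∈ c j := by
      intro x hx; rcases k6 x hx with hh | hh
      · left; simpa using hh
      · exact Or.inr hh
    have k7' : ∀ x ∈ l2, x ∈ c b ∨ x ∈ c j := by
      intro x hx; rcases k7 x hx with hh | hh
      · left; simpa using hh
      · exact Or.inr hh
    have hoth : ∀ i, i ≠ j → ∀ x, (x ∈ c b ∨ x ∈ c j) → x ∉ restr c I p i := by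
      intro i hij x hx hx'
      obtain ⟨hi, hxi⟩ := mem_restr hx'
      have hib : i ≠ b := by
        rintro rfl
        rcases hi with hi | hi
        · exact hbI hi
        · exact hbp hi
      rcases hx with hx | hx
      · exact h.st.dis i b hib x hxi hx
      · exact h.st.dis i j hij x hxi hx
    have st1 := (St.drop (s := [b]) (hbl ▸ h.st)).swap hj k1 k3
      (fun i hij x hx => hoth i hij x (k6' x hx))
    refine h.improve hbl st1 ?_ hbI hbp k2 (by omega) ?_ ?_
    · intro i hi
      have hij : i ≠ j := by
        rintro rfl; exact h.st.dsj i (by rw [hbl]; simp [hi]) hj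
      rw [Function.update_of_ne hij, restr_pos (Or.inr hi)]
    · intro i x hx hx'
      by_cases hij : i = j
      · subst hij
        rw [Function.update_self] at hx'
        exact k5 x hx' hx
      · rw [Function.update_of_ne hij] at hx'
        exact hoth i hij x (k7' x hx) hx'
    · intro b' r' hh
      simp only [List.cons.injEq] at hh
      rw [← hh.1]; omega
  have hsum := Finset.sum_le_sum (s := Finset.range n) (fun r _ => hrot r)
  simp only [Finset.sum_add_distrib, sum_shift f n hf, Finset.sum_const, Finset.card_range,
    smul_eq_mul] at hsum
  have hE : ∑ u ∈ (c b).toFinset, dg G u (c j).toFinset = ∑ i ∈ Finset.range n, f i := by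
    have e0 : (c b).map (fun u => dg G u (c j).toFinset) = List.ofFn (fun i : Fin n => f i) := by
      apply List.ext_getElem
      · simp [hn]
      · intro i hi1 hi2
        have hi : i < n := by simpa using hi2
        simp only [List.getElem_map, List.getElem_ofFn, f, Nat.mod_eq_of_lt hi]
    rw [List.sum_toFinset _ h2.1.nodup, e0, List.sum_ofFn, Finset.sum_range]
  rw [hE]
  have e2 : n * (6 * mm j) = 6 * (n * (mm j - 1)) + n * 6 := by
    obtain ⟨t, ht⟩ : ∃ t, mm j = t + 1 := ⟨mm j - 1, by omega⟩
    rw [ht, Nat.add_sub_cancel]; ring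
  rw [e2] at hsum
  omega

end
end SubdivEven


namespace SubdivEven
open Finset
set_option linter.unusedSectionVars false

section
variable {V : Type*} [Fintype V] [DecidableEq V] {G : SimpleGraph V} {k : ℕ} {mm : Fin k → ℕ}
variable {c : Fin k → List V} {I : Finset (Fin k)} {bl p s : List (Fin k)} {P : List V}
  {col : V → Bool}

theorem St.cyc_or (h : St G mm c I bl) (i : Fin k) : CycL G (c i) ∨ c i = [] := by
  by_cases h1 : i ∈ I
  · exact Or.inl (h.hI i h1).1
  by_cases h2 : i ∈ bl
  · exact Or.inl (h.hb i h2).1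
  exact Or.inr (h.emp i h1 h2)

theorem St.cov_disj (h : St G mm c I bl) :
    (Set.univ : Set (Fin k)).PairwiseDisjoint (fun i => (c i).toFinset) := by
  intro i _ j _ hij
  simp only [Function.onFun]
  rw [Finset.disjoint_left]
  intro x hx hx'
  exact h.dis i j hij x (by simpa using hx) (by simpa using hx')

theorem St.balR (h : St G mm c I bl) (hcol : ∀ u v, G.Adj u v → col u ≠ col v)
    (hbal : ∑ v, sg col v = 0) : ∑ v ∈ Rst c, sg col v = 0 := by
  have h1 := Finset.sum_sdiff (f := sg col)
    (Finset.subset_univ (Finset.univ.biUnion (fun i => (c i).toFinset)))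
  have h2 : ∑ v ∈ Finset.univ.biUnion (fun i => (c i).toFinset), sg col v = 0 := by
    rw [Finset.sum_biUnion (by simpa using h.cov_disj)]
    apply Finset.sum_eq_zero
    intro i _
    rcases h.cyc_or i with hc | hc
    · exact hc.sum_sg hcol
    · rw [hc]; simp
  rw [h2, hbal, add_zero] at h1
  exact h1

theorem St.cardR (h : St G mm c I bl) : Fintype.card V = ∑ i, (c i).length + (Rst c).card := by
  have h1 := Finset.card_sdiff_add_card_eq_card
    (Finset.subset_univ (Finset.univ.biUnion (fun i => (c i).toFinset)))
  rw [Finset.card_biUnion (by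
    intro i _ j _ hij
    exact h.cov_disj (Set.mem_univ i) (Set.mem_univ j) hij)] at h1
  rw [Finset.card_univ] at h1
  rw [← h1, add_comm]
  congr 1
  apply Finset.sum_congr rfl
  intro i _
  rcases h.cyc_or i with hc | hc
  · exact (List.toFinset_card_of_nodup hc.nodup)
  · rw [hc]; simp

theorem Opt.bigR (h : Opt G mm c I bl P) (hcol : ∀ u v, G.Adj u v → col u ≠ col v)
    (hm : ∀ i, 3 ≤ mm i) (hD : ∀ v, ∑ i, (mm i - 1) + 1 ≤ dg G v Finset.univ)
    (hbal : ∑ v, sg col v = 0) (hN : 2 * ∑ i, mm i + 2 ≤ Fintype.card V) {i0 : Fin k}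
    (hi0 : i0 ∉ I) (hi0' : i0 ∉ bl) : 2 * mm i0 + 2 ≤ (Rst c).card ∧ (Rst c).card % 2 = 0 := by
  have heven : (Rst c).card % 2 = 0 := by
    have h1 := h.st.balR hcol hbal
    rw [sum_sg] at h1
    have h2 := card_split (col := col) (Rst c)
    omega
  refine ⟨?_, heven⟩
  rcases List.eq_nil_or_concat bl with hbl | ⟨p, b, hbl⟩
  · have h1 := h.st.cardR
    have h2 : ∑ i, (c i).length + 2 * mm i0 ≤ 2 * ∑ i, mm i := by
      rw [Finset.mul_sum, ← Finset.sum_erase_add _ _ (Finset.mem_univ i0),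
        ← Finset.sum_erase_add _ (fun i => 2 * mm i) (Finset.mem_univ i0)]
      rw [h.st.emp i0 hi0 hi0']
      simp only [List.length_nil, add_zero]
      gcongr with i _
      by_cases hi : i ∈ I
      · exact (h.st.hI i hi).2.le
      · rw [h.st.emp i hi (by rw [hbl]; simp)]; simp
    omega
  · rw [List.concat_eq_append] at hbl
    have hb : b ∈ bl := by rw [hbl]; simp
    have hbI := h.st.dsj b hb
    have h1 := h.long hb
    have h2 := h.st.hb b hb
    have hev := h2.1.even hcol
    have hnd := h.st.nd
    rw [hbl] at hnd
    have hbp : b ∉ p := fun hh => (List.nodup_append.1 hnd).2.2 b hh b (by simp) rfl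
    -- degrees of vertices in the last block
    have hdeg : ∀ u ∈ (c b).toFinset, (mm i0 : ℤ) ≤ exc G mm c I u + dg G u (Rst c) := by
      intro u hu
      rw [List.mem_toFinset] at hu
      refine h.st.deg hm hD hi0 hi0' ?_
      intro i hi
      by_cases hib : i = b
      · subst hib; exact h.U2 hcol hm hbl hu
      · have hoth : ∀ j, j ≠ b → u ∉ c j := fun j hj hh => h.st.dis j b hj u hh hu
        obtain ⟨p', r, hpr⟩ := List.append_of_mem hi
        have hp' : b ∉ p' := by
          intro hbp'
          have hbr : b ∈ r ∨ r = [] := by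
            have : (i :: r).getLast? = some b := by
              have := congrArg List.getLast? (hbl.symm.trans hpr)
              simpa using this.symm
            rcases List.eq_nil_or_concat r with hr | ⟨r', z, hr⟩
            · right; exact hr
            · left
              rw [hr, List.concat_eq_append] at this ⊢
              rw [← List.cons_append, List.getLast?_append] at this
              simp at this
              simp [this]
          have hnd' := h.st.nd
          rw [hpr] at hnd'
          rcases hbr with hbr | hbr
          · exact (List.nodup_append.1 hnd').2.2 b hbp' b (by simp [hbr]) rfl
          · have := congrArg List.getLast? (hbl.symm.trans hpr)
            rw [hbr] at this
            simp at this
            exact hib this.symm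
        exact h.U1 hcol hm hpr (fun j hj => hoth j (by rintro rfl; exact hbI hj))
          (fun j hj => hoth j (by rintro rfl; exact hp' hj)) (hoth i hib)
    have hsum := Finset.sum_le_sum hdeg
    rw [Finset.sum_add_distrib, Finset.sum_const, List.toFinset_card_of_nodup h2.1.nodup] at hsum
    have hexc : ∑ u ∈ (c b).toFinset, exc G mm c I u ≤ 0 := by
      unfold exc
      rw [Finset.sum_comm]
      apply Finset.sum_nonpos
      intro j hj
      have h3 := h.U4 hcol hm hbl hj
      have hmj := hm j
      rw [Finset.sum_sub_distrib, Finset.sum_const, List.toFinset_card_of_nodup h2.1.nodup]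
      have h4 : ((∑ u ∈ (c b).toFinset, dg G u (c j).toFinset : ℕ) : ℤ) ≤
          (((c b).length * (mm j - 1) : ℕ) : ℤ) := by exact_mod_cast h3
      rw [Nat.cast_mul, Nat.cast_sub (by omega)] at h4
      push_cast at h4
      simp only [nsmul_eq_mul]
      linarith
    have h5 : ∑ u ∈ (c b).toFinset, dg G u (Rst c) ≤ (Rst c).card * (mm b - 1) := by
      rw [dg_comm]
      rw [← smul_eq_mul]
      apply Finset.sum_le_card_nsmul
      intro v hv
      rw [mem_Rst] at hv
      exact h.U1 hcol hm hbl (fun i _ => hv i) (fun i _ => hv i) (hv b)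
    have h6 : (c b).length * mm i0 ≤ (Rst c).card * (mm b - 1) := by
      have : (((c b).length * mm i0 : ℕ) : ℤ) ≤ ((∑ u ∈ (c b).toFinset, dg G u (Rst c) : ℕ) : ℤ) := by
        push_cast
        simp only [nsmul_eq_mul] at hsum
        linarith
      exact le_trans (by exact_mod_cast this) h5
    by_contra hcon
    have hmb := hm b
    have hmi := hm i0
    have h7 : (Rst c).card ≤ 2 * mm i0 := by omega
    have h8 : (Rst c).card * (mm b - 1) ≤ 2 * mm i0 * (mm b - 1) := Nat.mul_le_mul_right _ h7
    have h9 : (2 * mm b) * mm i0 ≤ (c b).length * mm i0 := Nat.mul_le_mul_right _ (by omega)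
    obtain ⟨t, ht⟩ : ∃ t, mm b = t + 1 := ⟨mm b - 1, by omega⟩
    rw [ht] at h8 h9 h6
    rw [Nat.add_sub_cancel] at h8 h6
    nlinarith

/-- swap fact -/
theorem Opt.swapfact (h : Opt G mm c I bl P) (hcol : ∀ u v, G.Adj u v → col u ≠ col v)
    (hm : ∀ i, 3 ≤ mm i) {a b : V} (hP : Pth G a b P) {z : V} (hz : z ∈ Rst c) (hzP : z ∉ P)
    (hza : col z ≠ col a) {j : Fin k} (hj : j ∈ I) :
    dg G a (c j).toFinset + dg G z (c j).toFinset + 2 ≤ 2 * mm j := by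
  classical
  by_contra hcon
  have hjI := h.st.hI j hj
  have e1 := dg_le_col hjI.1 hcol hjI.2 a
  have e2 := dg_le_col hjI.1 hcol hjI.2 z
  have hmj := hm j
  rw [mem_Rst] at hz
  have hT : ((c j).toFinset.filter (fun x => G.Adj a x)).card = dg G a (c j).toFinset := by
    unfold dg
    congr 1
  obtain ⟨y, hy, l', k1, k2, k3⟩ := replace_exists hjI.1 hcol hjI.2 (hz j)
    ((c j).toFinset.filter (fun x => G.Adj a x))
    (by
      intro y hy
      rw [Finset.mem_filter, List.mem_toFinset] at hy
      refine ⟨hy.1, ?_⟩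
      have := hcol _ _ hy.2
      revert this hza
      cases col a <;> cases col y <;> cases col z <;> simp)
    (by rw [hT]; omega)
  rw [Finset.mem_filter, List.mem_toFinset] at hy
  have st1 := h.st.swap hj k1 (by rw [k2, hjI.2]) (by
    intro i hij x hx hx'
    rcases k3 x hx with rfl | hx2
    · exact hz i hx'
    · exact h.st.dis i j hij x hx' hx2.1)
  have hyP : y ∉ P := fun hh => h.out y hh j hy.1
  have hp2 := hP.cons hy.2.symm hyP
  have := h.o3 _ (y :: P) st1 (by
    intro i hi
    rw [Function.update_of_ne (by rintro rfl; exact h.st.dsj i hi hj)]) hp2.chain hp2.nodup (by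
    intro x hx i
    by_cases hij : i = j
    · subst hij
      rw [Function.update_self]
      intro hx'
      rcases List.mem_cons.1 hx with rfl | hx
      · rcases k3 x hx' with rfl | hh
        · exact hz i hy.1
        · exact hh.2 rfl
      · rcases k3 x hx' with rfl | hh
        · exact hzP hx
        · exact h.out x hx i hh.1
    · rw [Function.update_of_ne hij]
      rcases List.mem_cons.1 hx with rfl | hx
      · exact fun hh => h.st.dis i j hij x hh hy.1
      · exact h.out x hx i)
  simp at this

/-- degrees near the start of a path without long cycles -/
theorem fwd_deg {a b : V} {l : List V} (hl : Pth G a b l) (hcol : ∀ u v, G.Adj u v → col u ≠ col v)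
    {m : ℕ} (hm : 2 ≤ m) (hno : ∀ l', CycL G l' → (∀ x ∈ l', x ∈ l) → l'.length < 2 * m) {i : ℕ}
    (hi : i < l.length) (hi2 : i ≤ 2) :
    dg G l[i] l.toFinset ≤ m - 1 + (if i = 0 then 0 else 1) := by
  rw [← card_nbpos hl.nodup]
  have h1 : ((nbpos G l[i] l).filter (fun t => i < t)).card ≤ m - 1 := by
    by_contra hcon
    obtain ⟨l', k1, k2, k3⟩ := forward hl hcol hi hm (by omega)
    have := hno l' k1 k3
    omega
  have h2 := Finset.card_filter_add_card_filter_not (s := nbpos G l[i] l) (fun t => i < t)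
  have hsub : (nbpos G l[i] l).filter (fun t => ¬ i < t) ⊆ if i = 0 then ∅ else {i - 1} := by
    intro t ht
    rw [Finset.mem_filter] at ht
    obtain ⟨htl, hta⟩ := mem_nbpos.1 ht.1
    have := hcol _ _ hta
    rw [Ne, hl.col_iff hcol hi htl] at this
    split_ifs
    · omega
    · rw [Finset.mem_singleton]; omega
  have h3 := Finset.card_le_card hsub
  split_ifs at h3 ⊢
  · rw [Finset.card_empty] at h3; omega
  · rw [Finset.card_singleton] at h3; omega

end
end SubdivEven


namespace SubdivEven
open Finset
set_option linter.unusedSectionVars false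

section
variable {V : Type*} [Fintype V] [DecidableEq V] {G : SimpleGraph V} {k : ℕ} {mm : Fin k → ℕ}
variable {c : Fin k → List V} {I : Finset (Fin k)} {bl p s : List (Fin k)} {P : List V}
  {col : V → Bool}

theorem path_sum {a b : V} (hP : Pth G a b P) (hcol : ∀ u v, G.Adj u v → col u ≠ col v) :
    ∑ x ∈ P.toFinset, sg col x = if P.length % 2 = 0 then 0 else sg col a := by
  rw [← list_sum_sg hP.nodup]
  split_ifs with h
  · exact chain_sum_even hcol (P.length / 2) P hP.chain (by omega)
  · have hh := hP.hd
    match P, hP, hh, h with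
    | x :: t, hP, hh, h =>
      obtain rfl : x = a := by simpa using hh
      have := chain_sum_even hcol (t.length / 2) t hP.chain.tail (by simp at h; omega)
      simp [this]

theorem Opt.spanning (h : Opt G mm c I bl P) (hcol : ∀ u v, G.Adj u v → col u ≠ col v)
    (hm : ∀ i, 3 ≤ mm i) (hD : ∀ v, ∑ i, (mm i - 1) + 1 ≤ dg G v Finset.univ)
    (hbal : ∑ v, sg col v = 0) {i0 : Fin k} (hi0 : i0 ∉ I) (hi0' : i0 ∉ bl)
    {a b : V} (hP : Pth G a b P) : P.toFinset = Rst c := by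
  have hPR : P.toFinset ⊆ Rst c := by
    intro x hx; rw [mem_Rst]; exact h.out x (by simpa using hx)
  have hno : ∀ l, CycL G l → (∀ z ∈ l, z ∈ Rst c) → l.length < 2 * mm i0 :=
    fun l hl hlR => h.U3 hi0 hi0' hl hlR
  have hmax : ∀ x y p, Pth G x y p → (∀ z ∈ p, z ∈ Rst c) → p.length ≤ P.length :=
    fun x y p hp hpR => h.o3 c p h.st (fun _ _ => rfl) hp.chain hp.nodup
      (fun x hx => mem_Rst.1 (hpR x hx))
  have hm0 := hm i0
  have haR : dg G a (Rst c) ≤ mm i0 - 1 := by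
    have h1 : dg G a (Rst c) ≤ dg G a P.toFinset := by
      apply dg_mono
      intro x hx hax
      by_contra hxP
      rw [List.mem_toFinset] at hxP
      have := hmax _ _ _ (hP.cons hax.symm hxP) (by
        intro z hz
        rcases List.mem_cons.1 hz with rfl | hz
        · exact hx
        · exact hPR (by simpa using hz))
      simp at this
    have h2 := fwd_deg hP hcol (m := mm i0) (by omega) (fun l' hl' hl'' => hno l' hl'
      (fun z hz => hPR (by simpa using hl'' z hz))) (i := 0) hP.length_pos (by omega)
    rw [hP.getElem_zero] at h2
    simp at h2; omega
  by_contra hne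
  set Z := Rst c \ P.toFinset with hZ
  have hZne : Z.Nonempty := by
    rw [Finset.sdiff_nonempty]
    exact fun hh => hne (Finset.Subset.antisymm hPR hh)
  set A := Z.filter (fun x => col x ≠ col a) with hA
  set B := Z.filter (fun x => col x = col a) with hB
  have hZm : ∀ x ∈ Z, x ∈ Rst c ∧ x ∉ P := by
    intro x hx; rw [hZ, Finset.mem_sdiff, List.mem_toFinset] at hx; exact hx
  have hdegA : ∀ z ∈ A, mm i0 + 1 ≤ dg G z P.toFinset + dg G z B := by
    intro z hz
    rw [hA, Finset.mem_filter] at hz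
    obtain ⟨hzR, hzP⟩ := hZm z hz.1
    have d1 := h.degR hcol hm hD hi0 hi0' (hPR (by simpa using hP.mem_left) : a ∈ Rst c)
    have d2 := h.degR hcol hm hD hi0 hi0' hzR
    have d3 : exc G mm c I a + exc G mm c I z ≤ 0 := by
      unfold exc
      rw [← Finset.sum_add_distrib]
      apply Finset.sum_nonpos
      intro j hj
      have := h.swapfact hcol hm hP hzR hzP hz.2 hj
      omega
    have d4 := dg_sdiff_add G z hPR
    have d5 : dg G z (Rst c \ P.toFinset) ≤ dg G z B := by
      apply dg_mono
      intro x hx hzx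
      rw [hB, Finset.mem_filter]
      refine ⟨hx, ?_⟩
      have e1 := hcol _ _ hzx
      have e2 := hz.2
      revert e1 e2
      cases col z <;> cases col x <;> cases col a <;> simp
    omega
  have hsum : ∑ x ∈ Z, sg col x = - (if P.length % 2 = 0 then 0 else sg col a) := by
    rw [← path_sum hP hcol]
    have e1 := Finset.sum_sdiff (f := sg col) hPR
    rw [h.st.balR hcol hbal] at e1
    rw [hZ]; linarith
  have hcard : ((B.card : ℤ) - A.card = if P.length % 2 = 0 then 0 else -1) ∧
      A.card + B.card = Z.card := by
    have hcs := card_split (col := col) Z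
    rw [sum_sg] at hsum
    have hs : sg col a = if col a = true then 1 else -1 := rfl
    rw [hs] at hsum
    cases hca : col a with
    | true =>
      have eA : A = Z.filter (fun x => col x = false) := by
        rw [hA]; apply Finset.filter_congr; intro x _; rw [hca]; simp
      have eB : B = Z.filter (fun x => col x = true) := by
        rw [hB]; apply Finset.filter_congr; intro x _; rw [hca]
      rw [eA, eB]
      rw [hca] at hsum
      simp only [if_true] at hsum
      split_ifs at hsum ⊢ <;> omega
    | false =>
      have eA : A = Z.filter (fun x => col x = true) := by
        rw [hA]; apply Finset.filter_congr; intro x _; rw [hca]; simp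
      have eB : B = Z.filter (fun x => col x = false) := by
        rw [hB]; apply Finset.filter_congr; intro x _; rw [hca]
      rw [eA, eB]
      rw [hca] at hsum
      simp only [Bool.false_eq_true, if_false] at hsum
      split_ifs at hsum ⊢ <;> omega
  have hAprop : ∀ x ∈ A, x ∈ Rst c ∧ x ∉ P ∧ col x = !(col a) := by
    intro x hx
    rw [hA, Finset.mem_filter] at hx
    obtain ⟨e1, e2⟩ := hZm x hx.1
    refine ⟨e1, e2, ?_⟩
    have e3 := hx.2
    revert e3
    cases col x <;> cases col a <;> simp
  have hBprop : ∀ x ∈ B, x ∈ Rst c ∧ x ∉ P ∧ col x ≠ !(col a) := by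
    intro x hx
    rw [hB, Finset.mem_filter] at hx
    obtain ⟨e1, e2⟩ := hZm x hx.1
    refine ⟨e1, e2, ?_⟩
    have e3 := hx.2
    revert e3
    cases col x <;> cases col a <;> simp
  have hPR' : ∀ x ∈ P, x ∈ Rst c := fun x hx => hPR (by simpa using hx)
  have hZc := Finset.card_pos.2 hZne
  by_cases hpar : P.length % 2 = 0
  · rw [if_pos hpar] at hcard
    obtain ⟨y, hy⟩ : B.Nonempty := by rw [← Finset.card_pos]; omega
    refine lemmaK hcol (Rst c) hP hPR' hmax A (B.erase y) hAprop
      (fun x hx => hBprop x (Finset.mem_of_mem_erase hx)) ?_ (m := mm i0) (by omega) ?_ hno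
    · rw [Finset.card_erase_of_mem hy]; omega
    · intro z hz
      have e1 := hdegA z hz
      have e2 := dg_sdiff_add G z (Finset.erase_subset y B)
      have e3 := dg_le_card G z (B \ B.erase y)
      have e4 := Finset.card_sdiff_add_card_eq_card (Finset.erase_subset y B)
      rw [Finset.card_erase_of_mem hy] at e4
      omega
  · rw [if_neg hpar] at hcard
    refine lemmaK hcol (Rst c) hP hPR' hmax A B hAprop hBprop (by omega) (m := mm i0) (by omega) ?_ hno
    intro z hz
    have e1 := hdegA z hz
    omega

theorem caseI (hcol : ∀ u v, G.Adj u v → col u ≠ col v)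
    (hm : ∀ i, 3 ≤ mm i) (hD : ∀ v, ∑ i, (mm i - 1) + 1 ≤ dg G v Finset.univ)
    (hbal : ∑ v, sg col v = 0) (hN : 2 * ∑ i, mm i + 2 ≤ Fintype.card V) :
    ∃ c : Fin k → List V, (∀ i, CycL G (c i) ∧ 2 * mm i ≤ (c i).length) ∧
      ∀ i j, i ≠ j → ∀ x ∈ c i, x ∉ c j := by
  obtain ⟨c, I, bl, P, h⟩ := exists_opt G mm
  by_cases hall : ∀ i, i ∈ I ∨ i ∈ bl
  · refine ⟨c, ?_, h.st.dis⟩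
    intro i
    rcases hall i with hi | hi
    · exact ⟨(h.st.hI i hi).1, (h.st.hI i hi).2.ge⟩
    · exact h.st.hb i hi
  exfalso
  push Not at hall
  obtain ⟨i0, hi0, hi0'⟩ := hall
  have hm0 := hm i0
  obtain ⟨hbig, heven⟩ := h.bigR hcol hm hD hbal hN hi0 hi0'
  obtain ⟨x0, hx0⟩ : (Rst c).Nonempty := by rw [← Finset.card_pos]; omega
  have hPpos : 1 ≤ P.length := by
    have := h.o3 c [x0] h.st (fun _ _ => rfl) (List.isChain_singleton _) (List.nodup_singleton _) (by
      intro x hx; simp at hx; subst hx; exact mem_Rst.1 hx0)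
    simpa using this
  obtain ⟨a, b, hP⟩ : ∃ a b, Pth G a b P := by
    have hne : P ≠ [] := by rintro rfl; simp at hPpos
    exact ⟨P.head hne, P.getLast hne, h.chain, h.nodup, List.head?_eq_some_head hne,
      List.getLast?_eq_some_getLast hne⟩
  have hspan := h.spanning hcol hm hD hbal hi0 hi0' hP
  have hlen : P.length = (Rst c).card := by
    rw [← hspan, List.toFinset_card_of_nodup hP.nodup]
  obtain ⟨p, hp⟩ : ∃ p, P.length = 2 * p := ⟨P.length / 2, by omega⟩
  have hno : ∀ l', CycL G l' → (∀ x ∈ l', x ∈ P) → l'.length < 2 * mm i0 := by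
    intro l' hl' hx
    exact h.U3 hi0 hi0' hl' (fun x hx' => by rw [← hspan]; simpa using hx x hx')
  have hR : ∀ t (ht : t < P.length), (mm i0 : ℤ) ≤ exc G mm c I P[t] + dg G P[t] P.toFinset := by
    intro t ht
    have := h.degR hcol hm hD hi0 hi0' (v := P[t]) (by rw [← hspan]; simp)
    rw [hspan]; exact this
  have f0 := fwd_deg hP hcol (m := mm i0) (by omega) hno (i := 0) (by omega) (by omega)
  have f1 := fwd_deg hP hcol (m := mm i0) (by omega) hno (i := 1) (by omega) (by omega)
  have f2 := fwd_deg hP hcol (m := mm i0) (by omega) hno (i := 2) (by omega) (by omega)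
  have hno' : ∀ l', CycL G l' → (∀ x ∈ l', x ∈ P.reverse) → l'.length < 2 * mm i0 := by
    intro l' hl' hx
    exact hno l' hl' (fun x hx' => by simpa using hx x hx')
  have g : ∀ t (ht : t ≤ 2), dg G (P[2 * p - 1 - t]'(by omega)) P.toFinset ≤
      mm i0 - 1 + (if t = 0 then 0 else 1) := by
    intro t ht
    have := fwd_deg hP.reverse hcol (m := mm i0) (by omega) hno' (i := t)
      (by rw [List.length_reverse]; omega) ht
    rw [List.getElem_reverse, List.toFinset_reverse] at this
    simpa only [hp] using this
  have g0 := g 0 (by omega)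
  have g1 := g 1 (by omega)
  have g2 := g 2 (by omega)
  simp only [if_true, one_ne_zero, if_false, OfNat.ofNat_ne_zero] at f0 f1 f2 g0 g1 g2
  have i1 : 2 * p - 1 - 0 = 2 * p - 1 := by omega
  have i2 : 2 * p - 1 - 1 = 2 * p - 2 := by omega
  have i3 : 2 * p - 1 - 2 = 2 * p - 3 := by omega
  simp only [i1, i2, i3] at g0 g1 g2
  have r0 := hR 0 (by omega)
  have r1 := hR 1 (by omega)
  have r2 := hR 2 (by omega)
  have r3 := hR (2 * p - 1) (by omega)
  have r4 := hR (2 * p - 2) (by omega)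
  have r5 := hR (2 * p - 3) (by omega)
  by_cases hkey : ∃ j ∈ I, 6 * mm j < dg G P[0] (c j).toFinset + dg G P[1] (c j).toFinset +
      dg G P[2] (c j).toFinset + dg G P[2 * p - 1] (c j).toFinset +
      dg G P[2 * p - 2] (c j).toFinset + dg G P[2 * p - 3] (c j).toFinset + 6
  · obtain ⟨j, hj, hsum⟩ := hkey
    have hjI := h.st.hI j hj
    obtain ⟨l1, l2, k1, k2, k3, k4, k5, k6, k7⟩ := key hcol hP (p := p) (q := mm j) (by omega)
      hp hjI.1 (hm j) hjI.2 (fun x hx => h.out x hx j) hsum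
    have hoth : ∀ i, i ≠ j → ∀ x, (x ∈ P ∨ x ∈ c j) → x ∉ c i := by
      intro i hij x hx
      rcases hx with hx | hx
      · exact h.out x hx i
      · exact fun hh => h.st.dis i j hij x hh hx
    have st1 := h.st.swap hj k1 k3 (fun i hij x hx => hoth i hij x (k6 x hx))
    refine h.improve (s := []) (by simp) st1 ?_ hi0 hi0' k2 (by omega) ?_ (by simp)
    · intro i hi
      rw [Function.update_of_ne (by rintro rfl; exact h.st.dsj i hi hj)]
    · intro i x hx hx'
      by_cases hij : i = j
      · subst hij
        rw [Function.update_self] at hx'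
        exact k5 x hx' hx
      · rw [Function.update_of_ne hij] at hx'
        exact hoth i hij x (k7 x hx) hx'
  · push Not at hkey
    have hexc : exc G mm c I P[0] + exc G mm c I P[1] + exc G mm c I P[2] + exc G mm c I P[2 * p - 1] +
        exc G mm c I P[2 * p - 2] + exc G mm c I P[2 * p - 3] ≤ 0 := by
      unfold exc
      simp only [← Finset.sum_add_distrib]
      apply Finset.sum_nonpos
      intro j hj
      have := hkey j hj
      have := hm j
      omega
    omega

end
end SubdivEven


namespace SubdivEven
open Finset
set_option linter.unusedSectionVars false

/-- Weighted number of `a`-neighbours of `v` in part `l`. -/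
def ff {V : Type*} [Fintype V] {k : ℕ} (a : V → V → ℤ) (σ : V → Fin k) (v : V) (l : Fin k) : ℤ :=
  ∑ u, if σ u = l then a v u else 0

/-- Total weight of the edges inside the parts, seen from side `β`. -/
def Phi {V : Type*} [Fintype V] {k : ℕ} (a : V → V → ℤ) (col : V → Bool) (w : Fin k → ℤ) (β : Bool)
    (σ : V → Fin k) : ℤ := ∑ v, if col v = β then w (σ v) * ff a σ v (σ v) else 0

/-- Secondary potential. -/
def Psi {V : Type*} [Fintype V] {k : ℕ} (a : V → V → ℤ) (col : V → Bool)
    (σ : V → Fin k) : ℤ := ∑ v, if col v = false then (ff a σ v (σ v)) ^ 2 else 0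

/-- Balanced partitions. -/
def Val {V : Type*} [Fintype V] {k : ℕ} (col : V → Bool) (mm : Fin k → ℕ) (σ : V → Fin k) : Prop :=
  ∀ i β, (Finset.univ.filter (fun v => σ v = i ∧ col v = β)).card = mm i

/-- The F-degree into part `i` of the vertices of part `j` on side `β`. -/
def FF {V : Type*} [Fintype V] {k : ℕ} (a : V → V → ℤ) (col : V → Bool) (σ : V → Fin k) (β : Bool)
    (i j : Fin k) : ℤ := ∑ v ∈ Finset.univ.filter (fun v => σ v = j ∧ col v = β), ff a σ v i

section
variable {V : Type*} [Fintype V] [DecidableEq V] {k : ℕ} {mm : Fin k → ℕ} {a : V → V → ℤ}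
  {col : V → Bool} {σ : V → Fin k} {w : Fin k → ℤ}

theorem ff_nonneg (ha0 : ∀ u v, 0 ≤ a u v) (v : V) (l : Fin k) : 0 ≤ ff a σ v l := by
  unfold ff
  apply Finset.sum_nonneg
  intro u _
  split_ifs
  · exact ha0 _ _
  · exact le_refl _

theorem sum_ff (v : V) : ∑ l, ff a σ v l = ∑ u, a v u := by
  unfold ff
  rw [Finset.sum_comm]
  apply Finset.sum_congr rfl
  intro u _
  simp

theorem Phi_symm (hsym : ∀ u v, a u v = a v u) (hc : ∀ u v, col u = col v → a u v = 0) (β : Bool) :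
    Phi a col w β σ = Phi a col w (!β) σ := by
  have e : ∀ β, Phi a col w β σ =
      ∑ v, ∑ u, if col v = β ∧ col u = !β ∧ σ u = σ v then w (σ v) * a v u else 0 := by
    intro β
    unfold Phi ff
    apply Finset.sum_congr rfl
    intro v _
    by_cases hv : col v = β
    · rw [if_pos hv, Finset.mul_sum]
      apply Finset.sum_congr rfl
      intro u _
      by_cases hu : σ u = σ v
      · by_cases hcu : col u = !β
        · simp [hv, hu, hcu]
        · have : a v u = 0 := hc _ _ (by
            rw [hv]; revert hcu; cases col u <;> cases β <;> simp)
          simp [this]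
      · simp [hu]
    · simp [hv]
  rw [e, e, Finset.sum_comm]
  apply Finset.sum_congr rfl
  intro u _
  apply Finset.sum_congr rfl
  intro v _
  rw [hsym v u]
  simp only [Bool.not_not]
  by_cases h1 : σ u = σ v
  · rw [h1]
    by_cases h2 : col u = !β <;> by_cases h3 : col v = β <;> simp [h2, h3]
  · have h2 : ¬ σ v = σ u := fun h => h1 h.symm
    simp [h1, h2]

theorem ff_swap_same (hc : ∀ u v, col u = col v → a u v = 0) {x x' : V} (hx : col x = col x') {v : V}
    (hv : col v = col x) (l : Fin k) : ff a (σ ∘ Equiv.swap x x') v l = ff a σ v l := by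
  unfold ff
  apply Finset.sum_congr rfl
  intro u _
  by_cases h1 : u = x
  · subst h1; rw [hc v u hv]; simp
  by_cases h2 : u = x'
  · subst h2; rw [hc v u (hv.trans hx)]; simp
  simp [Equiv.swap_apply_of_ne_of_ne h1 h2]

theorem Phi_swap (hc : ∀ u v, col u = col v → a u v = 0) {x x' : V} (hne : x ≠ x')
    (hx : col x = col x') :
    Phi a col w (col x) (σ ∘ Equiv.swap x x') - Phi a col w (col x) σ =
      (w (σ x') * ff a σ x (σ x') + w (σ x) * ff a σ x' (σ x)) -
      (w (σ x) * ff a σ x (σ x) + w (σ x') * ff a σ x' (σ x')) := by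
  unfold Phi
  rw [← Finset.sum_sub_distrib, Fintype.sum_eq_add x x' hne]
  · simp only [hx, if_true, Function.comp, Equiv.swap_apply_left, Equiv.swap_apply_right]
    have e1 := ff_swap_same (a := a) (σ := σ) hc hx (v := x) rfl (σ x')
    have e2 := ff_swap_same (a := a) (σ := σ) hc hx (v := x') hx.symm (σ x)
    rw [e1, e2]
    ring
  · rintro v ⟨h1, h2⟩
    by_cases hv : col v = col x
    · rw [if_pos hv, if_pos hv, ff_swap_same hc hx hv]
      simp [Equiv.swap_apply_of_ne_of_ne h1 h2]
    · rw [if_neg hv, if_neg hv, sub_zero]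

theorem Val_swap (h : Val col mm σ) {x x' : V} (hx : col x = col x') :
    Val col mm (σ ∘ Equiv.swap x x') := by
  intro i β
  rw [← h i β]
  apply Finset.card_bij (fun v _ => Equiv.swap x x' v)
  · intro v hv
    simp only [Finset.mem_filter, Finset.mem_univ, true_and, Function.comp] at hv ⊢
    refine ⟨hv.1, ?_⟩
    rw [← hv.2]
    by_cases h1 : v = x
    · subst h1; simp [hx]
    by_cases h2 : v = x'
    · subst h2; simp [hx]
    rw [Equiv.swap_apply_of_ne_of_ne h1 h2]
  · intro v _ u _ huv
    exact (Equiv.swap x x').injective huv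
  · intro v hv
    simp only [Finset.mem_filter, Finset.mem_univ, true_and, Function.comp] at hv
    refine ⟨Equiv.swap x x' v, ?_, by simp⟩
    simp only [Finset.mem_filter, Finset.mem_univ, true_and, Function.comp, Equiv.swap_apply_self]
    refine ⟨hv.1, ?_⟩
    rw [← hv.2]
    by_cases h1 : v = x
    · subst h1; simp [hx]
    by_cases h2 : v = x'
    · subst h2; simp [hx]
    rw [Equiv.swap_apply_of_ne_of_ne h1 h2]

theorem exists_Val (hX : ∀ β, (Finset.univ.filter (fun v : V => col v = β)).card = ∑ i, mm i) :
    ∃ σ : V → Fin k, Val col mm σ := by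
  have e : ∀ β, Nonempty ({v : V // col v = β} ≃ Σ i : Fin k, Fin (mm i)) := by
    intro β
    apply Fintype.card_eq.1
    rw [Fintype.card_subtype, hX β]
    simp
  let E : ∀ β, {v : V // col v = β} ≃ Σ i : Fin k, Fin (mm i) := fun β => (e β).some
  refine ⟨fun v => (E (col v) ⟨v, rfl⟩).1, ?_⟩
  intro i β
  have : mm i = (Finset.univ : Finset (Fin (mm i))).card := by simp
  rw [this]
  symm
  apply Finset.card_bij (fun t _ => ((E β).symm ⟨i, t⟩).1)
  · intro t _
    have hcol := ((E β).symm ⟨i, t⟩).2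
    simp only [Finset.mem_filter, Finset.mem_univ, true_and]
    refine ⟨?_, hcol⟩
    generalize hs : (E β).symm ⟨i, t⟩ = s at hcol ⊢
    obtain ⟨s, hs'⟩ := s
    subst hs'
    have h2 := (Equiv.symm_apply_eq _).1 hs
    exact (congrArg Sigma.fst h2).symm
  · intro t _ t' _ h
    have := (E β).symm.injective (Subtype.ext h)
    simpa using this
  · intro v hv
    simp only [Finset.mem_filter, Finset.mem_univ, true_and] at hv
    obtain ⟨h1, h2⟩ := hv
    subst h2
    subst h1
    refine ⟨(E (col v) ⟨v, rfl⟩).2, Finset.mem_univ _, ?_⟩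
    simp

/-- An optimal partition. -/
structure OptP (a : V → V → ℤ) (col : V → Bool) (mm : Fin k → ℕ) (w : Fin k → ℤ) (σ : V → Fin k) :
    Prop where
  val : Val col mm σ
  o1 : ∀ σ', Val col mm σ' → Phi a col w true σ ≤ Phi a col w true σ'
  o2 : ∀ σ', Val col mm σ' → Phi a col w true σ = Phi a col w true σ' → Psi a col σ ≤ Psi a col σ'

theorem exists_OptP (a : V → V → ℤ) (w : Fin k → ℤ)
    (hX : ∀ β, (Finset.univ.filter (fun v : V => col v = β)).card = ∑ i, mm i) :
    ∃ σ, OptP a col mm w σ := by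
  classical
  obtain ⟨σ0, h0⟩ := exists_Val (k := k) hX
  obtain ⟨σ, hσ, hmin⟩ := Finset.exists_min_image (Finset.univ.filter (fun σ => Val col mm σ))
    (fun σ => toLex (Phi a col w true σ, Psi a col σ)) ⟨σ0, by simpa using h0⟩
  rw [Finset.mem_filter] at hσ
  have hm : ∀ σ', Val col mm σ' → Phi a col w true σ < Phi a col w true σ' ∨
      Phi a col w true σ = Phi a col w true σ' ∧ Psi a col σ ≤ Psi a col σ' := by
    intro σ' h'
    have := hmin σ' (by simpa using h')
    rw [Prod.Lex.le_iff] at this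
    simpa using this
  refine ⟨σ, hσ.2, ?_, ?_⟩
  · intro σ' h'
    rcases hm σ' h' with h | h
    · exact h.le
    · exact h.1.le
  · intro σ' h' he
    rcases hm σ' h' with h | h
    · omega
    · exact h.2

theorem OptP.swap (h : OptP a col mm w σ) (hsym : ∀ u v, a u v = a v u)
    (hc : ∀ u v, col u = col v → a u v = 0) {x x' : V} (hx : col x = col x') (hne : σ x ≠ σ x') :
    w (σ x) * ff a σ x (σ x) + w (σ x') * ff a σ x' (σ x') ≤
      w (σ x') * ff a σ x (σ x') + w (σ x) * ff a σ x' (σ x) := by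
  have hne' : x ≠ x' := by rintro rfl; exact hne rfl
  have h1 := h.o1 _ (Val_swap h.val hx)
  have h2 := Phi_swap (a := a) (σ := σ) (w := w) hc hne' hx
  have h3 : ∀ σ : V → Fin k, Phi a col w (col x) σ = Phi a col w true σ := by
    intro σ
    cases hcx : col x with
    | true => rfl
    | false => rw [Phi_symm hsym hc]; rfl
  rw [h3, h3] at h2
  linarith

theorem contra (hval : Val col mm σ) (hsym : ∀ u v, a u v = a v u) (ha0 : ∀ u v, 0 ≤ a u v)
    (hc : ∀ u v, col u = col v → a u v = 0) (hk : ∀ v, ∑ u, a v u ≤ (k : ℤ) - 1) (x : V)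
    (p q : ℤ) (hp : 0 ≤ p) (hφ : 1 ≤ ff a σ x (σ x)) (hpq : p + mm (σ x) ≤ q)
    (hj : ∀ j, j ≠ σ x → q ≤ p * ff a σ x j + FF a col σ (col x) (σ x) j) : False := by
  set i := σ x with hi
  have s1 : ∑ j ∈ Finset.univ.erase i, ff a σ x j + ff a σ x i ≤ (k : ℤ) - 1 := by
    rw [Finset.sum_erase_add _ _ (Finset.mem_univ i), sum_ff]
    exact hk x
  have s2 : ∑ j ∈ Finset.univ.erase i, FF a col σ (col x) i j + FF a col σ (col x) i i ≤
      mm i * ((k : ℤ) - 1) := by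
    rw [Finset.sum_erase_add _ _ (Finset.mem_univ i)]
    have e1 : ∑ j, FF a col σ (col x) i j =
        ∑ v ∈ Finset.univ.filter (fun v => col v = col x), ff a σ v i := by
      unfold FF
      rw [← Finset.sum_fiberwise (s := Finset.univ.filter (fun v => col v = col x)) (g := σ)]
      apply Finset.sum_congr rfl
      intro j _
      rw [Finset.filter_filter]
      apply Finset.sum_congr
      · ext v; simp [and_comm]
      · intros; rfl
    rw [e1]
    have e2 : ∑ v ∈ Finset.univ.filter (fun v => col v = col x), ff a σ v i ≤
        ∑ u ∈ Finset.univ.filter (fun u => σ u = i ∧ col u = !(col x)), ∑ v, a u v := by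
      unfold ff
      rw [Finset.sum_comm, Finset.sum_filter]
      apply Finset.sum_le_sum
      intro u _
      by_cases hu : σ u = i
      · by_cases hcu : col u = !(col x)
        · rw [if_pos ⟨hu, hcu⟩]
          rw [Finset.sum_filter]
          apply Finset.sum_le_sum
          intro v _
          simp only [hu, if_true]
          split_ifs
          · rw [hsym]
          · exact ha0 _ _
        · rw [if_neg (fun h => hcu h.2)]
          apply le_of_eq
          apply Finset.sum_eq_zero
          intro v hv
          rw [Finset.mem_filter] at hv
          have : a v u = 0 := hc _ _ (by
            rw [hv.2]; revert hcu; cases col u <;> cases col x <;> simp)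
          simp [this]
      · simp [hu]
    refine e2.trans ?_
    have e3 := Finset.sum_le_card_nsmul
      (Finset.univ.filter (fun u => σ u = i ∧ col u = !(col x))) (fun u => ∑ v, a u v) _
      (fun u _ => hk u)
    rw [hval i (!(col x))] at e3
    simpa using e3
  have s3 : ff a σ x i ≤ FF a col σ (col x) i i := by
    unfold FF
    apply Finset.single_le_sum (f := fun v => ff a σ v i) (fun v _ => ff_nonneg ha0 v i)
    simp [hi]
  have s4 := Finset.sum_le_sum (s := Finset.univ.erase i)
    (fun j hjm => hj j (Finset.ne_of_mem_erase hjm))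
  rw [Finset.sum_add_distrib, ← Finset.mul_sum, Finset.sum_const,
    Finset.card_erase_of_mem (Finset.mem_univ i), Finset.card_univ, Fintype.card_fin] at s4
  have hk1 : 1 ≤ k := i.pos
  rw [nsmul_eq_mul, Nat.cast_sub hk1] at s4
  push_cast at s4
  have hk1' : (0 : ℤ) ≤ (k : ℤ) - 1 := by omega
  have t1 : p * ∑ j ∈ Finset.univ.erase i, ff a σ x j ≤ p * ((k : ℤ) - 1 - ff a σ x i) :=
    mul_le_mul_of_nonneg_left (by linarith) hp
  have t2 : ((k : ℤ) - 1) * (p + mm i) ≤ ((k : ℤ) - 1) * q := mul_le_mul_of_nonneg_left hpq hk1'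
  have t3 : 0 ≤ p * ff a σ x i := mul_nonneg hp (by linarith)
  nlinarith

theorem FF_ge (hval : Val col mm σ) (β : Bool) (i j : Fin k) (t : ℤ)
    (h : ∀ v, σ v = j → col v = β → t ≤ ff a σ v i) : mm j * t ≤ FF a col σ β i j := by
  have := Finset.card_nsmul_le_sum (Finset.univ.filter (fun v => σ v = j ∧ col v = β))
    (fun v => ff a σ v i) t (by
      intro v hv
      rw [Finset.mem_filter] at hv
      exact h v hv.2.1 hv.2.2)
  rw [hval j β, nsmul_eq_mul] at this
  exact this

/-- The weights. -/
def ww (mm : Fin k → ℕ) (i : Fin k) : ℤ := if mm i = 3 then 2 else 3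

theorem OptP.bound (h : OptP a col mm (ww mm) σ) (hsym : ∀ u v, a u v = a v u)
    (ha0 : ∀ u v, 0 ≤ a u v)
    (hc : ∀ u v, col u = col v → a u v = 0) (hk : ∀ v, ∑ u, a v u ≤ (k : ℤ) - 1)
    (hm : ∀ i, 3 ≤ mm i) (x : V) : 3 * ff a σ x (σ x) < mm (σ x) + 3 := by
  by_contra hcon
  push Not at hcon
  have hmi := hm (σ x)
  set φ := ff a σ x (σ x) with hφ
  have hsw : ∀ x', col x' = col x → σ x' ≠ σ x → ww mm (σ x) * φ ≤
      ww mm (σ x') * ff a σ x (σ x') + ww mm (σ x) * ff a σ x' (σ x) := by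
    intro x' h1 h2
    have e1 := h.swap hsym hc h1.symm (Ne.symm h2)
    have e2 := ff_nonneg (σ := σ) ha0 x' (σ x')
    have e3 : 0 ≤ ww mm (σ x') * ff a σ x' (σ x') :=
      mul_nonneg (by unfold ww; split_ifs <;> norm_num) e2
    linarith
  by_cases h3 : mm (σ x) = 3
  · refine contra h.val hsym ha0 hc hk x 3 6 (by norm_num) (by omega) (by omega) ?_
    intro j hj
    have f0 := ff_nonneg (σ := σ) ha0 x j
    have hmj := hm j
    have hF0 := FF_ge h.val (col x) (σ x) j 0 (fun v _ _ => ff_nonneg ha0 v (σ x))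
    by_cases c2 : 2 ≤ ff a σ x j
    · linarith
    by_cases c1 : ff a σ x j = 0
    · have := FF_ge (a := a) h.val (col x) (σ x) j 2 (by
        intro v hv hcv
        have := hsw v hcv (by rw [hv]; exact hj)
        rw [hv, c1] at this
        unfold ww at this
        rw [if_pos h3] at this
        omega)
      have : (3 : ℤ) ≤ mm j := by exact_mod_cast hmj
      linarith
    · have c3 : ff a σ x j = 1 := by omega
      have := FF_ge (a := a) h.val (col x) (σ x) j 1 (by
        intro v hv hcv
        have := hsw v hcv (by rw [hv]; exact hj)
        rw [hv, c3] at this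
        unfold ww at this
        rw [if_pos h3] at this
        split_ifs at this <;> omega)
      have : (3 : ℤ) ≤ mm j := by exact_mod_cast hmj
      linarith
  · refine contra h.val hsym ha0 hc hk x 3 (3 * φ) (by norm_num) (by omega) (by omega) ?_
    intro j hj
    have f0 := ff_nonneg (σ := σ) ha0 x j
    have hmj := hm j
    have hF0 := FF_ge h.val (col x) (σ x) j 0 (fun v _ _ => ff_nonneg ha0 v (σ x))
    by_cases c2 : φ ≤ ff a σ x j
    · linarith
    have h4 := FF_ge (a := a) h.val (col x) (σ x) j (φ - ff a σ x j) (by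
        intro v hv hcv
        have := hsw v hcv (by rw [hv]; exact hj)
        rw [hv] at this
        unfold ww at this
        rw [if_neg h3] at this
        split_ifs at this <;> omega)
    have h5 : (3 : ℤ) ≤ mm j := by exact_mod_cast hmj
    have h6 : 3 * (φ - ff a σ x j) ≤ mm j * (φ - ff a σ x j) :=
      mul_le_mul_of_nonneg_right h5 (by omega)
    linarith

end
end SubdivEven


namespace SubdivEven
open Finset
set_option linter.unusedSectionVars false

section
variable {V : Type*} [Fintype V] [DecidableEq V] {k : ℕ} {mm : Fin k → ℕ} {a : V → V → ℤ}
  {col : V → Bool} {σ : V → Fin k} {w : Fin k → ℤ}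

theorem ff_swap_gen {x x' : V} (hne : x ≠ x') (y : V) (l : Fin k) :
    ff a (σ ∘ Equiv.swap x x') y l - ff a σ y l =
      ((if σ x' = l then a y x else 0) - (if σ x = l then a y x else 0)) +
      ((if σ x = l then a y x' else 0) - (if σ x' = l then a y x' else 0)) := by
  unfold ff
  rw [← Finset.sum_sub_distrib, Fintype.sum_eq_add x x' hne]
  · simp
  · rintro v ⟨h1, h2⟩
    simp [Equiv.swap_apply_of_ne_of_ne h1 h2]

theorem FF_symm (hsym : ∀ u v, a u v = a v u) (hc : ∀ u v, col u = col v → a u v = 0)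
    (j : Fin k) : FF a col σ true j j = FF a col σ false j j := by
  have e : ∀ β, FF a col σ β j j = Phi a col (fun l => if l = j then 1 else 0) β σ := by
    intro β
    unfold FF Phi
    rw [Finset.sum_filter]
    apply Finset.sum_congr rfl
    intro v _
    by_cases h1 : σ v = j
    · by_cases h2 : col v = β <;> simp [h1, h2]
    · simp [h1]
  rw [e, e, Phi_symm hsym hc]
  rfl

theorem Psi_swap (hsym : ∀ u v, a u v = a v u) (ha : ∀ u v, a u v = 0 ∨ a u v = 1)
    (hc : ∀ u v, col u = col v → a u v = 0) {x x' : V} (hx : col x = true) (hx' : col x' = true)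
    (hij : σ x ≠ σ x') (h1 : ff a σ x' (σ x) = 0) (h2 : ff a σ x' (σ x') = 0)
    (hy : ∀ y, σ y = σ x → a x y ≠ 0 → ff a σ y (σ y) = 2) :
    Psi a col (σ ∘ Equiv.swap x x') - Psi a col σ ≤
      -3 * ff a σ x (σ x) + 2 * FF a col σ false (σ x') (σ x') + ff a σ x (σ x') := by
  have hne : x ≠ x' := by rintro rfl; exact hij rfl
  have ha0 : ∀ u v, 0 ≤ a u v := by
    intro u v; rcases ha u v with h | h <;> omega
  have z : ∀ l, ff a σ x' l = 0 → ∀ y, σ y = l → a x' y = 0 := by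
    intro l hl y hyl
    unfold ff at hl
    rw [Finset.sum_eq_zero_iff_of_nonneg] at hl
    · have := hl y (Finset.mem_univ _)
      simpa [hyl] using this
    · intro u _
      split_ifs
      · exact ha0 _ _
      · exact le_refl _
  have e : -3 * ff a σ x (σ x) + 2 * FF a col σ false (σ x') (σ x') + ff a σ x (σ x') =
      ∑ y, ((-3 * (if σ y = σ x then a x y else 0) +
        2 * (if σ y = σ x' ∧ col y = false then ff a σ y (σ x') else 0)) +
        (if σ y = σ x' then a x y else 0)) := by
    rw [Finset.sum_add_distrib, Finset.sum_add_distrib, ← Finset.mul_sum, ← Finset.mul_sum]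
    unfold FF
    rw [Finset.sum_filter]
    rfl
  rw [e]
  unfold Psi
  rw [← Finset.sum_sub_distrib]
  apply Finset.sum_le_sum
  intro y _
  cases hcy : col y with
  | true =>
    have : a x y = 0 := hc _ _ (by rw [hx, hcy])
    simp [this]
  | false =>
    have hyx : y ≠ x := by rintro rfl; rw [hx] at hcy; simp at hcy
    have hyx' : y ≠ x' := by rintro rfl; rw [hx'] at hcy; simp at hcy
    have hs : (σ ∘ Equiv.swap x x') y = σ y := by
      simp [Equiv.swap_apply_of_ne_of_ne hyx hyx']
    have g := ff_swap_gen (a := a) (σ := σ) hne y (σ y)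
    rw [hs]
    simp only [if_true, and_true]
    rw [hsym y x, hsym y x'] at g
    have f0 := ff_nonneg (σ := σ) ha0 y (σ y)
    by_cases c1 : σ y = σ x
    · have c2 : σ y ≠ σ x' := by rw [c1]; exact hij
      have z1 := z _ h1 y c1
      rw [if_neg (Ne.symm c2), if_pos c1.symm, z1] at g
      rw [if_pos c1, if_neg c2, if_neg c2]
      rcases ha x y with h | h
      · rw [h] at g ⊢
        have : ff a (σ ∘ Equiv.swap x x') y (σ y) = ff a σ y (σ y) := by
          simp at g; omega
        rw [this]; simp
      · have h2 := hy y c1 (by omega)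
        rw [h] at g ⊢
        have : ff a (σ ∘ Equiv.swap x x') y (σ y) = 1 := by
          simp at g; omega
        rw [this, h2]; norm_num
    · rw [if_neg c1]
      by_cases c2 : σ y = σ x'
      · have z1 := z _ h2 y c2
        rw [if_neg (Ne.symm c1), if_pos c2.symm, z1] at g
        rw [if_pos c2, if_pos c2, ← c2]
        rcases ha x y with h | h
        · rw [h] at g ⊢
          have : ff a (σ ∘ Equiv.swap x x') y (σ y) = ff a σ y (σ y) := by
            simp at g; omega
          rw [this]; simp; exact f0
        · rw [h] at g ⊢
          have : ff a (σ ∘ Equiv.swap x x') y (σ y) = ff a σ y (σ y) + 1 := by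
            simp at g; omega
          rw [this]; nlinarith
      · rw [if_neg c2, if_neg c2]
        rw [if_neg (Ne.symm c1), if_neg (Ne.symm c2)] at g
        have : ff a (σ ∘ Equiv.swap x x') y (σ y) = ff a σ y (σ y) := by
          rw [if_neg (Ne.symm c1), if_neg (Ne.symm c2)] at g
          omega
        rw [this]; simp

theorem OptP.no_bad (h : OptP a col mm (ww mm) σ) (hsym : ∀ u v, a u v = a v u)
    (ha : ∀ u v, a u v = 0 ∨ a u v = 1)
    (hc : ∀ u v, col u = col v → a u v = 0) (hk : ∀ v, ∑ u, a v u ≤ (k : ℤ) - 1)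
    (hm : ∀ i, 3 ≤ mm i) (x : V) (hx : col x = true) (hm4 : mm (σ x) = 4)
    (hφ : ff a σ x (σ x) = 2)
    (hy : ∀ y, σ y = σ x → a x y ≠ 0 → ff a σ y (σ y) = 2) : False := by
  have ha0 : ∀ u v, 0 ≤ a u v := by
    intro u v; rcases ha u v with h | h <;> omega
  have hwx : ww mm (σ x) = 3 := by unfold ww; simp [hm4]
  refine contra h.val hsym ha0 hc hk x 2 6 (by norm_num) (by omega) (by omega) ?_
  intro j hj
  have f0 := ff_nonneg (σ := σ) ha0 x j
  have hmj : (3 : ℤ) ≤ mm j := by exact_mod_cast hm j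
  have hF0 := FF_ge h.val (col x) (σ x) j 0 (fun v _ _ => ff_nonneg ha0 v (σ x))
  have hsw : ∀ x', col x' = col x → σ x' = j → 6 + ww mm j * ff a σ x' j ≤
      ww mm j * ff a σ x j + 3 * ff a σ x' (σ x) := by
    intro x' h1 h2
    subst h2
    have e1 := h.swap hsym hc h1.symm (Ne.symm hj)
    rw [hwx, hφ] at e1
    linarith
  by_cases c3 : 3 ≤ ff a σ x j
  · linarith
  by_cases h3 : mm j = 3
  · have hwj : ww mm j = 2 := by unfold ww; simp [h3]
    rw [hwj] at hsw
    by_cases c2 : ff a σ x j = 2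
    · have := FF_ge (a := a) h.val (col x) (σ x) j 1 (by
        intro v hv hcv
        have := hsw v hcv hv
        have := ff_nonneg (σ := σ) ha0 v j
        omega)
      linarith
    · have := FF_ge (a := a) h.val (col x) (σ x) j 2 (by
        intro v hv hcv
        have := hsw v hcv hv
        have := ff_nonneg (σ := σ) ha0 v j
        omega)
      linarith
  · have hwj : ww mm j = 3 := by unfold ww; simp [h3]
    rw [hwj] at hsw
    have hmj4 : (4 : ℤ) ≤ mm j := by
      have := hm j
      omega
    by_cases c2 : ff a σ x j = 2
    · by_contra hcon
      have hF1 : FF a col σ (col x) (σ x) j ≤ 1 := by omega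
      have : ∃ x', σ x' = j ∧ col x' = col x ∧ ff a σ x' (σ x) = 0 := by
        by_contra hne
        push Not at hne
        have := FF_ge (a := a) h.val (col x) (σ x) j 1 (by
          intro v hv hcv
          have h1 := hne v hv hcv
          have h2 := ff_nonneg (σ := σ) ha0 v (σ x)
          omega)
        linarith
      obtain ⟨x', hj', hcx', hx0⟩ := this
      subst hj'
      have hx0' : ff a σ x' (σ x') = 0 := by
        have h1 := hsw x' hcx' rfl
        have h2 := ff_nonneg (σ := σ) ha0 x' (σ x')
        omega
      have hne : x ≠ x' := by rintro rfl; exact hj rfl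
      have p1 := Phi_swap (a := a) (σ := σ) (w := ww mm) hc hne hcx'.symm
      rw [hwx, hwj, hφ, hx0, hx0', c2, hx] at p1
      have p2 := h.o2 _ (Val_swap h.val hcx'.symm) (by linarith)
      have p3 := Psi_swap hsym ha hc hx (hcx'.trans hx) (Ne.symm hj) hx0 hx0' hy
      have p4 : FF a col σ false (σ x') (σ x') ≤ FF a col σ (col x) (σ x) (σ x') := by
        rw [← FF_symm hsym hc, hx]
        unfold FF
        apply Finset.sum_le_sum
        intro v hv
        rw [Finset.mem_filter] at hv
        have := hsw v (hv.2.2.trans hx.symm) hv.2.1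
        omega
      rw [hφ, c2] at p3
      omega
    · have h5 := FF_ge (a := a) h.val (col x) (σ x) j (2 - ff a σ x j) (by
        intro v hv hcv
        have := hsw v hcv hv
        have := ff_nonneg (σ := σ) ha0 v j
        omega)
      have : ff a σ x j = 0 ∨ ff a σ x j = 1 := by omega
      rcases this with h6 | h6 <;> rw [h6] at h5 ⊢ <;> linarith

end
end SubdivEven


namespace SubdivEven
open Finset
set_option linter.unusedSectionVars false

section
variable {V : Type*} [DecidableEq V] {G : SimpleGraph V} {col : V → Bool} {m : ℕ}

/-- A Hamilton path whose ends have large degree sum can be closed up. -/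
theorem ham_close (hcol : ∀ u v, G.Adj u v → col u ≠ col v) {x y : V} {l : List V}
    (h : Pth G x y l) (hl : l.length = 2 * m) (hm : 2 ≤ m)
    (hd : m + 1 ≤ dg G x l.toFinset + dg G y l.toFinset) :
    ∃ l', CycL G l' ∧ l'.length = 2 * m ∧ ∀ v ∈ l', v ∈ l := by
  classical
  rw [← card_nbpos h.nodup, ← card_nbpos h.nodup] at hd
  have hx0 := h.getElem_zero
  have hyl := h.getElem_last
  have hP : ∀ t ∈ nbpos G x l, t % 2 = 1 := by
    intro t ht
    obtain ⟨h1, h2⟩ := mem_nbpos.1 ht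
    have h3 := hcol _ _ h2
    have h4 := h.col_iff hcol (i := 0) (j := t) (by omega) h1
    rw [hx0] at h4
    by_contra h5
    exact h3 (h4.2 (by omega))
  have hQ : ∀ t ∈ nbpos G y l, t % 2 = 0 := by
    intro t ht
    obtain ⟨h1, h2⟩ := mem_nbpos.1 ht
    have h3 := hcol _ _ h2
    have h4 := h.col_iff hcol (i := l.length - 1) (j := t) (by omega) h1
    rw [hyl] at h4
    by_contra h5
    exact h3 (h4.2 (by omega))
  have hlt : ∀ z, ∀ t ∈ nbpos G z l, t < 2 * m := by
    intro z t ht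
    obtain ⟨h1, h2⟩ := mem_nbpos.1 ht
    omega
  have cP : ((nbpos G x l).image (fun t => t / 2)).card = (nbpos G x l).card := by
    apply Finset.card_image_of_injOn
    intro s hs t ht hst
    have h1 := hP s hs
    have h2 := hP t ht
    simp only at hst
    omega
  have cQ : ((nbpos G y l).image (fun t => t / 2)).card = (nbpos G y l).card := by
    apply Finset.card_image_of_injOn
    intro s hs t ht hst
    have h1 := hQ s hs
    have h2 := hQ t ht
    simp only at hst
    omega
  have : ¬ Disjoint ((nbpos G x l).image (fun t => t / 2)) ((nbpos G y l).image (fun t => t / 2)) := by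
    intro hdis
    have h1 := Finset.card_union_of_disjoint hdis
    have h2 : ((nbpos G x l).image (fun t => t / 2)) ∪ ((nbpos G y l).image (fun t => t / 2)) ⊆
        Finset.range m := by
      intro s hs
      rw [Finset.mem_union, Finset.mem_image, Finset.mem_image] at hs
      rw [Finset.mem_range]
      rcases hs with ⟨t, ht, rfl⟩ | ⟨t, ht, rfl⟩
      · have := hlt _ t ht; omega
      · have := hlt _ t ht; omega
    have h3 := Finset.card_le_card h2
    rw [Finset.card_range] at h3
    omega
  rw [Finset.not_disjoint_iff] at this
  obtain ⟨s, hs1, hs2⟩ := this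
  rw [Finset.mem_image] at hs1 hs2
  obtain ⟨t1, ht1, e1⟩ := hs1
  obtain ⟨t, ht, e2⟩ := hs2
  have o1 := hP _ ht1
  have o2 := hQ _ ht
  obtain rfl : t1 = t + 1 := by omega
  obtain ⟨q1, a1⟩ := mem_nbpos.1 ht1
  obtain ⟨q2, a2⟩ := mem_nbpos.1 ht
  obtain ⟨s1, p1, len1, mem1⟩ := h.seg (i := 0) (j := t) (by omega) (by omega)
  obtain ⟨s2, p2, len2, mem2⟩ := h.seg (i := t + 1) (j := l.length - 1) (by omega) (by omega)
  rw [hyl] at p2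
  rw [hx0] at p1
  have p3 := p1.append p2.reverse a2.symm (by
    intro v hv hv'
    rw [List.mem_reverse] at hv'
    obtain ⟨i, hi, -, hi2, rfl⟩ := mem1 v hv
    obtain ⟨j, hj, hj1, -, e⟩ := mem2 _ hv'
    have := h.inj _ _ e
    omega)
  have L : (s1 ++ s2.reverse).length = 2 * m := by
    rw [List.length_append, List.length_reverse]; omega
  refine ⟨_, p3.cyc a1.symm (by omega), L, ?_⟩
  intro v hv
  rw [List.mem_append, List.mem_reverse] at hv
  rcases hv with hv | hv
  · obtain ⟨i, hi, -, hi2, rfl⟩ := mem1 v hv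
    exact List.getElem_mem _
  · obtain ⟨i, hi, -, hi2, rfl⟩ := mem2 v hv
    exact List.getElem_mem _

theorem ham_desc {x y z : V} {l : List V} (h : Pth (G ⊔ SimpleGraph.edge x y) x z l)
    (h1 : ∀ h : 1 < l.length, l[1] ≠ y) : Pth G x z l := by
  refine ⟨?_, h.nodup, h.hd, h.lst⟩
  rw [List.isChain_iff_getElem]
  intro i hi
  have h2 := h.adj i hi
  rw [SimpleGraph.sup_adj, SimpleGraph.edge_adj] at h2
  rcases h2 with h2 | ⟨⟨e1, e2⟩ | ⟨e1, e2⟩, h3⟩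
  · exact h2
  · have := h.inj (i := i) (j := 0) (by omega) (by omega) (by rw [e1, h.getElem_zero])
    subst this
    exact absurd e2 (h1 (by omega))
  · have := h.inj (i := i + 1) (j := 0) (by omega) (by omega) (by rw [e2, h.getElem_zero])
    omega

theorem ham_base {A B : Finset V} (hA : ∀ v ∈ A, col v = true) (hB : ∀ v ∈ B, col v = false)
    (hAm : A.card = m) (hBm : B.card = m) (hm : 2 ≤ m)
    (hadj : ∀ u ∈ A, ∀ v ∈ B, G.Adj u v) :
    ∃ l, CycL G l ∧ l.length = 2 * m ∧ ∀ v ∈ l, v ∈ A ∪ B := by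
  have la : A.toList.length = m := by simp [hAm]
  have lb : B.toList.length = m := by simp [hBm]
  let f : Fin (2 * m) → V := fun t => if t.1 % 2 = 0 then A.toList[t.1 / 2]'(by have := t.2; omega)
    else B.toList[t.1 / 2]'(by have := t.2; omega)
  have f0 : ∀ t : Fin (2 * m), t.1 % 2 = 0 → f t ∈ A := by
    intro t ht
    simp only [f, if_pos ht]
    exact Finset.mem_toList.1 (List.getElem_mem _)
  have f1 : ∀ t : Fin (2 * m), t.1 % 2 = 1 → f t ∈ B := by
    intro t ht
    have : ¬ t.1 % 2 = 0 := by omega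
    simp only [f, if_neg this]
    exact Finset.mem_toList.1 (List.getElem_mem _)
  have finj : Function.Injective f := by
    intro s t hst
    by_cases hs : s.1 % 2 = 0
    · by_cases ht : t.1 % 2 = 0
      · simp only [f, if_pos hs, if_pos ht] at hst
        have := (List.Nodup.getElem_inj_iff A.nodup_toList).1 hst
        ext; omega
      · have h1 := hA _ (f0 s hs)
        have h2 := hB _ (f1 t (by omega))
        rw [hst, h2] at h1
        simp at h1
    · by_cases ht : t.1 % 2 = 0
      · have h1 := hA _ (f0 t ht)
        have h2 := hB _ (f1 s (by omega))
        rw [← hst, h2] at h1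
        simp at h1
      · simp only [f, if_neg hs, if_neg ht] at hst
        have := (List.Nodup.getElem_inj_iff B.nodup_toList).1 hst
        ext; omega
  refine ⟨List.ofFn f, cycL_of (by simp; omega) (List.nodup_ofFn.2 finj) ?_, by simp, ?_⟩
  · intro j hj
    simp only [List.getElem_ofFn]
    have hj' : j < 2 * m := by simpa using hj
    have key : ((j + 1) % (List.ofFn f).length) % 2 ≠ j % 2 := by
      rw [List.length_ofFn]
      by_cases h : j + 1 < 2 * m
      · rw [Nat.mod_eq_of_lt h]; omega
      · have : j + 1 = 2 * m := by omega
        rw [this, Nat.mod_self]; omega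
    by_cases hs : j % 2 = 0
    · exact hadj _ (f0 _ hs) _ (f1 _ (by simp only; omega))
    · exact (hadj _ (f0 _ (by simp only; omega)) _ (f1 _ (by simp only; omega))).symm
  · intro v hv
    rw [List.mem_ofFn] at hv
    obtain ⟨t, rfl⟩ := hv
    rw [Finset.mem_union]
    by_cases ht : t.1 % 2 = 0
    · exact Or.inl (f0 t ht)
    · exact Or.inr (f1 t (by omega))

theorem ham_main {A B : Finset V} (hA : ∀ v ∈ A, col v = true) (hB : ∀ v ∈ B, col v = false)
    (hAm : A.card = m) (hBm : B.card = m) (hm : 2 ≤ m) (s : ℕ) :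
    ∀ (G : SimpleGraph V) (_ : ∀ u v, G.Adj u v → col u ≠ col v) (F : Finset (V × V))
      (_ : F ⊆ A ×ˢ B) (_ : F.card = s)
      (_ : ∀ u ∈ A, ∀ v ∈ B, (u, v) ∉ F → G.Adj u v)
      (_ : ∀ F' ⊆ F, F'.Nonempty → ∃ p ∈ F', (F'.filter (fun q => q.1 = p.1)).card +
        (F'.filter (fun q => q.2 = p.2)).card + 1 ≤ m),
    ∃ l, CycL G l ∧ l.length = 2 * m ∧ ∀ v ∈ l, v ∈ A ∪ B := by
  classical
  induction s with
  | zero =>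
    intro G hcol F hF hs hadj _
    have : F = ∅ := Finset.card_eq_zero.1 hs
    subst this
    exact ham_base hA hB hAm hBm hm (fun u hu v hv => hadj u hu v hv (by simp))
  | succ s ih =>
    intro G hcol F hF hs hadj hcond
    have hne : F.Nonempty := by rw [← Finset.card_pos]; omega
    obtain ⟨⟨x, y⟩, hp, hdeg⟩ := hcond F (Finset.Subset.refl _) hne
    simp only at hdeg
    have hxy := Finset.mem_product.1 (hF hp)
    obtain ⟨hx, hy⟩ : x ∈ A ∧ y ∈ B := hxy
    have hcx := hA x hx
    have hcy := hB y hy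
    have hxny : x ≠ y := by rintro rfl; rw [hcx] at hcy; simp at hcy
    have hcol' : ∀ u v, (G ⊔ SimpleGraph.edge x y).Adj u v → col u ≠ col v := by
      intro u v huv
      rw [SimpleGraph.sup_adj, SimpleGraph.edge_adj] at huv
      rcases huv with h | ⟨⟨rfl, rfl⟩ | ⟨rfl, rfl⟩, -⟩
      · exact hcol _ _ h
      · rw [hcx, hcy]; simp
      · rw [hcx, hcy]; simp
    obtain ⟨l, hl, hlen, hmem⟩ := ih (G ⊔ SimpleGraph.edge x y) hcol' (F.erase (x, y))
      ((Finset.erase_subset _ _).trans hF) (by rw [Finset.card_erase_of_mem hp]; omega) (by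
        intro u hu v hv huv
        rw [SimpleGraph.sup_adj, SimpleGraph.edge_adj]
        by_cases h : (u, v) = (x, y)
        · right
          simp only [Prod.mk.injEq] at h
          obtain ⟨rfl, rfl⟩ := h
          exact ⟨Or.inl ⟨rfl, rfl⟩, hxny⟩
        · left
          exact hadj u hu v hv (fun h' => huv (Finset.mem_erase.2 ⟨h, h'⟩)))
      (fun F' hF' => hcond F' (hF'.trans (Finset.erase_subset _ _)))
    have hAB : Disjoint A B := by
      rw [Finset.disjoint_left]
      intro v h1 h2
      have h3 := hA v h1
      rw [hB v h2] at h3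
      simp at h3
    have full : ∀ l' : List V, l'.Nodup → l'.length = 2 * m → (∀ v ∈ l', v ∈ A ∪ B) →
        l'.toFinset = A ∪ B := by
      intro l' h1 h2 h3
      apply Finset.eq_of_subset_of_card_le
      · intro v hv
        exact h3 v (List.mem_toFinset.1 hv)
      · rw [Finset.card_union_of_disjoint hAB, List.toFinset_card_of_nodup h1]
        omega
    have hxl : x ∈ l := by
      rw [← List.mem_toFinset, full l hl.nodup hlen hmem]
      exact Finset.mem_union_left _ hx
    -- closing a Hamilton path from x to y
    have close : ∀ l' : List V, Pth (G ⊔ SimpleGraph.edge x y) x y l' → l'.length = 2 * m →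
        (∀ v ∈ l', v ∈ A ∪ B) → ∃ l, CycL G l ∧ l.length = 2 * m ∧ ∀ v ∈ l, v ∈ A ∪ B := by
      intro l' h1 h2 h3
      have h4 : Pth G x y l' := ham_desc h1 (by
        intro h5 h6
        have := h1.inj (i := 1) (j := l'.length - 1) h5 (by omega) (by rw [h6, h1.getElem_last])
        omega)
      obtain ⟨l, hl1, hl2, hl3⟩ := ham_close hcol h4 h2 hm (by
        rw [full l' h4.nodup h2 h3]
        have d1 : B.card ≤ dg G x (A ∪ B) + (F.filter (fun q => q.1 = x)).card := by
          unfold dg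
          rw [← Finset.card_filter_add_card_filter_not (s := B) (fun v => G.Adj x v)]
          apply Nat.add_le_add
          · exact Finset.card_le_card (Finset.filter_subset_filter _ Finset.subset_union_right)
          · apply Finset.card_le_card_of_injOn (fun v => (x, v))
            · intro v hv
              simp only [Finset.coe_filter, Set.mem_ofPred_eq] at hv ⊢
              refine ⟨?_, trivial⟩
              by_contra h7
              exact hv.2 (hadj x hx v hv.1 h7)
            · intro u _ v _ huv
              simpa using huv
        have d2 : A.card ≤ dg G y (A ∪ B) + (F.filter (fun q => q.2 = y)).card := by
          unfold dg
          rw [← Finset.card_filter_add_card_filter_not (s := A) (fun v => G.Adj y v)]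
          apply Nat.add_le_add
          · exact Finset.card_le_card (Finset.filter_subset_filter _ Finset.subset_union_left)
          · apply Finset.card_le_card_of_injOn (fun v => (v, y))
            · intro v hv
              simp only [Finset.coe_filter, Set.mem_ofPred_eq] at hv ⊢
              refine ⟨?_, trivial⟩
              by_contra h7
              exact hv.2 (hadj v hv.1 y hy h7).symm
            · intro u _ v _ huv
              simpa using huv
        omega)
      exact ⟨l, hl1, hl2, fun v hv => h3 v (hl3 v hv)⟩
    obtain ⟨l', z, h1, h2, h3⟩ := hl.rot hxl
    have len' : l'.length = 2 * m := by rw [h3.length_eq, hlen]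
    have mem' : ∀ v ∈ l', v ∈ A ∪ B := fun v hv => hmem v (h3.mem_iff.1 hv)
    by_cases hz : z = y
    · subst hz
      exact close l' h1 len' mem'
    by_cases h5 : l'[1]'(by omega) = y
    · obtain ⟨t, p1, len1, mem1⟩ := h1.seg (i := 1) (j := l'.length - 1) (by omega) (by omega)
      rw [h5, h1.getElem_last] at p1
      have p2 := p1.reverse.cons h2.symm (by
        intro h6
        rw [List.mem_reverse] at h6
        obtain ⟨i, hi, hi1, -, e⟩ := mem1 _ h6
        have := h1.inj (i := 0) (j := i) (by omega) hi (by rw [h1.getElem_zero, ← e])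
        omega)
      refine close _ p2 (by rw [List.length_cons, List.length_reverse]; omega) ?_
      intro v hv
      rw [List.mem_cons, List.mem_reverse] at hv
      rcases hv with rfl | hv
      · exact Finset.mem_union_left _ hx
      · obtain ⟨i, hi, hi1, -, rfl⟩ := mem1 _ hv
        exact mem' _ (List.getElem_mem _)
    · have p1 := ham_desc h1 (fun _ => h5)
      refine ⟨l', p1.cyc ?_ (by omega), len', mem'⟩
      rw [SimpleGraph.sup_adj, SimpleGraph.edge_adj] at h2
      rcases h2 with h2 | ⟨⟨-, h6⟩ | ⟨h6, -⟩, -⟩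
      · exact h2
      · exact absurd h6 hxny
      · exact absurd h6 hz

end
end SubdivEven


namespace SubdivEven
open Finset
set_option linter.unusedSectionVars false

section
variable {V : Type*} [Fintype V] [DecidableEq V] {k : ℕ} {mm : Fin k → ℕ} {G : SimpleGraph V}
  {col : V → Bool}

theorem caseII (hcol : ∀ u v, G.Adj u v → col u ≠ col v)
    (hm : ∀ i, 3 ≤ mm i) (hD : ∀ v, ∑ i, (mm i - 1) + 1 ≤ dg G v Finset.univ)
    (hX : ∀ β, (Finset.univ.filter (fun v : V => col v = β)).card = ∑ i, mm i) :
    ∃ c : Fin k → List V, (∀ i, CycL G (c i) ∧ 2 * mm i ≤ (c i).length) ∧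
      ∀ i j, i ≠ j → ∀ x ∈ c i, x ∉ c j := by
  classical
  let a : V → V → ℤ := fun u v => if col u ≠ col v ∧ ¬ G.Adj u v then 1 else 0
  have hsym : ∀ u v, a u v = a v u := by
    intro u v
    simp only [a, G.adj_comm u v, ne_comm (a := col u)]
  have ha : ∀ u v, a u v = 0 ∨ a u v = 1 := by
    intro u v
    simp only [a]
    split_ifs <;> simp
  have ha0 : ∀ u v, 0 ≤ a u v := by
    intro u v; rcases ha u v with h | h <;> omega
  have hc : ∀ u v, col u = col v → a u v = 0 := by
    intro u v h
    simp [a, h]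
  have hk : ∀ v, ∑ u, a v u ≤ (k : ℤ) - 1 := by
    intro v
    have h1 : ∑ u, a v u =
        ((Finset.univ.filter (fun u => col v ≠ col u ∧ ¬ G.Adj v u)).card : ℤ) := by
      simp [a]
    have h2 : (Finset.univ.filter (fun u => col v ≠ col u ∧ ¬ G.Adj v u)).card +
        dg G v Finset.univ ≤ ∑ i, mm i := by
      rw [← hX (!col v)]
      unfold dg
      rw [← Finset.card_union_of_disjoint]
      · apply Finset.card_le_card
        intro u hu
        simp only [Finset.mem_union, Finset.mem_filter, Finset.mem_univ, true_and] at hu ⊢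
        have h3 : col v ≠ col u := by
          rcases hu with hu | hu
          · exact hu.1
          · exact hcol _ _ hu
        revert h3
        cases col u <;> cases col v <;> simp
      · rw [Finset.disjoint_left]
        intro u h3 h4
        rw [Finset.mem_filter] at h3 h4
        exact h3.2.2 h4.2
    have h3 := hD v
    have h4 : ∑ i, (mm i - 1) + k = ∑ i, mm i := by
      have : ∑ i : Fin k, mm i = ∑ i : Fin k, ((mm i - 1) + 1) := by
        apply Finset.sum_congr rfl
        intro i _
        have := hm i
        omega
      rw [this, Finset.sum_add_distrib]
      simp
    rw [h1]
    omega
  obtain ⟨σ, hσ⟩ := exists_OptP (mm := mm) a (ww mm) hX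
  have hbound := hσ.bound hsym ha0 hc hk hm
  have hbad := hσ.no_bad hsym ha hc hk hm
  have main : ∀ i, ∃ l, CycL G l ∧ l.length = 2 * mm i ∧ ∀ v ∈ l, σ v = i := by
    intro i
    let A := Finset.univ.filter (fun v => σ v = i ∧ col v = true)
    let B := Finset.univ.filter (fun v => σ v = i ∧ col v = false)
    let F := (A ×ˢ B).filter (fun p => ¬ G.Adj p.1 p.2)
    have hAmem : ∀ v, v ∈ A ↔ σ v = i ∧ col v = true := by intro v; simp [A]
    have hBmem : ∀ v, v ∈ B ↔ σ v = i ∧ col v = false := by intro v; simp [B]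
    have hFmem : ∀ u v, (u, v) ∈ F ↔ (u ∈ A ∧ v ∈ B) ∧ ¬ G.Adj u v := by
      intro u v
      simp [F]
    have hff : ∀ x, ff a σ x i = ((Finset.univ.filter (fun u => σ u = i ∧ a x u = 1)).card : ℤ) := by
      intro x
      unfold ff
      rw [Finset.card_filter]
      push_cast
      apply Finset.sum_congr rfl
      intro u _
      by_cases h1 : σ u = i
      · rcases ha x u with h2 | h2 <;> simp [h1, h2]
      · simp [h1]
    have ha1 : ∀ x y, (x, y) ∈ F → a x y = 1 := by
      intro x y hxy
      rw [hFmem, hAmem, hBmem] at hxy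
      have : col x ≠ col y := by rw [hxy.1.1.2, hxy.1.2.2]; simp
      simp [a, this, hxy.2]
    have g1 : ∀ x, ((F.filter (fun q => q.1 = x)).card : ℤ) ≤ ff a σ x i := by
      intro x
      rw [hff]
      norm_cast
      apply Finset.card_le_card_of_injOn (fun q => q.2)
      · rintro ⟨u, v⟩ hq
        simp only [Finset.coe_filter, Set.mem_ofPred_eq] at hq ⊢
        obtain ⟨hq, rfl⟩ := hq
        have := (hFmem _ _).1 hq
        exact ⟨Finset.mem_univ _, ((hBmem _).1 this.1.2).1, ha1 _ _ hq⟩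
      · rintro ⟨u, v⟩ hq ⟨u', v'⟩ hq' h
        simp only [Finset.coe_filter, Set.mem_ofPred_eq] at hq hq'
        simp only at h
        rw [hq.2, hq'.2, h]
    have g2 : ∀ y, ((F.filter (fun q => q.2 = y)).card : ℤ) ≤ ff a σ y i := by
      intro x
      rw [hff]
      norm_cast
      apply Finset.card_le_card_of_injOn (fun q => q.1)
      · rintro ⟨u, v⟩ hq
        simp only [Finset.coe_filter, Set.mem_ofPred_eq] at hq ⊢
        obtain ⟨hq, rfl⟩ := hq
        have := (hFmem _ _).1 hq
        exact ⟨Finset.mem_univ _, ((hAmem _).1 this.1.1).1, by rw [hsym]; exact ha1 _ _ hq⟩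
      · rintro ⟨u, v⟩ hq ⟨u', v'⟩ hq' h
        simp only [Finset.coe_filter, Set.mem_ofPred_eq] at hq hq'
        simp only at h
        rw [hq.2, hq'.2, h]
    have hmi := hm i
    obtain ⟨l, h1, h2, h3⟩ := ham_main (col := col) (m := mm i) (A := A) (B := B)
      (fun v hv => ((hAmem v).1 hv).2)
      (fun v hv => ((hBmem v).1 hv).2) (hσ.val i true) (hσ.val i false) (by omega) _ G hcol F
      (Finset.filter_subset _ _) rfl (by
        intro u hu v hv huv
        by_contra h
        exact huv ((hFmem _ _).2 ⟨⟨hu, hv⟩, h⟩)) (by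
        intro F' hF' hne
        have g1' : ∀ x, ((F'.filter (fun q => q.1 = x)).card : ℤ) ≤ ff a σ x i := fun x =>
          le_trans (by exact_mod_cast Finset.card_le_card (Finset.filter_subset_filter _ hF')) (g1 x)
        have g2' : ∀ x, ((F'.filter (fun q => q.2 = x)).card : ℤ) ≤ ff a σ x i := fun x =>
          le_trans (by exact_mod_cast Finset.card_le_card (Finset.filter_subset_filter _ hF')) (g2 x)
        have hin : ∀ x y, (x, y) ∈ F' → σ x = i ∧ σ y = i ∧ col x = true := by
          intro x y h
          have := (hFmem _ _).1 (hF' h)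
          rw [hAmem, hBmem] at this
          exact ⟨this.1.1.1, this.1.2.1, this.1.1.2⟩
        obtain ⟨⟨x, y⟩, hp⟩ := hne
        obtain ⟨sx, sy, cx⟩ := hin x y hp
        have bx := hbound x
        have bd : ∀ z, σ z = i → 3 * ff a σ z i < mm i + 3 := by
          intro z hz
          have := hbound z
          rwa [hz] at this
        by_cases h4 : mm i = 4
        · by_contra hcon
          push Not at hcon
          have two : ∀ x y, (x, y) ∈ F' → (F'.filter (fun q => q.1 = x)).card = 2 ∧
              ff a σ x i = 2 ∧ ff a σ y i = 2 := by
            intro x y h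
            have e1 := hcon (x, y) h
            obtain ⟨sx, sy, cx⟩ := hin x y h
            have e2 := bd x sx
            have e3 := bd y sy
            have e4 := g1' x
            have e5 := g2' y
            simp only at e1
            omega
          obtain ⟨t1, t2, t3⟩ := two x y hp
          refine hbad x cx (by rw [sx, h4]) (by rw [sx, t2]) ?_
          intro y' hy' hay'
          rw [sx] at hy'
          have eqF : F'.filter (fun q => q.1 = x) = F.filter (fun q => q.1 = x) := by
            apply Finset.eq_of_subset_of_card_le (Finset.filter_subset_filter _ hF')
            have := g1 x
            omega
          have hy'F : (x, y') ∈ F'.filter (fun q => q.1 = x) := by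
            rw [eqF, Finset.mem_filter, hFmem, hAmem, hBmem]
            have : col x ≠ col y' ∧ ¬ G.Adj x y' := by
              by_contra h
              exact hay' (by simp only [a]; rw [if_neg h])
            refine ⟨⟨⟨⟨sx, cx⟩, hy', ?_⟩, this.2⟩, rfl⟩
            have := this.1
            rw [cx] at this
            revert this
            cases col y' <;> simp
          rw [hy']
          exact (two x y' (Finset.mem_filter.1 hy'F).1).2.2
        · refine ⟨(x, y), hp, ?_⟩
          have e2 := bd x sx
          have e3 := bd y sy
          have e4 := g1' x
          have e5 := g2' y
          simp only
          omega)
    refine ⟨l, h1, h2, ?_⟩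
    intro v hv
    have := h3 v hv
    rw [Finset.mem_union, hAmem, hBmem] at this
    rcases this with h | h <;> exact h.1
  choose c hc1 hc2 hc3 using main
  refine ⟨c, fun i => ⟨hc1 i, (hc2 i).ge⟩, ?_⟩
  intro i j hij x hx hx'
  exact hij ((hc3 i x hx).symm.trans (hc3 j x hx'))

end
end SubdivEven


namespace SubdivEven
open Finset
set_option linter.unusedSectionVars false

theorem Pth.toWalk {V : Type*} {G : SimpleGraph V} {b : V} :
    ∀ (l : List V) (a : V), Pth G a b l → ∃ p : G.Walk a b, p.support = l := by
  intro l
  induction l with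
  | nil => intro a h; exact absurd rfl h.ne_nil
  | cons x l ih =>
    intro a h
    obtain rfl : x = a := by simpa using h.hd
    cases l with
    | nil =>
      obtain rfl : x = b := by simpa using h.lst
      exact ⟨SimpleGraph.Walk.nil, rfl⟩
    | cons y l =>
      have hc := List.isChain_cons_cons.1 h.chain
      have h' : Pth G y b (y :: l) := ⟨hc.2, (List.nodup_cons.1 h.nodup).2, rfl, by
        have := h.lst
        rwa [List.getLast?_cons_cons] at this⟩
      obtain ⟨p, hp⟩ := ih y h'
      exact ⟨SimpleGraph.Walk.cons hc.1 p, by simp [hp]⟩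

/-- A component of a 2-regular graph, listed as a cycle. -/
theorem component_list {W : Type*} [Fintype W] (H : SimpleGraph W) [DecidableRel H.Adj]
    (hdeg2 : ∀ w, H.degree w = 2) (r : W) :
    ∃ g : ℕ → W, ∃ L : ℕ, L = {w | H.Reachable w r}.ncard ∧ 0 < L ∧
      (∀ s t, s < L → t < L → g s = g t → s = t) ∧
      (∀ t, t < L → H.Reachable (g t) r) ∧
      (∀ w, H.Reachable w r → ∃ t, t < L ∧ g t = w) ∧
      (∀ a b, H.Reachable a r → H.Adj a b → ∃ t, t < L ∧ s(g t, g ((t + 1) % L)) = s(a, b)) := by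
  classical
  have hcard : ∀ w, (H.neighborSet w).ncard = 2 := by
    intro w
    rw [← hdeg2 w, ← H.card_neighborSet_eq_degree, Set.ncard_eq_toFinset_card', Set.toFinset_card]
  have hcyc : H.IsCycles := fun w _ => hcard w
  obtain ⟨p, hp, hv⟩ := hcyc.exists_cycle_toSubgraph_verts_eq_connectedComponentSupp
    (c := H.connectedComponentMk r) (v := r) (by simp)
    (Set.nonempty_of_ncard_ne_zero (by rw [hcard]; norm_num))
  have hmem : ∀ w, w ∈ p.support ↔ H.Reachable w r := by
    intro w
    rw [← p.mem_verts_toSubgraph, hv, SimpleGraph.ConnectedComponent.mem_supp_iff,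
      SimpleGraph.ConnectedComponent.eq]
  have h3 := hp.three_le_length
  have inj : ∀ s t, s < p.length → t < p.length → p.getVert s = p.getVert t → s = t := by
    intro s t hs ht hst
    exact hp.getVert_injOn' (by rw [Set.mem_ofPred_eq]; omega) (by rw [Set.mem_ofPred_eq]; omega) hst
  have sur : ∀ w, H.Reachable w r → ∃ t, t < p.length ∧ p.getVert t = w := by
    intro w hw
    obtain ⟨t, ht, hle⟩ := SimpleGraph.Walk.mem_support_iff_exists_getVert.1 ((hmem w).2 hw)
    by_cases h : t = p.length
    · refine ⟨0, by omega, ?_⟩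
      rw [← ht, h]; simp
    · exact ⟨t, by omega, ht⟩
  refine ⟨p.getVert, p.length, ?_, by omega, inj, ?_, sur, ?_⟩
  · have : {w | H.Reachable w r} = p.getVert '' (Set.Iio p.length) := by
      ext w
      constructor
      · intro hw
        obtain ⟨t, ht, e⟩ := sur w hw
        exact ⟨t, ht, e⟩
      · rintro ⟨t, ht, rfl⟩
        exact (hmem _).1 (p.getVert_mem_support t)
    have io : Set.InjOn p.getVert (Set.Iio p.length) := by
      intro s hs t ht hst
      exact inj s t hs ht hst
    rw [this, io.ncard_image]
    simp [Set.ncard_eq_toFinset_card']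
  · intro t _
    exact (hmem _).1 (p.getVert_mem_support t)
  · intro a b ha hab
    have h4 := (hp.adj_toSubgraph_iff_of_isCycles hcyc (v := a)
      (by rw [p.mem_verts_toSubgraph]; exact (hmem a).2 ha) b).2 hab
    obtain ⟨i, hi, hlt⟩ := (p.toSubgraph_adj_iff).1 h4
    refine ⟨i, hlt, ?_⟩
    rw [← hi]
    by_cases h : i + 1 < p.length
    · rw [Nat.mod_eq_of_lt h]
    · have : i + 1 = p.length := by omega
      rw [this, Nat.mod_self]
      simp

end SubdivEven


namespace SubdivEven
open Finset
set_option linter.unusedSectionVars false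

theorem convert_sub {W V : Type*} [Fintype W] (H : SimpleGraph W) [DecidableRel H.Adj]
    (G : SimpleGraph V) {k : ℕ} (rep : Fin k → W)
    (hrep₁ : ∀ i j, i ≠ j → ¬ H.Reachable (rep i) (rep j))
    (hrep₂ : ∀ w, ∃ i, H.Reachable w (rep i))
    (hdeg2 : ∀ w, H.degree w = 2)
    (c : Fin k → List V)
    (hc : ∀ i, CycL G (c i) ∧ {w | H.Reachable w (rep i)}.ncard ≤ (c i).length)
    (hdis : ∀ i j, i ≠ j → ∀ x ∈ c i, x ∉ c j) : ContainsSubdivision H G := by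
  classical
  choose g L hL hL0 ginj greach gsur gadj using fun i => component_list H hdeg2 (rep i)
  choose comp hcomp using hrep₂
  have comp_eq : ∀ w i, H.Reachable w (rep i) → comp w = i := by
    intro w i h
    by_contra hne
    exact hrep₁ _ _ hne ((hcomp w).symm.trans h)
  choose pos hpos hgpos using fun w => gsur (comp w) w (hcomp w)
  have hlen : ∀ i, L i ≤ (c i).length := fun i => by rw [hL]; exact (hc i).2
  let φ : W → V := fun w => (c (comp w))[pos w]'(lt_of_lt_of_le (hpos w) (hlen _))
  have hφg : ∀ i t (ht : t < L i), φ (g i t) = (c i)[t]'(lt_of_lt_of_le ht (hlen _)) := by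
    intro i t ht
    have e1 : comp (g i t) = i := comp_eq _ _ (greach i t ht)
    have e2 : pos (g i t) = t := by
      have h1 := hpos (g i t)
      have h2 := hgpos (g i t)
      rw [e1] at h1 h2
      exact ginj i _ _ h1 ht h2
    simp only [φ, e1, e2]
  have hφc : ∀ w, φ w ∈ c (comp w) := fun w => List.getElem_mem _
  -- a branch vertex is at a small position
  have hbr : ∀ w i t (ht : t < (c i).length), φ w = (c i)[t] → comp w = i ∧ pos w = t := by
    intro w i t ht h
    have e1 : comp w = i := by
      by_contra hne
      exact hdis _ _ hne _ (hφc w) (by rw [h]; exact List.getElem_mem _)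
    subst e1
    exact ⟨rfl, (List.Nodup.getElem_inj_iff (hc _).1.nodup).1 h⟩
  have φinj : Function.Injective φ := by
    intro u v h
    have h1 := hbr u (comp v) (pos v) _ h
    rw [← hgpos u, ← hgpos v, h1.1, h1.2]
  have hone : ∀ i t (ht : t < L i), ∃ p : G.Walk (φ (g i t)) (φ (g i ((t + 1) % L i))), p.IsPath ∧
      ∀ v ∈ p.support, v = φ (g i t) ∨ v = φ (g i ((t + 1) % L i)) ∨
        (t + 1 = L i ∧ ∃ s, ∃ hs : s < (c i).length, L i ≤ s ∧ v = (c i)[s]) := by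
    intro i t ht
    obtain ⟨x, y, hP, hadj, h3⟩ := (hc i).1
    have hleni := hlen i
    by_cases h : t + 1 < L i
    · have hm : (t + 1) % L i = t + 1 := Nat.mod_eq_of_lt h
      rw [hm]
      have ha : G.Adj (φ (g i t)) (φ (g i (t + 1))) := by
        rw [hφg i t ht, hφg i (t + 1) h]
        exact hP.adj t (by omega)
      refine ⟨ha.toWalk, SimpleGraph.Walk.IsPath.of_adj ha, ?_⟩
      intro v hv
      simp at hv
      tauto
    · have ht1 : t + 1 = L i := by omega
      have hm : (t + 1) % L i = 0 := by rw [ht1, Nat.mod_self]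
      rw [hm]
      have h0 := hL0 i
      by_cases hL1 : t = 0
      · subst hL1
        refine ⟨SimpleGraph.Walk.nil, by simp, ?_⟩
        intro v hv
        simp at hv
        tauto
      obtain ⟨s, p1, len1, mem1⟩ := hP.seg (i := t) (j := (c i).length - 1) (by omega) (by omega)
      rw [hP.getElem_last] at p1
      have p2 := p1.append (Pth.single x) hadj (by
        intro v hv hv'
        rw [List.mem_singleton] at hv'
        subst hv'
        obtain ⟨j, hj, h1, -, e⟩ := mem1 _ hv
        have := hP.inj (i := 0) (j := j) (by omega) hj (by rw [hP.getElem_zero, ← e])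
        omega)
      have e1 : (c i)[t] = φ (g i t) := (hφg i t ht).symm
      have e2 : x = φ (g i 0) := by rw [hφg i 0 (by omega), hP.getElem_zero]
      rw [e1, e2] at p2
      obtain ⟨p, hp⟩ := Pth.toWalk _ _ p2
      refine ⟨p, ?_, ?_⟩
      · rw [SimpleGraph.Walk.isPath_def, hp]
        exact p2.nodup
      · intro v hv
        rw [hp, List.mem_append, List.mem_singleton] at hv
        rcases hv with hv | hv
        · obtain ⟨j, hj, h1, -, e⟩ := mem1 _ hv
          by_cases hjt : j = t
          · left
            subst hjt
            rw [e, e1]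
          · right; right
            exact ⟨ht1, j, hj, by omega, e⟩
        · exact Or.inr (Or.inl hv)
  have hedge : ∀ a b, H.Adj a b → ∃ p : G.Walk (φ a) (φ b), p.IsPath ∧
      ∀ v ∈ p.support, v = φ a ∨ v = φ b ∨
        ∃ i, s(a, b) = s(g i (L i - 1), g i 0) ∧
          ∃ s, ∃ hs : s < (c i).length, L i ≤ s ∧ v = (c i)[s] := by
    intro a b hab
    obtain ⟨t, ht, e⟩ := gadj (comp a) a b (hcomp a) hab
    obtain ⟨p, hp1, hp2⟩ := hone (comp a) t ht
    have hex : ∀ v ∈ p.support, v = φ (g (comp a) t) ∨ v = φ (g (comp a) ((t + 1) % L (comp a))) ∨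
        ∃ i, s(a, b) = s(g i (L i - 1), g i 0) ∧
          ∃ s, ∃ hs : s < (c i).length, L i ≤ s ∧ v = (c i)[s] := by
      intro v hv
      rcases hp2 v hv with h | h | ⟨h1, h2⟩
      · exact Or.inl h
      · exact Or.inr (Or.inl h)
      · refine Or.inr (Or.inr ⟨comp a, ?_, h2⟩)
        rw [← e, h1, Nat.mod_self, ← h1]
        rfl
    rw [Sym2.eq_iff] at e
    generalize hG1 : g (comp a) t = u1 at p hp1 hp2 hex e
    generalize hG2 : g (comp a) ((t + 1) % L (comp a)) = u2 at p hp1 hp2 hex e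
    rcases e with ⟨rfl, rfl⟩ | ⟨rfl, rfl⟩
    · exact ⟨p, hp1, hex⟩
    · refine ⟨p.reverse, hp1.reverse, ?_⟩
      intro v hv
      rw [SimpleGraph.Walk.support_reverse, List.mem_reverse] at hv
      rcases hex v hv with h | h | h
      · exact Or.inr (Or.inl h)
      · exact Or.inl h
      · exact Or.inr (Or.inr h)
  choose P hP1 hP2 using hedge
  have hnr : ∀ i s (hs : s < (c i).length), L i ≤ s → ∀ w, φ w ≠ (c i)[s] := by
    intro i s hs hLs w h
    obtain ⟨h1, h2⟩ := hbr w i s hs h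
    have h3 := hpos w
    rw [h1, h2] at h3
    omega
  refine ⟨⟨φ, φinj⟩, P, hP1, ?_, ?_⟩
  · intro a b h v hv
    rcases hP2 a b h v hv with h1 | h1 | ⟨i, -, s, hs, hLs, h1⟩
    · exact Or.inr (Or.inl h1)
    · exact Or.inr (Or.inr h1)
    · left
      rintro ⟨w, hw⟩
      exact hnr i s hs hLs w (hw.trans h1)
  · intro a b h a' b' h' hne v hv hv'
    have f1 := hP2 a b h v hv
    have f2 := hP2 a' b' h' v hv'
    have key : ∀ w i, (∃ s, ∃ hs : s < (c i).length, L i ≤ s ∧ v = (c i)[s]) → v ≠ φ w := by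
      rintro w i ⟨s, hs, hLs, h1⟩ h2
      exact hnr i s hs hLs w (h2.symm.trans h1)
    have g1 : v = φ a ∨ v = φ b := by
      rcases f1 with h1 | h1 | ⟨i, e, h1⟩
      · exact Or.inl h1
      · exact Or.inr h1
      · exfalso
        rcases f2 with h2 | h2 | ⟨j, e', h2⟩
        · exact key _ _ h1 h2
        · exact key _ _ h1 h2
        · obtain ⟨s, hs, -, hvs⟩ := h1
          obtain ⟨t, ht, -, hvt⟩ := h2
          by_cases hij : i = j
          · subst hij
            exact hne (e.trans e'.symm)
          · exact hdis i j hij v (by rw [hvs]; exact List.getElem_mem _)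
              (by rw [hvt]; exact List.getElem_mem _)
    refine ⟨g1, ?_⟩
    rcases f2 with h2 | h2 | ⟨j, e', h2⟩
    · exact Or.inl h2
    · exact Or.inr h2
    · exfalso
      rcases g1 with h1 | h1
      · exact key _ _ h2 h1
      · exact key _ _ h2 h1

end SubdivEven

/-- Let H be a graph of order n with k components, each of which is an
even cycle of length at least 6 (a finite connected graph in which every vertex has
degree 2 is a cycle, whose length is the number of vertices of the component).
Let G be a bipartite graph with bipartition (X,Y), |X| = |Y| ≥ n/2. If
δ(G) ≥ n/2 − k + 1, then G contains a subdivision of H. -/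
theorem subdivision_of_disjoint_even_cycles
    {W V : Type*} [Fintype W] [Fintype V] [DecidableEq V]
    (H : SimpleGraph W) [DecidableRel H.Adj]
    (G : SimpleGraph V) [DecidableRel G.Adj]
    (n k : ℕ) (hn : Fintype.card W = n)
    (rep : Fin k → W)
    (hrep₁ : ∀ i j, i ≠ j → ¬ H.Reachable (rep i) (rep j))
    (hrep₂ : ∀ w, ∃ i, H.Reachable w (rep i))
    (hdeg2 : ∀ w, H.degree w = 2)
    (hcomp : ∀ i, Even {w | H.Reachable w (rep i)}.ncard ∧
      6 ≤ {w | H.Reachable w (rep i)}.ncard)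
    (X Y : Finset V) (hdisj : Disjoint X Y) (hcover : X ∪ Y = Finset.univ)
    (hbip : ∀ a b, G.Adj a b → (a ∈ X ∧ b ∈ Y) ∨ (a ∈ Y ∧ b ∈ X))
    (hcard : X.card = Y.card) (hbig : n ≤ 2 * X.card)
    (hdeg : n / 2 - k + 1 ≤ G.minDegree) :
    ContainsSubdivision H G := by
  classical
  choose mm hmm using fun i => (hcomp i).1
  have hm : ∀ i, 3 ≤ mm i := by
    intro i
    have := (hcomp i).2
    have := hmm i
    omega
  choose comp hcmp using hrep₂
  have comp_iff : ∀ w i, comp w = i ↔ H.Reachable w (rep i) := by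
    intro w i
    constructor
    · rintro rfl; exact hcmp w
    · intro h
      by_contra hne
      exact hrep₁ _ _ hne ((hcmp w).symm.trans h)
  have hnsum : n = 2 * ∑ i, mm i := by
    rw [← hn, ← Finset.card_univ, Finset.card_eq_sum_card_fiberwise (f := comp) (t := Finset.univ)
      (fun _ _ => Finset.mem_coe.2 (Finset.mem_univ _)), Finset.mul_sum]
    apply Finset.sum_congr rfl
    intro i _
    have h1 := hmm i
    have h2 : {w | H.Reachable w (rep i)} =
        ((Finset.univ.filter (fun w => comp w = i) : Finset W) : Set W) := by
      ext w
      simp [comp_iff]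
    rw [h2, Set.ncard_coe_finset] at h1
    omega
  have hsub : ∑ i, (mm i - 1) + k = ∑ i, mm i := by
    have : ∑ i : Fin k, mm i = ∑ i : Fin k, ((mm i - 1) + 1) := by
      apply Finset.sum_congr rfl
      intro i _
      have := hm i
      omega
    rw [this, Finset.sum_add_distrib]
    simp
  let col : V → Bool := fun v => decide (v ∈ X)
  have hXY : ∀ v, v ∈ Y ↔ v ∉ X := by
    intro v
    constructor
    · intro h1 h2
      exact Finset.disjoint_left.1 hdisj h2 h1
    · intro h
      have : v ∈ X ∪ Y := by rw [hcover]; exact Finset.mem_univ v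
      rcases Finset.mem_union.1 this with h' | h'
      · exact absurd h' h
      · exact h'
  have hcol : ∀ u v, G.Adj u v → col u ≠ col v := by
    intro u v h
    have := hbip u v h
    rw [hXY, hXY] at this
    simp only [col]
    rcases this with ⟨h1, h2⟩ | ⟨h1, h2⟩ <;> simp [h1, h2]
  have hD : ∀ v, ∑ i, (mm i - 1) + 1 ≤ SubdivEven.dg G v Finset.univ := by
    intro v
    have h1 := G.minDegree_le_degree v
    have h2 : G.degree v = SubdivEven.dg G v Finset.univ := by
      rw [← SimpleGraph.card_neighborFinset_eq_degree]
      unfold SubdivEven.dg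
      congr 1
      ext u
      simp
    omega
  have hXt : (Finset.univ.filter (fun v : V => col v = true)) = X := by
    ext v; simp [col]
  have hXf : (Finset.univ.filter (fun v : V => col v = false)) = Y := by
    ext v; simp [col, hXY]
  have hVc : Fintype.card V = X.card + Y.card := by
    rw [← Finset.card_univ, ← hcover, Finset.card_union_of_disjoint hdisj]
  have fin : ∃ c : Fin k → List V, (∀ i, SubdivEven.CycL G (c i) ∧ 2 * mm i ≤ (c i).length) ∧
      ∀ i j, i ≠ j → ∀ x ∈ c i, x ∉ c j := by
    by_cases hN : 2 * ∑ i, mm i + 2 ≤ Fintype.card V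
    · refine SubdivEven.caseI hcol hm hD ?_ hN
      rw [SubdivEven.sum_sg, hXt, hXf, hcard]
      simp
    · refine SubdivEven.caseII hcol hm hD ?_
      intro β
      cases β
      · rw [hXf]; omega
      · rw [hXt]; omega
  obtain ⟨c, hc1, hc2⟩ := fin
  refine SubdivEven.convert_sub H G rep hrep₁ (fun w => ⟨comp w, hcmp w⟩) hdeg2 c ?_ hc2
  intro i
  refine ⟨(hc1 i).1, ?_⟩
  have h1 := (hc1 i).2
  have h2 := hmm i
  omega
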